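/- Let F be an algebraically closed field of characteristic 0 and let g be the simple Lie algebra of type E8 over F (equivalently, a finite-dimensional simple Lie algebra over F with dim g = 248). Then there exists a grading of g by the group (ℤ/2ℤ)^5 such that dim g_α = 8 for every nonzero α ∈ (ℤ/2ℤ)^5 (so necessarily g_0 = 0), and any two such gradings of g are equivalent. -/

import Mathlib

open Module

/-- A grading of the Lie algebra `L` over `F` by the additive group `A`:
a direct sum decomposition into subspaces compatible with the bracket. -/
def IsLieGrading (F : Type*) {A L : Type*} [Field F] [AddCommGroup A] [DecidableEq A]
    [LieRing L] [LieAlgebra F L] (gr : A → Submodule F L) : Prop :=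
  DirectSum.IsInternal gr ∧
    ∀ a b : A, ∀ x ∈ gr a, ∀ y ∈ gr b, ⁅x, y⁆ ∈ gr (a + b)

/-- Two gradings of `L` are equivalent if some automorphism of `L` maps each nonzero
homogeneous component of the first grading onto a homogeneous component of the second. -/
def GradingsEquiv (F : Type*) {A B L : Type*} [Field F] [AddCommGroup A] [AddCommGroup B]
    [LieRing L] [LieAlgebra F L] (gr : A → Submodule F L) (gr' : B → Submodule F L) : Prop :=
  ∃ φ : L ≃ₗ⁅F⁆ L, ∀ a : A, gr a ≠ ⊥ →
    ∃ b : B, (gr a).map φ.toLinearEquiv.toLinearMap = gr' b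

namespace LieAlgebra.Basis

open LieSubalgebra Set

section Iso

variable {ι K L₁ L₂ : Type*} [Finite ι] [Field K]
  [LieRing L₁] [LieRing L₂]
  [LieAlgebra K L₁] {H₁ : LieSubalgebra K L₁} (b₁ : Basis ι H₁)
  [LieAlgebra K L₂] {H₂ : LieSubalgebra K L₂} (b₂ : Basis ι H₂)

/-- The diagonal subalgebra of a product generated by two bases with the same indices. -/
def diag : LieSubalgebra K (L₁ × L₂) :=
  .lieSpan K _ (range (fun i ↦ (b₁.e i, b₂.e i)) ∪ range (fun i ↦ (b₁.f i, b₂.f i)))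

/-- Diagonal raising operator. -/
def diagE (i : ι) : diag b₁ b₂ := ⟨(b₁.e i, b₂.e i), subset_lieSpan (.inl ⟨i, rfl⟩)⟩

/-- Diagonal lowering operator. -/
def diagF (i : ι) : diag b₁ b₂ := ⟨(b₁.f i, b₂.f i), subset_lieSpan (.inr ⟨i, rfl⟩)⟩

lemma lie_e_f_prod (i : ι) :
    ⁅(b₁.e i, b₂.e i), (b₁.f i, b₂.f i)⁆ = (b₁.h i, b₂.h i) := by
  simp [(b₁.sl2 i).lie_e_f, (b₂.sl2 i).lie_e_f]

/-- Diagonal semisimple element. -/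
def diagH (i : ι) : diag b₁ b₂ :=
  ⟨(b₁.h i, b₂.h i), by
    rw [← lie_e_f_prod]
    exact lie_mem _ (diagE b₁ b₂ i).2 (diagF b₁ b₂ i).2⟩

/-- The diagonal basis. -/
def diagBasis (hA : b₁.A = b₂.A) :
    Basis ι (lieSpan K (diag b₁ b₂) (range (diagH b₁ b₂))) where
  A := b₁.A
  h := diagH b₁ b₂
  e := diagE b₁ b₂
  f := diagF b₁ b₂
  cartan_eq_lieSpan := rfl
  span_ef := by
    have hr : range (diagE b₁ b₂) ∪ range (diagF b₁ b₂) =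
        Subtype.val ⁻¹' (range (fun i ↦ (b₁.e i, b₂.e i)) ∪ range (fun i ↦ (b₁.f i, b₂.f i))) := by
      ext; simp [Subtype.ext_iff, diagE, diagF]
    rw [hr]
    exact lieSpan_lieSpan_coe_preimage
  linInd := .of_comp (diag b₁ b₂).subtype <| .of_comp (LinearMap.fst K L₁ L₂) b₁.linInd
  nondegen := b₁.nondegen
  sl2 i :=
    { h_ne_zero := by simp [Subtype.ext_iff, diagH, (b₁.sl2 i).h_ne_zero]
      lie_e_f := by
        simp [Subtype.ext_iff, diagE, diagF, diagH, (b₁.sl2 i).lie_e_f, (b₂.sl2 i).lie_e_f]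
      lie_h_e_nsmul := by
        simp [Subtype.ext_iff, diagE, diagH, (b₁.sl2 i).lie_h_e_nsmul, (b₂.sl2 i).lie_h_e_nsmul]
      lie_h_f_nsmul := by
        simp [Subtype.ext_iff, diagF, diagH, (b₁.sl2 i).lie_h_f_nsmul, (b₂.sl2 i).lie_h_f_nsmul] }
  lie_h_h i j := by simp [Subtype.ext_iff, diagH, b₁.lie_h_h, b₂.lie_h_h]
  lie_h_e i j := by simp [Subtype.ext_iff, diagH, diagE, b₁.lie_h_e, b₂.lie_h_e, ← hA]
  lie_h_f i j := by simp [Subtype.ext_iff, diagH, diagF, b₁.lie_h_f, b₂.lie_h_f, ← hA]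
  lie_e_f_ne i j hij := by
    simp [Subtype.ext_iff, diagE, diagF, b₁.lie_e_f_ne i j hij, b₂.lie_e_f_ne _ _ hij]

lemma surjective_fst_diag :
    Function.Surjective ((LieHom.fst K L₁ L₂).comp (diag b₁ b₂).incl) := by
  rw [← LieHom.range_eq_top, eq_top_iff, ← b₁.span_ef, lieSpan_le]
  rintro _ (⟨i, rfl⟩ | ⟨i, rfl⟩)
  · exact ⟨diagE b₁ b₂ i, rfl⟩
  · exact ⟨diagF b₁ b₂ i, rfl⟩

lemma surjective_snd_diag :
    Function.Surjective ((LieHom.snd K L₁ L₂).comp (diag b₁ b₂).incl) := by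
  rw [← LieHom.range_eq_top, eq_top_iff, ← b₂.span_ef, lieSpan_le]
  rintro _ (⟨i, rfl⟩ | ⟨i, rfl⟩)
  · exact ⟨diagE b₁ b₂ i, rfl⟩
  · exact ⟨diagF b₁ b₂ i, rfl⟩

lemma diag_ne_top [CharZero K] [FiniteDimensional K L₁] [FiniteDimensional K L₂]
    [Nonempty ι] (hA : b₁.A = b₂.A) : diag b₁ b₂ ≠ ⊤ := by
  intro contra
  have := Fintype.ofFinite ι
  have hC := (diagBasis b₁ b₂ hA).isCartanSubalgebra
  set C := lieSpan K (diag b₁ b₂) (range (diagH b₁ b₂)) with hCdef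
  have hsp : (C : Submodule K _) = Submodule.span K (range (diagH b₁ b₂)) :=
    (diagBasis b₁ b₂ hA).coe_cartan_eq_span
  obtain ⟨i⟩ := ‹Nonempty ι›
  let x : diag b₁ b₂ := ⟨(b₁.h i, 0), by rw [contra]; trivial⟩
  have hx : x ∈ C := by
    rw [← hC.self_normalizing, mem_normalizer_iff]
    intro y hy
    have : y ∈ Submodule.span K (range (diagH b₁ b₂)) := by rw [← hsp]; exact hy
    suffices ⁅x, y⁆ = 0 by rw [this]; exact zero_mem _
    clear hy
    induction this using Submodule.span_induction with
    | mem y hy =>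
      obtain ⟨j, rfl⟩ := hy
      simp [Subtype.ext_iff, x, diagH, b₁.lie_h_h]
    | zero => simp
    | add u v _ _ hu hv => rw [lie_add, hu, hv, add_zero]
    | smul t u _ hu => rw [lie_smul, hu, smul_zero]
  have hx' : x ∈ Submodule.span K (range (diagH b₁ b₂)) := by rw [← hsp]; exact hx
  obtain ⟨c, hc⟩ := (Submodule.mem_span_range_iff_exists_fun K).1 hx'
  have h2 : ∑ j, c j • b₂.h j = 0 := by
    have := congr_arg (fun z : diag b₁ b₂ ↦ (LieHom.snd K L₁ L₂) z.1) hc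
    simpa [diagH, x, AddSubmonoidClass.coe_finsetSum, Prod.snd_sum] using this
  have h1 : ∑ j, c j • b₁.h j = b₁.h i := by
    have := congr_arg (fun z : diag b₁ b₂ ↦ (LieHom.fst K L₁ L₂) z.1) hc
    simpa [diagH, x, AddSubmonoidClass.coe_finsetSum, Prod.fst_sum] using this
  have := Fintype.linearIndependent_iff.1 b₂.linInd c h2
  simp only [this, zero_smul, Finset.sum_const_zero] at h1
  exact (b₁.sl2 i).h_ne_zero h1.symm

end Iso

section Ker

variable {K L₁ L₂ : Type*} [Field K] [LieRing L₁] [LieRing L₂]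
  [LieAlgebra K L₁] [LieAlgebra K L₂] [IsSimple K L₂]

lemma _root_.LieSubalgebra.injective_fst_of_ne_top (D : LieSubalgebra K (L₁ × L₂)) (hD : D ≠ ⊤)
    (h₁ : Function.Surjective ((LieHom.fst K L₁ L₂).comp D.incl))
    (h₂ : Function.Surjective ((LieHom.snd K L₁ L₂).comp D.incl)) :
    Function.Injective ((LieHom.fst K L₁ L₂).comp D.incl) := by
  let I : LieIdeal K L₂ :=
    { carrier := {y | ((0 : L₁), y) ∈ D}
      add_mem' := fun {a b} ha hb ↦ by simpa using add_mem (S := LieSubalgebra K (L₁ × L₂)) ha hb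
      zero_mem' := zero_mem D
      smul_mem' := fun c x hx ↦ by simpa using D.smul_mem c hx
      lie_mem := fun {x m} hm ↦ by
        obtain ⟨⟨⟨a, b⟩, hz⟩, rfl⟩ := h₂ x
        simpa using D.lie_mem hz hm }
  have hI (y : L₂) : y ∈ I ↔ ((0 : L₁), y) ∈ D := Iff.rfl
  rcases IsSimple.eq_bot_or_eq_top I with h | h
  · rw [injective_iff_map_eq_zero]
    rintro ⟨⟨a, b⟩, hz⟩ h0
    have ha : a = 0 := by simpa using h0
    subst ha
    have : b ∈ I := hz
    rw [h] at this
    simp only [LieSubmodule.mem_bot] at this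
    subst this
    rfl
  · exfalso
    apply hD
    rw [eq_top_iff]
    rintro ⟨a, b⟩ -
    obtain ⟨⟨⟨a', c⟩, hz⟩, rfl⟩ := h₁ a
    have : b - c ∈ I := by rw [h]; trivial
    have := D.add_mem hz this
    simpa using this

end Ker

section Iso2

variable {ι K L₁ L₂ : Type*} [Fintype ι] [Nonempty ι] [Field K] [CharZero K]
  [LieRing L₁] [LieRing L₂]
  [LieAlgebra K L₁] [FiniteDimensional K L₁] {H₁ : LieSubalgebra K L₁} (b₁ : Basis ι H₁)
  [LieAlgebra K L₂] [FiniteDimensional K L₂] {H₂ : LieSubalgebra K L₂} (b₂ : Basis ι H₂)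
  [IsSimple K L₁] [IsSimple K L₂]

/-- Simple Lie algebras with bases having the same Cartan matrix are isomorphic via an
isomorphism matching the generators. -/
theorem exists_equiv_of_A_eq (hA : b₁.A = b₂.A) :
    ∃ φ : L₁ ≃ₗ⁅K⁆ L₂, ∀ i, φ (b₁.e i) = b₂.e i ∧ φ (b₁.f i) = b₂.f i := by
  let p₁ := (LieHom.fst K L₁ L₂).comp (diag b₁ b₂).incl
  let p₂ := (LieHom.snd K L₁ L₂).comp (diag b₁ b₂).incl
  have s₁ : Function.Surjective p₁ := surjective_fst_diag b₁ b₂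
  have s₂ : Function.Surjective p₂ := surjective_snd_diag b₁ b₂
  have hD := diag_ne_top b₁ b₂ hA
  have i₁ : Function.Injective p₁ := LieSubalgebra.injective_fst_of_ne_top _ hD s₁ s₂
  have i₂ : Function.Surjective p₂ ∧ Function.Injective p₂ := by
    refine ⟨s₂, ?_⟩
    let I : LieIdeal K (diag b₁ b₂) := p₂.ker
    let q₁ : diag b₁ b₂ ≃ₗ⁅K⁆ L₁ := .ofBijective p₁ ⟨i₁, s₁⟩
    let q := p₂.comp q₁.symm.toLieHom
    have hq : Function.Injective q := by
      rw [← LieHom.ker_eq_bot]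
      refine (IsSimple.eq_bot_or_eq_top q.ker).resolve_right fun h ↦ ?_
      obtain ⟨i⟩ := ‹Nonempty ι›
      have : q (b₁.h i) = 0 := by
        rw [← LieHom.mem_ker, h]; trivial
      have h' : q₁.symm (b₁.h i) = diagH b₁ b₂ i := by
        rw [LieEquiv.symm_apply_eq]; rfl
      have h'' : p₂ (q₁.symm (b₁.h i)) = 0 := this
      rw [h'] at h''
      exact (b₂.sl2 i).h_ne_zero h''
    intro x y hxy
    have := @hq (q₁ x) (q₁ y) (by simpa [q] using hxy)
    exact q₁.injective this
  let q₁ : diag b₁ b₂ ≃ₗ⁅K⁆ L₁ := .ofBijective p₁ ⟨i₁, s₁⟩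
  let q₂ : diag b₁ b₂ ≃ₗ⁅K⁆ L₂ := .ofBijective p₂ ⟨i₂.2, i₂.1⟩
  refine ⟨q₁.symm.trans q₂, fun i ↦ ⟨?_, ?_⟩⟩
  · have : q₁.symm (b₁.e i) = diagE b₁ b₂ i := by rw [LieEquiv.symm_apply_eq]; rfl
    rw [LieEquiv.trans_apply, this]; rfl
  · have : q₁.symm (b₁.f i) = diagF b₁ b₂ i := by rw [LieEquiv.symm_apply_eq]; rfl
    rw [LieEquiv.trans_apply, this]; rfl

end Iso2

end LieAlgebra.Basis

/-- An irreducible reduced crystallographic root system in a rational vector space,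
relative to an invariant positive definite form. -/
structure IsEuclideanRootSystem {V : Type*} [AddCommGroup V] [Module ℚ V]
    (B : LinearMap.BilinForm ℚ V) (Φ : Finset V) : Prop where
  symm : ∀ x y, B x y = B y x
  pos : ∀ x, x ≠ 0 → 0 < B x x
  span : Submodule.span ℚ (Φ : Set V) = ⊤
  ne_zero : ∀ α ∈ Φ, α ≠ 0
  int : ∀ α ∈ Φ, ∀ β ∈ Φ, ∃ n : ℤ, 2 * B β α = n * B α α ∧ β - (n : ℚ) • α ∈ Φ
  reduced : ∀ α ∈ Φ, ∀ c : ℚ, c • α ∈ Φ → c = 1 ∨ c = -1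
  irred : ∀ S ⊆ Φ, S.Nonempty → (∀ α ∈ S, ∀ β ∈ Φ, B α β ≠ 0 → β ∈ S) → S = Φ

namespace IsEuclideanRootSystem

variable {V : Type*} [AddCommGroup V] [Module ℚ V] {B : LinearMap.BilinForm ℚ V} {Φ : Finset V}
  (h : IsEuclideanRootSystem B Φ)
include h

lemma norm_pos {α : V} (hα : α ∈ Φ) : 0 < B α α := h.pos α (h.ne_zero α hα)

/-- The reflection in `α`. -/
lemma refl_mem {α β : V} (hα : α ∈ Φ) (hβ : β ∈ Φ) :
    β - (2 * B β α / B α α) • α ∈ Φ := by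
  obtain ⟨n, hn, hm⟩ := h.int α hα β hβ
  have := (h.norm_pos hα).ne'
  rwa [hn, mul_div_cancel_right₀ _ this]

lemma neg_mem {α : V} (hα : α ∈ Φ) : -α ∈ Φ := by
  have := h.refl_mem hα hα
  have h0 := (h.norm_pos hα).ne'
  rwa [mul_div_cancel_right₀ _ h0, two_smul, sub_add_cancel_left] at this

lemma neg_mem_iff {α : V} : -α ∈ Φ ↔ α ∈ Φ :=
  ⟨fun ha ↦ by simpa using h.neg_mem ha, h.neg_mem⟩

lemma refl_form {α : V} (hα : α ∈ Φ) (x y : V) :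
    B (x - (2 * B x α / B α α) • α) (y - (2 * B y α / B α α) • α) = B x y := by
  have h0 := (h.norm_pos hα).ne'
  simp only [map_sub, map_smul, LinearMap.sub_apply, LinearMap.smul_apply, smul_eq_mul]
  rw [h.symm α y]
  field_simp
  ring

lemma refl_refl {α : V} (hα : α ∈ Φ) (x : V) :
    (x - (2 * B x α / B α α) • α) -
      (2 * B (x - (2 * B x α / B α α) • α) α / B α α) • α = x := by
  have h0 := (h.norm_pos hα).ne'
  have : 2 * B (x - (2 * B x α / B α α) • α) α / B α α = - (2 * B x α / B α α) := by
    simp only [map_sub, map_smul, LinearMap.sub_apply, LinearMap.smul_apply, smul_eq_mul]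
    field_simp
    ring
  rw [this]
  module

lemma cauchy_schwarz {α β : V} (hα : α ∈ Φ) (hβ : β ∈ Φ) (h₁ : β ≠ α) (h₂ : β ≠ -α) :
    B β α * B β α < B α α * B β β := by
  have h0 := (h.norm_pos hα)
  have hx : B α α • β - B β α • α ≠ 0 := by
    intro h'
    have : β = (B β α / B α α) • α := by
      rw [sub_eq_zero] at h'
      rw [div_eq_inv_mul, mul_smul, ← h', smul_smul, inv_mul_cancel₀ h0.ne', one_smul]
    rcases h.reduced α hα _ (this ▸ hβ) with hc | hc <;> rw [hc] at this <;> simp_all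
  have := h.pos _ hx
  simp only [map_sub, map_smul, LinearMap.sub_apply, LinearMap.smul_apply, smul_eq_mul,
    h.symm α β] at this
  nlinarith

lemma form_of_norm_le {α β : V} (hα : α ∈ Φ) (hβ : β ∈ Φ) (h₁ : β ≠ α) (h₂ : β ≠ -α)
    (hle : B β β ≤ B α α) : B β α = 0 ∨ 2 * B β α = B α α ∨ 2 * B β α = - B α α := by
  have h0 := h.norm_pos hα
  obtain ⟨n, hn, -⟩ := h.int α hα β hβ
  have hcs := h.cauchy_schwarz hα hβ h₁ h₂
  have h4 : (n : ℚ) * n < 4 := by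
    have : (n * B α α) * (n * B α α) < 4 * (B α α * B α α) := by
      rw [← hn]; nlinarith
    by_contra! hc
    nlinarith [mul_pos h0 h0]
  have h4' : n * n < 4 := by exact_mod_cast h4
  have hl : -2 < n := by nlinarith
  have hu : n < 2 := by nlinarith
  have : n = -1 ∨ n = 0 ∨ n = 1 := by omega
  rcases this with rfl | rfl | rfl
  · right; right; simpa using hn
  · left; simpa using hn
  · right; left; simpa using hn

lemma norm_ratio {α β : V} (hα : α ∈ Φ) (hβ : β ∈ Φ) (hle : B β β ≤ B α α) (hne : B β α ≠ 0) :
    B α α = B β β ∨ B α α = 2 * B β β ∨ B α α = 3 * B β β := by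
  by_cases h₁ : β = α
  · left; rw [h₁]
  by_cases h₂ : β = -α
  · left; rw [h₂]; simp
  have h0 := h.norm_pos hα
  have h0' := h.norm_pos hβ
  obtain ⟨n, hn, -⟩ := h.int β hβ α hα
  have hcs := h.cauchy_schwarz hα hβ h₁ h₂
  have key : ∀ m : ℤ, m * B β β = B α α → (2 * B β α) * (2 * B β α) = B α α * B α α →
      B α α = B β β ∨ B α α = 2 * B β β ∨ B α α = 3 * B β β := by
    intro m hm hsq
    have h4 : (m : ℚ) < 4 := by
      by_contra! hc
      nlinarith [mul_pos h0 h0']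
    have h1 : (0 : ℚ) < m := by
      by_contra! hc
      nlinarith
    have h4' : m < 4 := by exact_mod_cast h4
    have h1' : 0 < m := by exact_mod_cast h1
    have : m = 1 ∨ m = 2 ∨ m = 3 := by omega
    rcases this with rfl | rfl | rfl
    · left; simpa using hm.symm
    · right; left; simpa using hm.symm
    · right; right; simpa using hm.symm
  rcases h.form_of_norm_le hα hβ h₁ h₂ hle with h3 | h3 | h3
  · exact absurd h3 hne
  · exact key n (by rw [← hn, h.symm, h3]) (by rw [h3])
  · exact key (-n) (by push_cast; rw [neg_mul, ← hn, h.symm, h3, neg_neg]) (by rw [h3]; ring)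

/-- Any two roots have a common nonorthogonal root. -/
lemma exists_common {α γ : V} (hα : α ∈ Φ) (hγ : γ ∈ Φ) :
    ∃ δ ∈ Φ, B α δ ≠ 0 ∧ B δ γ ≠ 0 := by
  classical
  have := h.irred (Φ.filter fun γ ↦ ∃ δ ∈ Φ, B α δ ≠ 0 ∧ B δ γ ≠ 0) (Finset.filter_subset _ _)
    ⟨α, by simpa [hα] using ⟨α, hα, (h.norm_pos hα).ne', (h.norm_pos hα).ne'⟩⟩ ?_
  · rw [← this] at hγ
    exact (Finset.mem_filter.1 hγ).2
  intro γ hγ ε hε hne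
  obtain ⟨hγ, δ, hδ, h1, h2⟩ := Finset.mem_filter.1 hγ
  refine Finset.mem_filter.2 ⟨hε, ?_⟩
  by_cases h3 : B δ ε = 0
  swap
  · exact ⟨δ, hδ, h1, h3⟩
  by_cases h4 : B α γ = 0
  swap
  · exact ⟨γ, hγ, h4, hne⟩
  refine ⟨_, h.refl_mem hδ hγ, ?_, ?_⟩
  · have := (h.norm_pos hδ).ne'
    rw [h.symm] at h2
    simp [h4, h1, this, h2]
  · simpa [h3] using hne

/-- Every root length occurs among the roots nonorthogonal to a given one. -/
lemma exists_norm_eq {α γ : V} (hα : α ∈ Φ) (hγ : γ ∈ Φ) :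
    ∃ δ ∈ Φ, B δ δ = B γ γ ∧ B δ α ≠ 0 := by
  by_cases h0 : B γ α = 0
  swap
  · exact ⟨γ, hγ, rfl, h0⟩
  obtain ⟨δ, hδ, h1, h2⟩ := h.exists_common hα hγ
  refine ⟨_, h.refl_mem hδ hγ, h.refl_form hδ _ _, ?_⟩
  have := (h.norm_pos hδ).ne'
  rw [h.symm] at h1 h2
  simp [h0, h1, this, h2]

lemma norm_ratio' {α β : V} (hα : α ∈ Φ) (hβ : β ∈ Φ) (hle : B β β ≤ B α α) :
    B α α = B β β ∨ B α α = 2 * B β β ∨ B α α = 3 * B β β := by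
  obtain ⟨δ, hδ, h1, h2⟩ := h.exists_norm_eq hα hβ
  rw [← h1] at hle ⊢
  exact h.norm_ratio hα hδ hle h2

/-- Invariant sums of squares are proportional to the form. -/
lemma exists_schur (Ψ : Finset V) (hΨ : ∀ α ∈ Φ, ∀ β ∈ Ψ, β - (2 * B β α / B α α) • α ∈ Ψ) :
    ∃ c : ℚ, ∀ x y, ∑ β ∈ Ψ, B β x * B β y = c * B x y := by
  classical
  let S (x y : V) : ℚ := ∑ β ∈ Ψ, B β x * B β y
  have hSs x y : S x y = S y x := by simp only [S, mul_comm]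
  have h1 : ∀ α ∈ Φ, ∀ y, S α y * B α α = S α α * B α y := by
    intro α hα y
    have h0 := (h.norm_pos hα).ne'
    have : S α y = S (-α) (y - (2 * B y α / B α α) • α) := by
      refine Finset.sum_nbij' (fun β ↦ β - (2 * B β α / B α α) • α)
        (fun β ↦ β - (2 * B β α / B α α) • α) (fun β ↦ hΨ α hα β) (fun β ↦ hΨ α hα β)
        (fun β _ ↦ h.refl_refl hα β) (fun β _ ↦ h.refl_refl hα β) ?_
      intro β _
      rw [h.refl_form hα]
      congr 1
      simp only [map_sub, map_smul, LinearMap.sub_apply, LinearMap.smul_apply, smul_eq_mul, map_neg]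
      field_simp
      ring
    have h2 : S (-α) (y - (2 * B y α / B α α) • α) = - S α y + (2 * B y α / B α α) * S α α := by
      simp only [S, map_sub, map_smul, smul_eq_mul, map_neg, Finset.mul_sum,
        ← Finset.sum_neg_distrib, ← Finset.sum_add_distrib]
      refine Finset.sum_congr rfl fun β _ ↦ ?_
      ring
    rw [h2] at this
    rw [h.symm α y]
    field_simp at this
    linarith
  rcases Φ.eq_empty_or_nonempty with rfl | ⟨α₀, hα₀⟩
  · have htop := h.span
    have hz (x : V) : x = 0 := by
      have : x ∈ Submodule.span ℚ ((∅ : Finset V) : Set V) := by rw [htop]; trivial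
      simpa using this
    exact ⟨0, fun x y ↦ by simp [hz x]⟩
  have hc : ∀ α ∈ Φ, S α α / B α α = S α₀ α₀ / B α₀ α₀ := by
    have := h.irred (Φ.filter fun α ↦ S α α / B α α = S α₀ α₀ / B α₀ α₀)
      (Finset.filter_subset _ _) ⟨α₀, by simp [hα₀]⟩ ?_
    · intro α hα
      rw [← this] at hα
      exact (Finset.mem_filter.1 hα).2
    intro α hα β hβ hne
    obtain ⟨hα, h2⟩ := Finset.mem_filter.1 hα
    refine Finset.mem_filter.2 ⟨hβ, ?_⟩
    rw [← h2]
    have e1 := h1 α hα β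
    have e2 := h1 β hβ α
    have a0 := (h.norm_pos hα).ne'
    have b0 := (h.norm_pos hβ).ne'
    rw [hSs, h.symm β α] at e2
    rw [div_eq_div_iff b0 a0]
    apply mul_right_cancel₀ hne
    linear_combination (-B α α) * e2 + (B β β) * e1
  refine ⟨S α₀ α₀ / B α₀ α₀, fun x y ↦ ?_⟩
  change S x y = _
  have hx : x ∈ Submodule.span ℚ (Φ : Set V) := by rw [h.span]; trivial
  induction hx using Submodule.span_induction with
  | mem x hx =>
    have := h1 x hx y
    have a0 := (h.norm_pos hx).ne'
    rw [← hc x hx, eq_comm, div_mul_eq_mul_div, div_eq_iff a0, this]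
  | zero => simp [S]
  | add u v _ _ hu hv =>
    have : S (u + v) y = S u y + S v y := by
      simp [S, add_mul, Finset.sum_add_distrib]
    rw [this, hu, hv, map_add, LinearMap.add_apply]; ring
  | smul t u _ hu =>
    have : S (t • u) y = t * S u y := by
      simp [S, Finset.mul_sum, mul_assoc]
    rw [this, hu, map_smul, LinearMap.smul_apply, smul_eq_mul]; ring

lemma finiteDimensional : FiniteDimensional ℚ V :=
  ⟨⟨Φ, h.span⟩⟩

lemma schur_smul {Ψ : Finset V} {c : ℚ} (hc : ∀ x y, ∑ β ∈ Ψ, B β x * B β y = c * B x y) (x : V) :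
    ∑ β ∈ Ψ, B β x • β = c • x := by
  rw [← sub_eq_zero]
  by_contra h0
  refine (h.pos _ h0).ne' ?_
  set y := ∑ β ∈ Ψ, B β x • β - c • x with hy
  conv_lhs => enter [1]; rw [hy]
  simp only [map_sub, map_sum, map_smul, LinearMap.sub_apply, LinearMap.sum_apply,
    LinearMap.smul_apply, smul_eq_mul, hc, sub_self]

lemma schur_trace {Ψ : Finset V} {c : ℚ} (hc : ∀ x y, ∑ β ∈ Ψ, B β x * B β y = c * B x y) :
    ∑ β ∈ Ψ, B β β = c * finrank ℚ V := by
  have := h.finiteDimensional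
  have h1 : ∑ β ∈ Ψ, (B β).smulRight β = c • (LinearMap.id : V →ₗ[ℚ] V) := by
    ext x
    simpa using h.schur_smul hc x
  have h2 := congr_arg (LinearMap.trace ℚ V) h1
  simpa [LinearMap.trace_id] using h2

end IsEuclideanRootSystem

/-- A fixed-point-free involution on a finset admits a fundamental domain. -/
lemma Finset.exists_half {X : Type*} (T : Finset X) (σ : X → X) (hσ : ∀ t ∈ T, σ t ∈ T)
    (hσσ : ∀ t ∈ T, σ (σ t) = t) (hne : ∀ t ∈ T, σ t ≠ t) :
    ∃ T' ⊆ T, T.card = 2 * T'.card ∧ (∀ t ∈ T, t ∈ T' ∨ σ t ∈ T') ∧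
      ∀ t ∈ T', σ t ∉ T' := by
  classical
  let _ : LinearOrder X := linearOrderOfSTO WellOrderingRel
  refine ⟨T.filter fun t ↦ t ≤ σ t, Finset.filter_subset _ _, ?_, ?_, ?_⟩
  · rw [← Finset.card_filter_add_card_filter_not (s := T) fun t ↦ t ≤ σ t, two_mul]
    congr 1
    refine Finset.card_nbij' σ σ ?_ ?_ ?_ ?_
    · intro t ht
      simp only [Finset.coe_filter, Set.mem_ofPred_eq, not_le] at ht ⊢
      exact ⟨hσ t ht.1, by rw [hσσ t ht.1]; exact ht.2.le⟩
    · intro t ht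
      simp only [Finset.coe_filter, Set.mem_ofPred_eq, not_le] at ht ⊢
      exact ⟨hσ t ht.1, by rw [hσσ t ht.1]; exact lt_of_le_of_ne ht.2 (hne t ht.1).symm⟩
    · intro t ht
      exact hσσ t (Finset.mem_filter.1 ht).1
    · intro t ht
      exact hσσ t (Finset.mem_filter.1 ht).1
  · intro t ht
    rcases le_total t (σ t) with h | h
    · exact .inl (Finset.mem_filter.2 ⟨ht, h⟩)
    · exact .inr (Finset.mem_filter.2 ⟨hσ t ht, by rwa [hσσ t ht]⟩)
  · intro t ht ht'
    obtain ⟨ht, h1⟩ := Finset.mem_filter.1 ht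
    have h2 := (Finset.mem_filter.1 ht').2
    rw [hσσ t ht] at h2
    exact hne t ht (le_antisymm h2 h1)

/-- A finite set of nonzero vectors that are pairwise orthogonal or proportional by a sign
is at most twice as large as the dimension. -/
lemma LinearMap.BilinForm.card_le_of_orthogonal_or_neg {V : Type*} [AddCommGroup V] [Module ℚ V]
    [FiniteDimensional ℚ V] (B : LinearMap.BilinForm ℚ V)
    (T : Finset V) (hT : ∀ v ∈ T, B v v ≠ 0)
    (ho : ∀ v ∈ T, ∀ w ∈ T, v = w ∨ v = -w ∨ B v w = 0) :
    T.card ≤ 2 * finrank ℚ V := by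
  classical
  let _ : LinearOrder V := linearOrderOfSTO WellOrderingRel
  let T' := T.filter fun v ↦ -v ∈ T → v ≤ -v
  have hsub : T ⊆ T' ∪ T'.image Neg.neg := by
    intro v hv
    rw [Finset.mem_union, Finset.mem_image]
    by_cases hv' : -v ∈ T
    · rcases le_total v (-v) with h | h
      · exact .inl (Finset.mem_filter.2 ⟨hv, fun _ ↦ h⟩)
      · exact .inr ⟨-v, Finset.mem_filter.2 ⟨hv', fun _ ↦ by rwa [neg_neg]⟩, neg_neg v⟩
    · exact .inl (Finset.mem_filter.2 ⟨hv, fun hh ↦ absurd hh hv'⟩)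
  have hli : LinearIndependent ℚ (fun v : T' ↦ (v : V)) := by
    refine LinearMap.linearIndependent_of_isOrthoᵢ (B := B) ?_ ?_
    · rw [LinearMap.isOrthoᵢ_def]
      rintro ⟨v, hv⟩ ⟨w, hw⟩ hvw
      obtain ⟨hv1, hv2⟩ := Finset.mem_filter.1 hv
      obtain ⟨hw1, hw2⟩ := Finset.mem_filter.1 hw
      rcases ho v hv1 w hw1 with h | h | h
      · exact absurd (Subtype.ext h) hvw
      · exfalso
        subst h
        rw [neg_neg] at hv2
        have := le_antisymm (hv2 hw1) (hw2 hv1)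
        exact hvw (Subtype.ext this)
      · exact h
    · rintro ⟨v, hv⟩
      exact hT v (Finset.mem_filter.1 hv).1
  have h1 := hli.fintype_card_le_finrank
  rw [Fintype.card_coe] at h1
  calc T.card ≤ _ := Finset.card_le_card hsub
    _ ≤ T'.card + (T'.image Neg.neg).card := Finset.card_union_le _ _
    _ ≤ T'.card + T'.card := Nat.add_le_add_left Finset.card_image_le _
    _ ≤ _ := by omega

namespace IsEuclideanRootSystem

variable {V : Type*} [AddCommGroup V] [Module ℚ V] {B : LinearMap.BilinForm ℚ V} {Φ : Finset V}
  (h : IsEuclideanRootSystem B Φ)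
include h

lemma refl_mem_filter [DecidableEq V] (t : ℚ) : ∀ α ∈ Φ, ∀ β ∈ Φ.filter (fun β ↦ B β β = t),
    β - (2 * B β α / B α α) • α ∈ Φ.filter (fun β ↦ B β β = t) := by
  intro α hα β hβ
  rw [Finset.mem_filter] at hβ ⊢
  exact ⟨h.refl_mem hα hβ.1, by rw [h.refl_form hα, hβ.2]⟩

lemma sum_sq [DecidableEq V] {α : V} (hα : α ∈ Φ) (Ψ : Finset V) (hΨ : Ψ ⊆ Φ)
    (hn : ∀ β ∈ Ψ, -β ∈ Ψ) (hle : ∀ β ∈ Ψ, B β β ≤ B α α) :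
    ∑ β ∈ Ψ, B β α * B β α =
      B α α * B α α / 2 * (Ψ.filter fun β ↦ 2 * B β α = B α α).card +
      if α ∈ Ψ then 2 * (B α α * B α α) else 0 := by
  have h0 := h.norm_pos hα
  have hneg : (Ψ.filter fun β ↦ 2 * B β α = - B α α).card =
      (Ψ.filter fun β ↦ 2 * B β α = B α α).card := by
    refine Finset.card_nbij' Neg.neg Neg.neg ?_ ?_ ?_ ?_
    · intro β hβ
      simp only [Finset.coe_filter, Set.mem_ofPred_eq] at hβ ⊢
      refine ⟨hn _ hβ.1, ?_⟩
      simp only [map_neg, LinearMap.neg_apply]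
      linarith [hβ.2]
    · intro β hβ
      simp only [Finset.coe_filter, Set.mem_ofPred_eq] at hβ ⊢
      refine ⟨hn _ hβ.1, ?_⟩
      simp only [map_neg, LinearMap.neg_apply]
      linarith [hβ.2]
    · intro β _; exact neg_neg β
    · intro β _; exact neg_neg β
  have hαn : -α ∈ Ψ ↔ α ∈ Ψ := ⟨fun ha ↦ by simpa using hn _ ha, hn α⟩
  have hαα : α ≠ -α := by
    intro h'
    have : B α α = B α (-α) := congr_arg _ h'
    rw [map_neg] at this
    linarith
  have : ∀ β ∈ Ψ, B β α * B β α =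
      (if 2 * B β α = B α α then B α α * B α α / 4 else 0) +
      (if 2 * B β α = - B α α then B α α * B α α / 4 else 0) +
      (if α = β then B α α * B α α else 0) + (if -α = β then B α α * B α α else 0) := by
    intro β hβ
    by_cases h1 : β = α
    · subst h1
      rw [if_neg (by linarith), if_neg (by linarith), if_pos rfl, if_neg hαα.symm]
      ring
    by_cases h2 : β = -α
    · subst h2
      rw [if_neg (by simp; linarith), if_neg (by simp; linarith), if_neg hαα, if_pos rfl]
      simp
    rw [if_neg (Ne.symm h1), if_neg (Ne.symm h2)]
    rcases h.form_of_norm_le hα (hΨ hβ) h1 h2 (hle β hβ) with h3 | h3 | h3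
    · rw [if_neg (by linarith), if_neg (by linarith), h3]; ring
    · rw [if_pos h3, if_neg (by linarith)]
      have : B β α = B α α / 2 := by linarith
      rw [this]; ring
    · rw [if_neg (by linarith), if_pos h3]
      have : B β α = - B α α / 2 := by linarith
      rw [this]; ring
  rw [Finset.sum_congr rfl this]
  simp only [Finset.sum_add_distrib, Finset.sum_ite_eq, hαn]
  rw [← Finset.sum_filter, ← Finset.sum_filter, Finset.sum_const, Finset.sum_const, hneg,
    nsmul_eq_mul]
  split_ifs <;> ring

lemma span_nonorthogonal {α : V} (hα : α ∈ Φ) :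
    Submodule.span ℚ {β | β ∈ Φ ∧ B β α ≠ 0} = ⊤ := by
  rw [eq_top_iff, ← h.span, Submodule.span_le]
  intro γ hγ
  by_cases h0 : B γ α = 0
  swap
  · exact Submodule.subset_span ⟨hγ, h0⟩
  obtain ⟨δ, hδ, h1, h2⟩ := h.exists_common hα hγ
  have hd := (h.norm_pos hδ).ne'
  have h3 : γ - (2 * B γ δ / B δ δ) • δ ∈ Submodule.span ℚ {β | β ∈ Φ ∧ B β α ≠ 0} := by
    refine Submodule.subset_span ⟨h.refl_mem hδ hγ, ?_⟩
    rw [h.symm] at h1 h2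
    simp [h0, h1, h2, hd]
  have h4 : δ ∈ Submodule.span ℚ {β | β ∈ Φ ∧ B β α ≠ 0} :=
    Submodule.subset_span ⟨hδ, by rwa [h.symm]⟩
  have := Submodule.add_mem _ h3 (Submodule.smul_mem _ (2 * B γ δ / B δ δ) h4)
  simpa using this

lemma exists_half_one {α : V} (hα : α ∈ Φ) (Ψ : Finset V) (hΨ : Ψ ⊆ Φ)
    (hr : ∀ β ∈ Ψ, β - (2 * B β α / B α α) • α ∈ Ψ) (hn : ∀ β ∈ Ψ, -β ∈ Ψ) :
    ∃ T' ⊆ Ψ.filter (fun β ↦ 2 * B β α = B α α),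
      (Ψ.filter (fun β ↦ 2 * B β α = B α α)).card = 2 * T'.card ∧
      ∀ t ∈ Ψ.filter (fun β ↦ 2 * B β α = B α α), t ∈ T' ∨ α - t ∈ T' := by
  have h0 := h.norm_pos hα
  refine (Finset.exists_half (Ψ.filter (fun β ↦ 2 * B β α = B α α)) (fun t ↦ α - t) ?_ ?_ ?_).imp
    fun T' h ↦ ⟨h.1, h.2.1, h.2.2.1⟩
  · intro t ht
    rw [Finset.mem_filter] at ht ⊢
    have h1 := hn _ (hr t ht.1)
    rw [ht.2, div_self h0.ne', one_smul, neg_sub] at h1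
    refine ⟨h1, ?_⟩
    simp only [map_sub, LinearMap.sub_apply]
    linarith [ht.2]
  · intro t _; simp
  · intro t ht hh
    rw [Finset.mem_filter] at ht
    have h2 : α = (2 : ℚ) • t := by rw [two_smul]; exact sub_eq_iff_eq_add.1 hh
    rcases h.reduced t (hΨ ht.1) 2 (h2 ▸ hα) with h3 | h3 <;> norm_num at h3

lemma finrank_le_of_long {α : V} (hα : α ∈ Φ) (hl : ∀ β ∈ Φ, B β β ≤ B α α) :
    finrank ℚ V + finrank ℚ V ≤ 2 + (Φ.filter fun β ↦ 2 * B β α = B α α).card := by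
  classical
  have h0 := h.norm_pos hα
  obtain ⟨T', hT', hc, hcov⟩ := h.exists_half_one hα Φ subset_rfl
    (fun β ↦ h.refl_mem hα) (fun β ↦ h.neg_mem)
  have : Submodule.span ℚ ((insert α T' : Finset V) : Set V) = ⊤ := by
    rw [eq_top_iff, ← h.span_nonorthogonal hα, Submodule.span_le]
    have hα' : α ∈ Submodule.span ℚ ((insert α T' : Finset V) : Set V) :=
      Submodule.subset_span (by simp)
    have hpos : ∀ t ∈ Φ.filter (fun β ↦ 2 * B β α = B α α),
        t ∈ Submodule.span ℚ ((insert α T' : Finset V) : Set V) := by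
      intro t ht
      rcases hcov t ht with h1 | h1
      · exact Submodule.subset_span (by simp [h1])
      · have h2 : α - t ∈ Submodule.span ℚ ((insert α T' : Finset V) : Set V) :=
          Submodule.subset_span (by simp [h1])
        simpa using Submodule.sub_mem _ hα' h2
    rintro β ⟨hβ, hne⟩
    by_cases h1 : β = α
    · rw [h1]; exact hα'
    by_cases h2 : β = -α
    · rw [h2]; exact Submodule.neg_mem _ hα'
    rcases h.form_of_norm_le hα hβ h1 h2 (hl β hβ) with h3 | h3 | h3
    · exact absurd h3 hne
    · exact hpos _ (Finset.mem_filter.2 ⟨hβ, h3⟩)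
    · have := hpos (-β) (Finset.mem_filter.2 ⟨h.neg_mem hβ, by simp; linarith⟩)
      simpa using Submodule.neg_mem _ this
  have h1 := finrank_span_finset_le_card (R := ℚ) (insert α T' : Finset V)
  rw [Set.finrank, this, finrank_top] at h1
  have := Finset.card_insert_le α T'
  omega

lemma finrank_mul_le (hne : Φ.Nonempty) :
    finrank ℚ V * (finrank ℚ V + 1) ≤ Φ.card := by
  classical
  obtain ⟨α, hα, hl⟩ := Finset.exists_max_image Φ (fun β ↦ B β β) hne
  have h0 := h.norm_pos hα
  obtain ⟨c, hc⟩ := h.exists_schur Φ (fun α ha β ↦ h.refl_mem ha)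
  have h1 := h.sum_sq hα Φ subset_rfl (fun β ↦ h.neg_mem) hl
  rw [hc, if_pos hα] at h1
  have h2 := h.schur_trace hc
  have h3 : ∑ β ∈ Φ, B β β ≤ Φ.card * B α α := by
    rw [← nsmul_eq_mul]; exact Finset.sum_le_card_nsmul _ _ _ hl
  have h4 := h.finrank_le_of_long hα hl
  set N := (Φ.filter fun β ↦ 2 * B β α = B α α).card
  set r := finrank ℚ V
  have h5 : c = B α α * (N / 2 + 2) := by
    apply mul_right_cancel₀ h0.ne'
    rw [h1]; ring
  have h4' : (r : ℚ) + r ≤ 2 + N := by exact_mod_cast h4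
  have h6 : (r : ℚ) * (r + 1) ≤ Φ.card := by
    have : B α α * ((r : ℚ) * (r + 1)) ≤ B α α * Φ.card := by
      calc B α α * ((r : ℚ) * (r + 1)) ≤ B α α * (r * (N / 2 + 2)) := by
            refine mul_le_mul_of_nonneg_left (mul_le_mul_of_nonneg_left ?_ r.cast_nonneg) h0.le
            linarith
        _ = c * r := by rw [h5]; ring
        _ ≤ _ := by rw [← h2]; linarith
    exact le_of_mul_le_mul_left this h0
  exact_mod_cast h6

lemma finrank_dvd_card_filter [DecidableEq V] {α : V} (hα : α ∈ Φ) :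
    finrank ℚ V ∣ (Φ.filter fun β ↦ B β β = B α α).card := by
  have h0 := h.norm_pos hα
  set Ψ := Φ.filter fun β ↦ B β β = B α α with hΨ
  have hr := h.refl_mem_filter (B α α)
  have hn : ∀ β ∈ Ψ, -β ∈ Ψ := by
    intro β hβ
    rw [hΨ, Finset.mem_filter] at hβ ⊢
    exact ⟨h.neg_mem hβ.1, by simpa using hβ.2⟩
  obtain ⟨c, hc⟩ := h.exists_schur Ψ hr
  have h1 := h.sum_sq hα Ψ (Finset.filter_subset _ _) hn
    (fun β hβ ↦ (Finset.mem_filter.1 hβ).2.le)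
  have hαΨ : α ∈ Ψ := Finset.mem_filter.2 ⟨hα, rfl⟩
  rw [hc, if_pos hαΨ] at h1
  obtain ⟨T', -, hT', -⟩ := h.exists_half_one hα Ψ (Finset.filter_subset _ _) (hr α hα) hn
  have h2 := h.schur_trace hc
  rw [Finset.sum_congr rfl (fun β hβ ↦ (Finset.mem_filter.1 hβ).2), Finset.sum_const,
    nsmul_eq_mul] at h2
  rw [hT'] at h1
  have h5 : c = B α α * (T'.card + 2) := by
    apply mul_right_cancel₀ h0.ne'
    rw [h1]; push_cast; ring
  refine ⟨T'.card + 2, ?_⟩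
  have : (Ψ.card : ℚ) = finrank ℚ V * (T'.card + 2) := by
    apply mul_right_cancel₀ h0.ne'
    rw [h2, h5]; ring
  exact_mod_cast this

lemma finrank_dvd_card : finrank ℚ V ∣ Φ.card := by
  classical
  rw [Finset.card_eq_sum_card_image (fun β ↦ B β β) Φ]
  refine Finset.dvd_sum fun t ht ↦ ?_
  obtain ⟨α, hα, rfl⟩ := Finset.mem_image.1 ht
  exact h.finrank_dvd_card_filter hα

lemma span_long [DecidableEq V] {α : V} (hα : α ∈ Φ) :
    Submodule.span ℚ ((Φ.filter fun β ↦ B β β = B α α : Finset V) : Set V) = ⊤ := by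
  obtain ⟨c, hc⟩ := h.exists_schur _ (h.refl_mem_filter (B α α))
  have h0 := h.norm_pos hα
  have hc0 : c ≠ 0 := by
    rintro rfl
    have := hc α α
    rw [zero_mul, Finset.sum_eq_zero_iff_of_nonneg (fun β _ ↦ mul_self_nonneg _)] at this
    have := this α (Finset.mem_filter.2 ⟨hα, rfl⟩)
    nlinarith
  rw [eq_top_iff]
  intro x _
  have : x = c⁻¹ • ∑ β ∈ Φ.filter (fun β ↦ B β β = B α α), B β x • β := by
    rw [h.schur_smul hc, smul_smul, inv_mul_cancel₀ hc0, one_smul]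
  rw [this]
  exact Submodule.smul_mem _ _ (Submodule.sum_mem _ fun β hβ ↦
    Submodule.smul_mem _ _ (Submodule.subset_span hβ))

lemma card_le_three_pow (hne : Φ.Nonempty) :
    Φ.card ≤ 3 ^ finrank ℚ V + 2 * finrank ℚ V := by
  classical
  have := h.finiteDimensional
  obtain ⟨α, hα, hl⟩ := Finset.exists_max_image Φ (fun β ↦ B β β) hne
  have h0 := h.norm_pos hα
  obtain ⟨b, hb, hspan, hli⟩ := exists_linearIndependent ℚ
    ((Φ.filter fun β ↦ B β β = B α α : Finset V) : Set V)
  have hfin : b.Finite := (Finset.finite_toSet _).subset hb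
  obtain ⟨b, rfl⟩ := hfin.exists_finset_coe
  rw [h.span_long hα] at hspan
  have hcard : b.card = finrank ℚ V := by
    have := finrank_span_finset_eq_card hli
    rw [hspan, finrank_top] at this
    exact this.symm
  let G := Φ.filter fun β ↦ ∀ i ∈ b, β ≠ i ∧ β ≠ -i
  have hsub : Φ ⊆ G ∪ (b ∪ b.image Neg.neg) := by
    intro β hβ
    by_cases hG : β ∈ G
    · exact Finset.mem_union_left _ hG
    · have : ∃ i ∈ b, β = i ∨ β = -i := by
        by_contra! hc
        exact hG (Finset.mem_filter.2 ⟨hβ, hc⟩)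
      obtain ⟨i, hi, rfl | rfl⟩ := this <;> simp [hi]
  have hG : G.card ≤ 3 ^ b.card := by
    have : (Fintype.piFinset fun _ : b ↦ ({0, B α α / 2, -B α α / 2} : Finset ℚ)).card =
        3 ^ b.card := by
      rw [Fintype.card_piFinset, Finset.prod_const, Finset.card_univ, Fintype.card_coe,
        Finset.card_eq_three.2]
      refine ⟨0, B α α / 2, -B α α / 2, ?_, ?_, ?_, rfl⟩
      · linarith
      · linarith
      · linarith
    rw [← this]
    refine Finset.card_le_card_of_injOn (fun β i ↦ B β i) ?_ ?_
    · intro β hβ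
      obtain ⟨hβ, hβb⟩ := Finset.mem_filter.1 hβ
      simp only [Finset.mem_coe, Fintype.mem_piFinset]
      rintro ⟨i, hi⟩
      obtain ⟨hiΦ, hin⟩ := Finset.mem_filter.1 (hb hi)
      have := h.form_of_norm_le hiΦ hβ (hβb i hi).1 (hβb i hi).2 (by rw [hin]; exact hl β hβ)
      rw [hin] at this
      simp only [Finset.mem_insert, Finset.mem_singleton]
      rcases this with h3 | h3 | h3
      · exact .inl h3
      · exact .inr (.inl (by linarith))
      · exact .inr (.inr (by linarith))
    · intro β _ γ _ hbc
      by_contra hne'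
      have hz : ∀ x, B (β - γ) x = 0 := by
        intro x
        have hx : x ∈ Submodule.span ℚ (b : Set V) := by rw [hspan]; trivial
        induction hx using Submodule.span_induction with
        | mem x hx =>
          have := congr_fun hbc ⟨x, hx⟩
          rw [map_sub, LinearMap.sub_apply, sub_eq_zero]
          exact this
        | zero => simp
        | add u v _ _ hu hv => rw [map_add, hu, hv, add_zero]
        | smul t u _ hu => rw [map_smul, hu, smul_zero]
      exact (h.pos _ (sub_ne_zero.2 hne')).ne' (hz _)
  calc Φ.card ≤ _ := Finset.card_le_card hsub
    _ ≤ G.card + (b.card + b.card) :=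
      (Finset.card_union_le _ _).trans (by
        exact Nat.add_le_add_left ((Finset.card_union_le _ _).trans
          (Nat.add_le_add_left Finset.card_image_le _)) _)
    _ ≤ _ := by rw [← hcard]; omega

theorem finrank_eq_eight (hcard : Φ.card + finrank ℚ V = 248) : finrank ℚ V = 8 := by
  have hne : Φ.Nonempty := by
    by_contra! hc
    have htop := h.span
    rw [hc] at htop hcard
    have : finrank ℚ V = 0 := by
      rw [← finrank_top ℚ V, ← htop]; simp
    simp [this] at hcard
  have h1 := h.finrank_mul_le hne
  have h2 := h.card_le_three_pow hne
  have h3 := h.finrank_dvd_card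
  have h4 : finrank ℚ V ∣ 248 := hcard ▸ Dvd.dvd.add h3 dvd_rfl
  set r := finrank ℚ V
  have h5 : r ≤ 15 := by nlinarith
  interval_cases r <;> omega

end IsEuclideanRootSystem

/-- Vectors with a common projection to `a` whose orthogonal components have equal norm and are
pairwise orthogonal or at an angle of at least `π`. -/
lemma LinearMap.BilinForm.card_le_of_projection {V : Type*} [AddCommGroup V] [Module ℚ V]
    [FiniteDimensional ℚ V] (B : LinearMap.BilinForm ℚ V) (hs : ∀ x y, B x y = B y x)
    (hp : ∀ x, x ≠ 0 → 0 < B x x) (X : Finset V) (a : V) (ha : 0 < B a a) (q t : ℚ) (ht : 0 < t)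
    (hq : ∀ x ∈ X, B x a = q * B a a) (hn : ∀ x ∈ X, B x x - q * q * B a a = t)
    (ho : ∀ x ∈ X, ∀ y ∈ X, x = y ∨ B x y - q * q * B a a = 0 ∨ B x y - q * q * B a a ≤ -t) :
    X.card + 2 ≤ 2 * finrank ℚ V ∧
    ((∀ x ∈ X, ∀ y ∈ X, B x y - q * q * B a a ≠ 0) → X.card ≤ 2) := by
  classical
  have hf : Function.Injective (fun x : V ↦ x - q • a) := sub_left_injective
  have hvw : ∀ x ∈ X, ∀ y ∈ X, B (x - q • a) (y - q • a) = B x y - q * q * B a a := by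
    intro x hx y hy
    simp only [map_sub, map_smul, LinearMap.sub_apply, LinearMap.smul_apply, smul_eq_mul,
      hq x hx, hs a y, hq y hy]
    ring
  have hva : ∀ x ∈ X, B (x - q • a) a = 0 := by
    intro x hx
    simp only [map_sub, map_smul, LinearMap.sub_apply, LinearMap.smul_apply, smul_eq_mul,
      hq x hx, sub_self]
  have hneg : ∀ x ∈ X, ∀ y ∈ X, B x y - q * q * B a a ≤ -t → x - q • a = -(y - q • a) := by
    intro x hx y hy hxy
    by_contra hc
    have h0 : (x - q • a) + (y - q • a) ≠ 0 := fun h0 ↦ hc (eq_neg_of_add_eq_zero_left h0)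
    have := hp _ h0
    rw [LinearMap.BilinForm.add_left, LinearMap.BilinForm.add_right, LinearMap.BilinForm.add_right, hvw x hx x hx, hvw x hx y hy,
      hvw y hy x hx, hvw y hy y hy, hn x hx, hn y hy, hs y x] at this
    linarith
  have ha0 : a ≠ 0 := by rintro rfl; simp at ha
  constructor
  · let T := X.image (fun x ↦ x - q • a)
    have haT : a ∉ T := by
      intro h
      obtain ⟨x, hx, hxa⟩ := Finset.mem_image.1 h
      have := hva x hx
      rw [hxa] at this
      exact ha.ne' this
    have haT' : -a ∉ T := by
      intro h
      obtain ⟨x, hx, hxa⟩ := Finset.mem_image.1 h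
      have := hva x hx
      rw [hxa] at this
      simp at this
      exact ha.ne' this
    have haa : a ≠ -a := by
      intro h
      have : B a a = B a (-a) := congr_arg _ h
      rw [map_neg] at this
      linarith
    have hcard : (insert a (insert (-a) T)).card = X.card + 2 := by
      rw [Finset.card_insert_of_notMem (by simp [haa, haT]), Finset.card_insert_of_notMem haT',
        Finset.card_image_of_injective _ hf]
    rw [← hcard]
    refine B.card_le_of_orthogonal_or_neg _ ?_ ?_
    · intro v hv
      refine (hp v ?_).ne'
      rintro rfl
      simp only [Finset.mem_insert, ha0.symm, zero_eq_neg, ha0, false_or, T, Finset.mem_image] at hv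
      obtain ⟨x, hx, hv⟩ := hv
      have := hvw x hx x hx
      rw [hv, hn x hx, map_zero] at this
      exact ht.ne this
    · intro v hv w hw
      simp only [Finset.mem_insert, T, Finset.mem_image] at hv hw
      rcases hv with rfl | rfl | ⟨x, hx, rfl⟩ <;> rcases hw with rfl | rfl | ⟨y, hy, rfl⟩
      · simp
      · simp
      · right; right; rw [hs, hva y hy]
      · simp
      · simp
      · right; right; rw [hs, map_neg, hva y hy, neg_zero]
      · right; right; rw [hva x hx]
      · right; right; rw [map_neg, hva x hx, neg_zero]
      · rcases ho x hx y hy with h | h | h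
        · left; rw [h]
        · right; right; rw [hvw x hx y hy, h]
        · right; left; exact hneg x hx y hy h
  · intro hne
    by_contra! hc
    obtain ⟨x, y, z, hx, hy, hz, hxy, hxz, hyz⟩ := Finset.two_lt_card_iff.1 hc
    have e : ∀ x ∈ X, ∀ y ∈ X, x ≠ y → x - q • a = -(y - q • a) := by
      intro x hx y hy hxy
      rcases ho x hx y hy with h | h | h
      · exact absurd h hxy
      · exact absurd h (hne x hx y hy)
      · exact hneg x hx y hy h
    have h1 := e x hx y hy hxy
    have h2 := e x hx z hz hxz
    exact hyz (hf (neg_injective (h1.symm.trans h2)))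

/-- A simply laced root system with the numerical invariants of `E₈`. -/
structure IsE8RootSystem {V : Type*} [AddCommGroup V] [Module ℚ V]
    (B : LinearMap.BilinForm ℚ V) (Φ : Finset V) : Prop where
  symm : ∀ x y, B x y = B y x
  pos : ∀ x, x ≠ 0 → 0 < B x x
  norm : ∀ α ∈ Φ, B α α = 2
  form : ∀ α ∈ Φ, ∀ β ∈ Φ, β = α ∨ β = -α ∨ B β α = 0 ∨ B β α = 1 ∨ B β α = -1
  refl : ∀ α ∈ Φ, ∀ β ∈ Φ, β - B β α • α ∈ Φ
  finrank : finrank ℚ V = 8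
  card : Φ.card = 240
  card_one : ∀ α ∈ Φ, ∀ [DecidableEq V], (Φ.filter fun β ↦ B β α = 1).card = 56

namespace IsEuclideanRootSystem

variable {V : Type*} [AddCommGroup V] [Module ℚ V] {B : LinearMap.BilinForm ℚ V} {Φ : Finset V}
  (h : IsEuclideanRootSystem B Φ)
include h

lemma card_long [DecidableEq V] (hr : finrank ℚ V = 8) {M s : ℚ} {a : V} (ha : a ∈ Φ)
    (has : B a a = s) (hs : s < M) :
    ((Φ.filter fun β ↦ B β β = M).card : ℚ) * s =
      4 * M * ((Φ.filter fun β ↦ B β β = M).filter fun β ↦ 2 * B β a = M).card := by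
  have h0 := h.norm_pos ha
  rw [has] at h0
  set Ψ := Φ.filter fun β ↦ B β β = M with hΨ
  obtain ⟨c, hc⟩ := h.exists_schur Ψ (h.refl_mem_filter M)
  have h2 := h.schur_trace hc
  rw [Finset.sum_congr rfl (fun β hβ ↦ (Finset.mem_filter.1 hβ).2), Finset.sum_const,
    nsmul_eq_mul, hr] at h2
  have hneg : (Ψ.filter fun β ↦ 2 * B β a = - M).card = (Ψ.filter fun β ↦ 2 * B β a = M).card := by
    refine Finset.card_nbij' Neg.neg Neg.neg ?_ ?_ (fun β _ ↦ neg_neg β) (fun β _ ↦ neg_neg β)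
    all_goals
      intro β hβ
      simp only [hΨ, Finset.coe_filter, Set.mem_ofPred_eq, Finset.mem_filter] at hβ ⊢
      refine ⟨⟨h.neg_mem hβ.1.1, by simpa using hβ.1.2⟩, ?_⟩
      simp only [map_neg, LinearMap.neg_apply]
      linarith [hβ.2]
  have h1 : ∑ β ∈ Ψ, B β a * B β a =
      M * M / 2 * (Ψ.filter fun β ↦ 2 * B β a = M).card := by
    have : ∀ β ∈ Ψ, B β a * B β a =
        (if 2 * B β a = M then M * M / 4 else 0) + (if 2 * B β a = - M then M * M / 4 else 0) := by
      intro β hβ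
      obtain ⟨hβΦ, hβM⟩ := Finset.mem_filter.1 hβ
      have := h.form_of_norm_le hβΦ ha (by rintro rfl; linarith)
        (by rintro rfl; simp at has; linarith) (by linarith)
      rw [h.symm a β, hβM] at this
      rcases this with h3 | h3 | h3
      · rw [if_neg (by linarith), if_neg (by linarith), h3]; ring
      · rw [if_pos h3, if_neg (by linarith)]
        have : B β a = M / 2 := by linarith
        rw [this]; ring
      · rw [if_neg (by linarith), if_pos h3]
        have : B β a = - M / 2 := by linarith
        rw [this]; ring
    rw [Finset.sum_congr rfl this, Finset.sum_add_distrib, ← Finset.sum_filter,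
      ← Finset.sum_filter, Finset.sum_const, Finset.sum_const, hneg, nsmul_eq_mul]
    ring
  rw [hc, has] at h1
  have hM : M ≠ 0 := by linarith
  apply mul_right_cancel₀ hM
  push_cast at h2
  linear_combination s * h2 + 8 * h1

lemma card_short [DecidableEq V] (hr : finrank ℚ V = 8) {M s : ℚ} {a : V} (ha : a ∈ Φ)
    (haM : B a a = M) (hs : s < M) :
    ((Φ.filter fun β ↦ B β β = s).card : ℚ) * s =
      4 * M * ((Φ.filter fun β ↦ B β β = s).filter fun β ↦ 2 * B β a = M).card := by
  have h0 := h.norm_pos ha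
  rw [haM] at h0
  set Ψ := Φ.filter fun β ↦ B β β = s with hΨ
  obtain ⟨c, hc⟩ := h.exists_schur Ψ (h.refl_mem_filter s)
  have h2 := h.schur_trace hc
  rw [Finset.sum_congr rfl (fun β hβ ↦ (Finset.mem_filter.1 hβ).2), Finset.sum_const,
    nsmul_eq_mul, hr] at h2
  have h1 := h.sum_sq ha Ψ (Finset.filter_subset _ _) ?_ ?_
  · have haΨ : a ∉ Ψ := fun h' ↦ by linarith [(Finset.mem_filter.1 h').2]
    rw [if_neg haΨ, hc, haM] at h1
    apply mul_right_cancel₀ h0.ne'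
    push_cast at h2
    linear_combination M * h2 + 8 * h1
  · intro β hβ
    rw [hΨ, Finset.mem_filter] at hβ ⊢
    exact ⟨h.neg_mem hβ.1, by simpa using hβ.2⟩
  · intro β hβ
    rw [(Finset.mem_filter.1 hβ).2, haM]
    exact hs.le

theorem norm_eq (hr : finrank ℚ V = 8) (hcard : Φ.card = 240) {α β : V} (hα : α ∈ Φ)
    (hβ : β ∈ Φ) : B α α = B β β := by
  classical
  have := h.finiteDimensional
  obtain ⟨l, hl, hmax⟩ := Finset.exists_max_image Φ (fun β ↦ B β β) ⟨α, hα⟩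
  suffices ∀ a ∈ Φ, B l l = B a a by rw [← this α hα, this β hβ]
  clear hα hβ α β
  intro a ha
  by_contra hla
  obtain ⟨M, hM⟩ : ∃ M, B l l = M := ⟨_, rfl⟩
  obtain ⟨s, hs⟩ : ∃ s, B a a = s := ⟨_, rfl⟩
  have hs0 : 0 < s := hs ▸ h.norm_pos ha
  have hsM : s < M := by
    have := hmax a ha
    rw [hM, hs] at this hla
    exact lt_of_le_of_ne this (Ne.symm hla)
  have hm : M = 2 * s ∨ M = 3 * s := by
    have := h.norm_ratio' hl ha (hmax a ha)
    rw [hM, hs] at this hla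
    tauto
  have htwo : ∀ γ ∈ Φ, B γ γ ≠ M → B γ γ = s := by
    intro γ hγ hγM
    have h1 := h.norm_ratio' hl hγ (hmax γ hγ)
    have h2 : B γ γ ≤ s → s = B γ γ ∨ s = 2 * B γ γ ∨ s = 3 * B γ γ := fun hle ↦ by
      simpa [hs] using h.norm_ratio' ha hγ (by rwa [hs])
    have h3 : s ≤ B γ γ → B γ γ = s ∨ B γ γ = 2 * s ∨ B γ γ = 3 * s := fun hle ↦ by
      simpa [hs] using h.norm_ratio' hγ ha (by rwa [hs])
    have h0 := h.norm_pos hγ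
    rw [hM] at h1
    rcases h1 with h1 | h1 | h1
    · exact absurd h1.symm hγM
    all_goals rcases hm with hm | hm
    · linarith
    · have := h3 (by linarith)
      rcases this with h | h | h <;> linarith
    · have := h2 (by linarith)
      rcases this with h | h | h <;> linarith
    · linarith
  have hsplit : Φ.card = (Φ.filter fun β ↦ B β β = M).card +
      (Φ.filter fun β ↦ B β β = s).card := by
    rw [← Finset.card_filter_add_card_filter_not (s := Φ) fun β ↦ B β β = M]
    congr 2
    refine Finset.filter_congr fun γ hγ ↦ ⟨htwo γ hγ, fun h1 ↦ by rw [h1]; exact hsM.ne⟩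
  have hL := h.card_long hr ha hs hsM
  have hS := h.card_short hr hl hM hsM
  set X := (Φ.filter fun β ↦ B β β = M).filter fun β ↦ 2 * B β a = M with hX
  set Y := (Φ.filter fun β ↦ B β β = s).filter fun β ↦ 2 * B β l = M with hY
  have hsum : 240 * s = 4 * M * (X.card + Y.card) := by
    have : ((Φ.filter fun β ↦ B β β = M).card : ℚ) + (Φ.filter fun β ↦ B β β = s).card = 240 := by
      exact_mod_cast (hsplit.symm.trans hcard)
    rw [← this]
    linear_combination hL + hS
  have hXm : ∀ x ∈ X, x ∈ Φ ∧ B x x = M ∧ 2 * B x a = M := by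
    intro x hx; simpa [hX, and_assoc] using hx
  have hYm : ∀ x ∈ Y, x ∈ Φ ∧ B x x = s ∧ 2 * B x l = M := by
    intro x hx; simpa [hY, and_assoc] using hx
  have hXf : ∀ x ∈ X, ∀ y ∈ X, x = y ∨ B x y = 0 ∨ 2 * B x y = M ∨ 2 * B x y = -M := by
    intro x hx y hy
    by_cases hxy : x = y
    · exact .inl hxy
    have hx' := hXm x hx
    have hy' := hXm y hy
    have := h.form_of_norm_le hy'.1 hx'.1 hxy (by
      rintro rfl
      have := hx'.2.2
      simp at this
      linarith) (by rw [hx'.2.1, hy'.2.1])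
    rw [hy'.2.1] at this
    exact .inr this
  have hYf : ∀ x ∈ Y, ∀ y ∈ Y, x = y ∨ B x y = 0 ∨ 2 * B x y = s ∨ 2 * B x y = -s := by
    intro x hx y hy
    by_cases hxy : x = y
    · exact .inl hxy
    have hx' := hYm x hx
    have hy' := hYm y hy
    have := h.form_of_norm_le hy'.1 hx'.1 hxy (by
      rintro rfl
      have := hx'.2.2
      simp at this
      linarith) (by rw [hx'.2.1, hy'.2.1])
    rw [hy'.2.1] at this
    exact .inr this
  rcases hm with rfl | rfl
  · have e1 := (B.card_le_of_projection h.symm h.pos X a (by rw [hs]; exact hs0) 1 s hs0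
      (fun x hx ↦ by rw [hs]; linarith [(hXm x hx).2.2])
      (fun x hx ↦ by rw [hs]; linarith [(hXm x hx).2.1]) (fun x hx y hy ↦ by
        rw [hs]
        rcases hXf x hx y hy with h1 | h1 | h1 | h1
        · exact .inl h1
        · right; right; linarith
        · right; left; linarith
        · right; right; linarith)).1
    have e2 := (B.card_le_of_projection h.symm h.pos Y l (by rw [hM]; linarith) (1/2) (s/2)
      (by linarith)
      (fun x hx ↦ by rw [hM]; linarith [(hYm x hx).2.2])
      (fun x hx ↦ by rw [hM]; linarith [(hYm x hx).2.1]) (fun x hx y hy ↦ by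
        rw [hM]
        rcases hYf x hx y hy with h1 | h1 | h1 | h1
        · exact .inl h1
        · right; right; linarith
        · right; left; linarith
        · right; right; linarith)).1
    have : ((X.card + Y.card : ℕ) : ℚ) = 30 := by
      apply mul_right_cancel₀ hs0.ne'
      push_cast
      linarith
    have : X.card + Y.card = 30 := by exact_mod_cast this
    omega
  · have e1 := (B.card_le_of_projection h.symm h.pos X a (by rw [hs]; exact hs0) (3/2) (3*s/4)
      (by linarith)
      (fun x hx ↦ by rw [hs]; linarith [(hXm x hx).2.2])
      (fun x hx ↦ by rw [hs]; linarith [(hXm x hx).2.1]) (fun x hx y hy ↦ by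
        rw [hs]
        rcases hXf x hx y hy with h1 | h1 | h1 | h1
        · exact .inl h1
        · right; right; linarith
        · right; right; linarith
        · right; right; linarith)).2 (fun x hx y hy ↦ by
        rw [hs]
        rcases hXf x hx y hy with h1 | h1 | h1 | h1
        · rw [h1, (hXm y hy).2.1]; exact ne_of_gt (by linarith)
        all_goals exact ne_of_lt (by linarith))
    have e2 := (B.card_le_of_projection h.symm h.pos Y l (by rw [hM]; linarith) (1/2) (s/4)
      (by linarith)
      (fun x hx ↦ by rw [hM]; linarith [(hYm x hx).2.2])
      (fun x hx ↦ by rw [hM]; linarith [(hYm x hx).2.1]) (fun x hx y hy ↦ by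
        rw [hM]
        rcases hYf x hx y hy with h1 | h1 | h1 | h1
        · exact .inl h1
        · right; right; linarith
        · right; right; linarith
        · right; right; linarith)).2 (fun x hx y hy ↦ by
        rw [hM]
        rcases hYf x hx y hy with h1 | h1 | h1 | h1
        · rw [h1, (hYm y hy).2.1]; exact ne_of_gt (by linarith)
        all_goals exact ne_of_lt (by linarith))
    have : ((X.card + Y.card : ℕ) : ℚ) = 20 := by
      apply mul_right_cancel₀ hs0.ne'
      push_cast
      linarith
    have : X.card + Y.card = 20 := by exact_mod_cast this
    omega

theorem exists_isE8RootSystem (hcard : Φ.card + finrank ℚ V = 248) :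
    ∃ B' : LinearMap.BilinForm ℚ V, IsE8RootSystem B' Φ ∧
      ∀ α ∈ Φ, ∀ β, B' β α = 2 * B β α / B α α := by
  have hr := h.finrank_eq_eight hcard
  have hc : Φ.card = 240 := by omega
  obtain ⟨α, hα⟩ : Φ.Nonempty := Finset.card_pos.1 (by omega)
  obtain ⟨M, hM⟩ : ∃ M, B α α = M := ⟨_, rfl⟩
  have hn : ∀ β ∈ Φ, B β β = M := fun β hβ ↦ hM ▸ h.norm_eq hr hc hβ hα
  have hM0 : 0 < M := hM ▸ h.norm_pos hα
  have key : ∀ x y, ((2 / M) • B) x y = 2 / M * B x y := fun x y ↦ by simp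
  refine ⟨(2 / M) • B, ?_, ?_⟩
  · refine ⟨?_, ?_, ?_, ?_, ?_, hr, hc, ?_⟩
    · intro x y
      rw [key, key, h.symm]
    · intro x hx
      rw [key]
      exact mul_pos (by positivity) (h.pos x hx)
    · intro β hβ
      rw [key, hn β hβ]
      field_simp
    · intro β hβ γ hγ
      by_cases h1 : γ = β
      · exact .inl h1
      by_cases h2 : γ = -β
      · exact .inr (.inl h2)
      have := h.form_of_norm_le hβ hγ h1 h2 (by rw [hn β hβ, hn γ hγ])
      rw [hn β hβ] at this
      rw [key]
      right; right
      rcases this with h3 | h3 | h3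
      · left; rw [h3, mul_zero]
      · right; left; rw [div_mul_eq_mul_div, h3, div_self hM0.ne']
      · right; right; rw [div_mul_eq_mul_div, h3, neg_div, div_self hM0.ne']
    · intro β hβ γ hγ
      have := h.refl_mem hβ hγ
      rwa [hn β hβ, ← div_mul_eq_mul_div] at this
    · intro β hβ _
      obtain ⟨c, hc'⟩ := h.exists_schur Φ (fun α ha β ↦ h.refl_mem ha)
      have h1 := h.sum_sq hβ Φ subset_rfl (fun β ↦ h.neg_mem)
        (fun γ hγ ↦ by rw [hn β hβ, hn γ hγ])
      have h2 := h.schur_trace hc'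
      rw [Finset.sum_congr rfl (fun β hβ ↦ hn β hβ), Finset.sum_const,
        nsmul_eq_mul, hr, hc] at h2
      rw [hc', if_pos hβ, hn β hβ] at h1
      have h3 : (Φ.filter fun γ ↦ ((2 / M) • B) γ β = 1) = Φ.filter fun γ ↦ 2 * B γ β = M := by
        refine Finset.filter_congr fun γ _ ↦ ?_
        rw [key, div_mul_eq_mul_div, div_eq_one_iff_eq hM0.ne']
      rw [h3]
      have h4 : c = 30 * M := by push_cast at h2; linarith
      have h5 : ((Φ.filter fun γ ↦ 2 * B γ β = M).card : ℚ) = 56 := by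
        rw [h4] at h1
        apply mul_left_cancel₀ (mul_pos hM0 hM0).ne'
        linarith
      exact_mod_cast h5
  · intro β hβ γ
    rw [key, hn β hβ, div_mul_eq_mul_div]

end IsEuclideanRootSystem

namespace IsE8RootSystem

variable {V : Type*} [AddCommGroup V] [Module ℚ V] {B : LinearMap.BilinForm ℚ V} {Φ : Finset V}
  (h : IsE8RootSystem B Φ)
include h

lemma finiteDimensional : FiniteDimensional ℚ V :=
  FiniteDimensional.of_finrank_pos (by rw [h.finrank]; norm_num)

lemma neg_mem {α : V} (hα : α ∈ Φ) : -α ∈ Φ := by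
  have := h.refl α hα α hα
  rwa [h.norm α hα, two_smul, sub_add_cancel_left] at this

lemma neg_mem_iff {α : V} : -α ∈ Φ ↔ α ∈ Φ :=
  ⟨fun ha ↦ by simpa using h.neg_mem ha, h.neg_mem⟩

lemma sub_mem {α β : V} (hα : α ∈ Φ) (hβ : β ∈ Φ) (hp : B β α = 1) : β - α ∈ Φ := by
  have := h.refl α hα β hβ
  rwa [hp, one_smul] at this

lemma add_mem {α β : V} (hα : α ∈ Φ) (hβ : β ∈ Φ) (hp : B β α = -1) : β + α ∈ Φ := by
  have := h.refl α hα β hβ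
  rwa [hp, neg_smul, one_smul, sub_neg_eq_add] at this

lemma eq_of_form_eq_two {α β : V} (hα : α ∈ Φ) (hβ : β ∈ Φ) (hp : B β α = 2) : β = α := by
  rcases h.form α hα β hβ with h1 | rfl | h1 | h1 | h1
  · exact h1
  · simp [h.norm α hα] at hp; norm_num at hp
  all_goals rw [hp] at h1; norm_num at h1

lemma exists_many_common [DecidableEq V] {α : V} (hα : α ∈ Φ) :
    ∃ β ∈ Φ, B β α = 0 ∧
      11 < (Φ.filter fun γ ↦ B γ α = 1 ∧ B γ β = 1).card := by
  by_contra! hc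
  set N := Φ.filter fun γ ↦ B γ α = 1 with hN
  set O := Φ.filter fun γ ↦ B γ α = 0 with hO
  have h1 : ∑ β ∈ O, (N.bipartiteAbove (fun β γ ↦ B γ β = 1) β).card ≤ O.card • 11 := by
    refine Finset.sum_le_card_nsmul _ _ _ fun β hβ ↦ ?_
    obtain ⟨hβ, hβα⟩ := Finset.mem_filter.1 hβ
    refine le_trans (Finset.card_le_card ?_) (hc β hβ hβα)
    intro γ
    simp only [Finset.bipartiteAbove, hN, Finset.mem_filter]
    tauto
  have h2 : N.card • 27 ≤ ∑ γ ∈ N, (O.bipartiteBelow (fun β γ ↦ B γ β = 1) γ).card := by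
    refine Finset.card_nsmul_le_sum _ _ _ fun γ hγ ↦ ?_
    obtain ⟨hγ, hγα⟩ := Finset.mem_filter.1 hγ
    have hcov : (Φ.filter fun β ↦ B β γ = 1) ⊆
        (Φ.filter fun β ↦ B β γ = 1 ∧ B β α = 1) ∪ (O.bipartiteBelow (fun β γ ↦ B γ β = 1) γ) ∪
          {α, γ - α} := by
      intro β hβ
      obtain ⟨hβ, hβγ⟩ := Finset.mem_filter.1 hβ
      simp only [Finset.mem_union, Finset.mem_filter, Finset.bipartiteBelow, hO,
        Finset.mem_insert, Finset.mem_singleton, h.symm γ β]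
      rcases h.form α hα β hβ with h1 | rfl | h1 | h1 | h1
      · simp [h1]
      · rw [map_neg, LinearMap.neg_apply, h.symm, hγα] at hβγ
        norm_num at hβγ
      · simp [hβ, hβγ, h1]
      · simp [hβ, hβγ, h1]
      · right; right
        have h2 : γ - β = α := by
          refine h.eq_of_form_eq_two hα (h.sub_mem hβ hγ (by rw [h.symm, hβγ])) ?_
          rw [map_sub, LinearMap.sub_apply, hγα, h1]
          norm_num
        rw [← h2, sub_sub_cancel]
    have hle : (Φ.filter fun β ↦ B β γ = 1 ∧ B β α = 1).card ≤
        (O.bipartiteBelow (fun β γ ↦ B γ β = 1) γ).card := by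
      refine Finset.card_le_card_of_injOn (fun β ↦ γ - β) ?_ (sub_right_injective.injOn)
      intro β hβ
      obtain ⟨hβ, hβγ, hβα⟩ := Finset.mem_filter.1 hβ
      simp only [Finset.coe_filter, Finset.bipartiteBelow, hO, Set.mem_ofPred_eq,
        Finset.mem_filter]
      refine ⟨⟨h.sub_mem hβ hγ (by rw [h.symm, hβγ]), ?_⟩, ?_⟩
      · rw [map_sub, LinearMap.sub_apply, hγα, hβα, sub_self]
      · rw [map_sub, h.norm γ hγ, h.symm γ β, hβγ]; norm_num
    have h3 := Finset.card_le_card hcov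
    rw [h.card_one γ hγ] at h3
    have h4 := Finset.card_union_le ((Φ.filter fun β ↦ B β γ = 1 ∧ B β α = 1) ∪
      (O.bipartiteBelow (fun β γ ↦ B γ β = 1) γ)) {α, γ - α}
    have h5 := Finset.card_union_le (Φ.filter fun β ↦ B β γ = 1 ∧ B β α = 1)
      (O.bipartiteBelow (fun β γ ↦ B γ β = 1) γ)
    have h6 : ({α, γ - α} : Finset V).card ≤ 2 := Finset.card_le_two
    omega
  rw [← Finset.sum_card_bipartiteAbove_eq_sum_card_bipartiteBelow] at h2
  have hN56 : N.card = 56 := h.card_one α hα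
  have hO128 : O.card + N.card + N.card ≤ 240 := by
    have hneg : (N.image Neg.neg).card = N.card := Finset.card_image_of_injective _ neg_injective
    have hd1 : Disjoint O N := by
      rw [Finset.disjoint_left]
      intro β h1 h2
      have := (Finset.mem_filter.1 h1).2
      rw [(Finset.mem_filter.1 h2).2] at this
      norm_num at this
    have hd2 : Disjoint (O ∪ N) (N.image Neg.neg) := by
      rw [Finset.disjoint_right]
      intro β h1 h2
      obtain ⟨γ, hγ, rfl⟩ := Finset.mem_image.1 h1
      have hγ' := (Finset.mem_filter.1 hγ).2
      rcases Finset.mem_union.1 h2 with h2 | h2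
      all_goals
        have := (Finset.mem_filter.1 h2).2
        rw [map_neg, LinearMap.neg_apply, hγ'] at this
        norm_num at this
    have hcard : (O ∪ N ∪ N.image Neg.neg).card = O.card + N.card + N.card := by
      rw [Finset.card_union_of_disjoint hd2, Finset.card_union_of_disjoint hd1, hneg]
    rw [← hcard, ← h.card]
    refine Finset.card_le_card (Finset.union_subset (Finset.union_subset
      (Finset.filter_subset _ _) (Finset.filter_subset _ _)) ?_)
    intro β h1
    obtain ⟨γ, hγ, rfl⟩ := Finset.mem_image.1 h1
    exact h.neg_mem (Finset.mem_filter.1 hγ).1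
  have := h2.trans h1
  simp only [smul_eq_mul] at this
  omega

/-- There is an orthonormal frame exhibiting a subsystem of type `D₈`. -/
lemma exists_frame : ∃ e : Fin 8 → V, (∀ i j, B (e i) (e j) = if i = j then 1 else 0) ∧
    ∀ i j, i ≠ j → e i + e j ∈ Φ ∧ e i - e j ∈ Φ := by
  classical
  obtain ⟨α, hα⟩ : Φ.Nonempty := Finset.card_pos.1 (by rw [h.card]; norm_num)
  obtain ⟨β, hβ, hβα, hcard⟩ := h.exists_many_common hα
  set v := α + β with hv
  set T := Φ.filter fun γ ↦ B γ α = 1 ∧ B γ β = 1 with hT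
  have hαβ : B α β = 0 := by rw [h.symm, hβα]
  have hTv : ∀ t ∈ T, v - t ∈ Φ ∧ B (v - t) α = 1 ∧ B (v - t) β = 1 := by
    intro t ht
    obtain ⟨ht, ht1, ht2⟩ := Finset.mem_filter.1 ht
    refine ⟨?_, ?_, ?_⟩
    · have h1 : α - t ∈ Φ := h.sub_mem ht hα (by rw [h.symm, ht1])
      have h2 := h.add_mem hβ h1 (by rw [map_sub, LinearMap.sub_apply, hαβ, ht2]; norm_num)
      rwa [sub_add_eq_add_sub] at h2
    · simp only [hv, map_sub, map_add, LinearMap.sub_apply, LinearMap.add_apply, h.norm α hα, hβα,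
        ht1]
      norm_num
    · simp only [hv, map_sub, map_add, LinearMap.sub_apply, LinearMap.add_apply, h.norm β hβ, hαβ,
        ht2]
      norm_num
  obtain ⟨T', hT', hTcard, -, hT'v⟩ := Finset.exists_half T (fun t ↦ v - t)
    (fun t ht ↦ Finset.mem_filter.2 (hTv t ht)) (fun t _ ↦ sub_sub_cancel v t) (by
      intro t ht h1
      have h3 := (hTv t ht).1
      obtain ⟨ht, ht1, ht2⟩ := Finset.mem_filter.1 ht
      have h2 : B (v - t) t = 0 := by
        simp only [hv, map_sub, map_add, LinearMap.sub_apply, LinearMap.add_apply, h.symm α t,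
          h.symm β t, ht1, ht2, h.norm t ht]
        norm_num
      rw [h1, h.norm t ht] at h2
      norm_num at h2)
  have hαT' : α ∉ T' := by
    intro h1
    have := (Finset.mem_filter.1 (hT' h1)).2.1
    rw [h.norm α hα] at this
    norm_num at this
  obtain ⟨U, hU, hU7⟩ := Finset.exists_subset_card_eq (s := insert α T') (n := 7) (by
    rw [Finset.card_insert_of_notMem hαT']; omega)
  have hUm : ∀ t ∈ U, t ∈ Φ ∧ v - t ∈ Φ ∧ B t v = 2 := by
    intro t ht
    rcases Finset.mem_insert.1 (hU ht) with rfl | ht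
    · exact ⟨hα, by simpa [hv] using hβ, by rw [hv, map_add, h.norm t hα, hαβ, add_zero]⟩
    · have h1 := hTv t (hT' ht)
      obtain ⟨ht, ht1, ht2⟩ := Finset.mem_filter.1 (hT' ht)
      exact ⟨ht, h1.1, by rw [hv, map_add, ht1, ht2]; norm_num⟩
  have hUU : ∀ t ∈ U, ∀ t' ∈ U, t ≠ t' → B t t' = 1 := by
    have h1 : ∀ t ∈ T', B t α = 1 := fun t ht ↦ (Finset.mem_filter.1 (hT' ht)).2.1
    intro t ht t' ht' hne
    rcases Finset.mem_insert.1 (hU ht) with rfl | hT1 <;>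
      rcases Finset.mem_insert.1 (hU ht') with rfl | hT2
    · exact absurd rfl hne
    · rw [h.symm, h1 _ hT2]
    · exact h1 _ hT1
    · have h2 : B t (v - t') = 2 - B t t' := by rw [map_sub, (hUm t ht).2.2]
      rcases h.form t' (hUm t' ht').1 t (hUm t ht).1 with h3 | h3 | h3 | h3 | h3
      · exact absurd h3 hne
      · have := (hUm t ht).2.2
        rw [h3, map_neg, LinearMap.neg_apply, (hUm t' ht').2.2] at this
        norm_num at this
      · rw [h3, sub_zero] at h2
        have h4 := h.eq_of_form_eq_two (hUm t' ht').2.1 (hUm t ht).1 h2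
        rw [h4] at hT1
        exact absurd hT1 (hT'v t' hT2)
      · exact h3
      · rw [h3] at h2
        rcases h.form _ (hUm t' ht').2.1 t (hUm t ht).1 with h4 | h4 | h4 | h4 | h4
        · rw [h4, h.norm _ (hUm t' ht').2.1] at h2; norm_num at h2
        · rw [h4, map_neg, LinearMap.neg_apply, h.norm _ (hUm t' ht').2.1] at h2; norm_num at h2
        all_goals rw [h4] at h2; norm_num at h2
  obtain ⟨g⟩ : Nonempty (Fin 7 ≃ U) := ⟨(U.equivFinOfCardEq hU7).symm⟩
  have hvv : B v v = 4 := by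
    simp only [hv, map_add, LinearMap.add_apply, h.norm α hα, h.norm β hβ, hαβ, hβα]
    norm_num
  have hvt : ∀ t ∈ U, B v t = 2 := fun t ht ↦ by rw [h.symm, (hUm t ht).2.2]
  refine ⟨Fin.cons ((1 / 2 : ℚ) • v) fun i ↦ (g i : V) - (1 / 2 : ℚ) • v, ?_, ?_⟩
  · intro i j
    refine Fin.cases ?_ (fun i ↦ ?_) i <;> refine Fin.cases ?_ (fun j ↦ ?_) j
    · simp [hvv]; norm_num
    · simp [hvv, hvt _ (g j).2, (Fin.succ_ne_zero j).symm]; norm_num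
    · simp [hvv, (hUm _ (g i).2).2.2]; norm_num
    · by_cases hij : i = j
      · subst hij
        simp [hvv, (hUm _ (g i).2).2.2, hvt _ (g i).2, h.norm _ (hUm _ (g i).2).1]; norm_num
      · have : (g i : V) ≠ g j := fun h1 ↦ hij (g.injective (Subtype.ext h1))
        simp [hvv, (hUm _ (g i).2).2.2, hvt _ (g j).2, hUU _ (g i).2 _ (g j).2 this, hij]; norm_num
  · intro i j hij
    refine Fin.cases (fun h1 ↦ ?_) (fun i h1 ↦ ?_) i hij <;>
      [refine Fin.cases (fun h1 ↦ ?_) (fun j h1 ↦ ?_) j h1;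
       refine Fin.cases (fun h1 ↦ ?_) (fun j h1 ↦ ?_) j h1]
    · exact absurd rfl h1
    · have := hUm _ (g j).2
      simp only [Fin.cons_zero, Fin.cons_succ]
      refine ⟨?_, ?_⟩
      · convert this.1 using 1; module
      · convert this.2.1 using 1; module
    · have := hUm _ (g i).2
      simp only [Fin.cons_zero, Fin.cons_succ]
      refine ⟨?_, ?_⟩
      · convert this.1 using 1; module
      · convert h.neg_mem this.2.1 using 1; module
    · have hne : (g i : V) ≠ g j := fun h2 ↦ h1 (congr_arg _ (g.injective (Subtype.ext h2)))
      have h2 := hUm _ (g i).2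
      have h3 := hUm _ (g j).2
      have h4 := hUU _ (g i).2 _ (g j).2 hne
      simp only [Fin.cons_succ]
      refine ⟨?_, ?_⟩
      · convert h.sub_mem h3.2.1 h2.1 (by rw [map_sub, h2.2.2, h4]; norm_num) using 1; module
      · convert h.sub_mem h3.1 h2.1 h4 using 1; module

lemma expand {e : Fin 8 → V} (he : ∀ i j, B (e i) (e j) = if i = j then 1 else 0) (x : V) :
    x = ∑ i, B x (e i) • e i := by
  have := h.finiteDimensional
  have hli : LinearIndependent ℚ e := by
    refine LinearMap.linearIndependent_of_isOrthoᵢ (B := B) ?_ ?_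
    · rw [LinearMap.isOrthoᵢ_def]
      intro i j hij
      rw [he, if_neg hij]
    · intro i (h1 : B (e i) (e i) = 0)
      rw [he, if_pos rfl] at h1
      norm_num at h1
  have hsp := hli.span_eq_top_of_card_eq_finrank (by rw [h.finrank, Fintype.card_fin])
  rw [← sub_eq_zero]
  by_contra h0
  refine (h.pos _ h0).ne' ?_
  set y := x - ∑ i, B x (e i) • e i with hy
  have hyi : ∀ j, B y (e j) = 0 := by
    intro j
    simp [hy, he]
  have hyx : ∀ x, B y x = 0 := by
    intro x
    have hx : x ∈ Submodule.span ℚ (Set.range e) := by rw [hsp]; trivial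
    induction hx using Submodule.span_induction with
    | mem x hx => obtain ⟨i, rfl⟩ := hx; exact hyi i
    | zero => simp
    | add u v _ _ hu hv => rw [map_add, hu, hv, add_zero]
    | smul t u _ hu => rw [map_smul, hu, smul_zero]
  exact hyx y

lemma parseval {e : Fin 8 → V} (he : ∀ i j, B (e i) (e j) = if i = j then 1 else 0) (x : V) :
    B x x = ∑ i, B x (e i) * B x (e i) := by
  have h1 : B x (∑ i, B x (e i) • e i) = ∑ i, B x (e i) * B x (e i) := by
    simp only [map_sum, map_smul, smul_eq_mul]
  rw [← h1, ← h.expand he x]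

/-- Every simply laced root system with the invariants of `E₈` contains a base of type `E₈`. -/
theorem exists_gram : ∃ r : Fin 8 → V, (∀ i, r i ∈ Φ) ∧
    ∀ i j, B (r i) (r j) = (CartanMatrix.E₈ i j : ℚ) := by
  classical
  obtain ⟨e, he, hD⟩ := h.exists_frame
  obtain ⟨γ, hγ, hγD⟩ : ∃ γ ∈ Φ, ∀ i j, γ ≠ e i + e j ∧ γ ≠ e i - e j ∧ γ ≠ -(e i + e j) := by
    by_contra! hc
    obtain ⟨f, hf⟩ : ∃ f : (Fin 8 × Fin 8) → Fin 3 → V, ∀ p, f p = ![e p.1 + e p.2, e p.1 - e p.2, -(e p.1 + e p.2)] :=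
      ⟨_, fun _ ↦ rfl⟩
    have hsub : Φ ⊆ Finset.univ.image (fun q : (Fin 8 × Fin 8) × Fin 3 ↦ f q.1 q.2) := by
      intro γ hγ
      simp only [Finset.mem_image, Finset.mem_univ, true_and]
      obtain ⟨i, j, hij⟩ := hc γ hγ
      by_cases h1 : γ = e i + e j
      · exact ⟨((i, j), 0), (congr_fun (hf (i, j)) 0).trans h1.symm⟩
      by_cases h2 : γ = e i - e j
      · exact ⟨((i, j), 1), (congr_fun (hf (i, j)) 1).trans h2.symm⟩
      · exact ⟨((i, j), 2), (congr_fun (hf (i, j)) 2).trans (hij h1 h2).symm⟩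
    have h1 := (Finset.card_le_card hsub).trans Finset.card_image_le
    rw [h.card, Finset.card_univ] at h1
    simp at h1
  have hx : ∀ i j, i ≠ j → (B γ (e i) + B γ (e j) = 0 ∨ B γ (e i) + B γ (e j) = 1 ∨
      B γ (e i) + B γ (e j) = -1) ∧ (B γ (e i) - B γ (e j) = 0 ∨ B γ (e i) - B γ (e j) = 1 ∨
      B γ (e i) - B γ (e j) = -1) := by
    intro i j hij
    have h1 := h.form _ (hD i j hij).1 γ hγ
    have h2 := h.form _ (hD i j hij).2 γ hγ
    have h3 := hγD i j
    have h4 := (hγD j i).2.1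
    rw [map_add] at h1
    rw [map_sub, neg_sub] at h2
    tauto
  have hpar := h.parseval he γ
  rw [h.norm γ hγ] at hpar
  have hhalf : ∀ i, B γ (e i) = 1 / 2 ∨ B γ (e i) = -1 / 2 := by
    intro i
    by_contra! hi
    have hinner : ∀ i j, i ≠ j → B γ (e i) ≠ 1 / 2 ∧ B γ (e i) ≠ -1 / 2 →
        (B γ (e j) ≠ 1 / 2 ∧ B γ (e j) ≠ -1 / 2) ∧ (B γ (e i) = 0 ∨ B γ (e j) = 0) ∧
          (B γ (e i) = 0 ∨ B γ (e i) = 1 ∨ B γ (e i) = -1) := by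
      intro i j hij ⟨h1, h2⟩
      obtain ⟨hp | hp | hp, hq | hq | hq⟩ := hx i j hij
      all_goals first
        | exact absurd (by linarith : B γ (e i) = 1 / 2) h1
        | exact absurd (by linarith : B γ (e i) = -1 / 2) h2
        | skip
      · have e1 : B γ (e i) = 0 := by linarith
        have e2 : B γ (e j) = 0 := by linarith
        rw [e1, e2]; norm_num
      · have e1 : B γ (e i) = 1 := by linarith
        have e2 : B γ (e j) = 0 := by linarith
        rw [e1, e2]; norm_num
      · have e1 : B γ (e i) = 0 := by linarith
        have e2 : B γ (e j) = 1 := by linarith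
        rw [e1, e2]; norm_num
      · have e1 : B γ (e i) = 0 := by linarith
        have e2 : B γ (e j) = -1 := by linarith
        rw [e1, e2]; norm_num
      · have e1 : B γ (e i) = -1 := by linarith
        have e2 : B γ (e j) = 0 := by linarith
        rw [e1, e2]; norm_num
    have hall : ∀ j, B γ (e j) ≠ 1 / 2 ∧ B γ (e j) ≠ -1 / 2 := by
      intro j
      by_cases hij : i = j
      · exact hij ▸ hi
      · exact (hinner i j hij hi).1
    obtain ⟨j, hj⟩ : ∃ j, B γ (e j) ≠ 0 := by
      by_contra! hc
      simp [hc] at hpar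
    rw [Finset.sum_eq_single j] at hpar
    · obtain ⟨k, hk⟩ := exists_ne j
      rcases (hinner j k hk.symm (hall j)).2.2 with h1 | h1 | h1 <;> rw [h1] at hpar <;>
        norm_num at hpar
    · intro k _ hk
      rcases (hinner j k hk.symm (hall j)).2.1 with h1 | h1
      · exact absurd h1 hj
      · rw [h1, zero_mul]
    · simp
  clear hpar hx hγD
  have hsign : ∃ s : Fin 8 → ℚ, (∀ i, s i = 1 ∨ s i = -1) ∧
      ∀ i, B γ (s i • e i) = if i < 3 then -1 / 2 else 1 / 2 := by
    refine ⟨fun i ↦ 2 * B γ (e i) * if i < 3 then -1 else 1, fun i ↦ ?_, fun i ↦ ?_⟩ <;>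
      rcases hhalf i with h1 | h1 <;> dsimp only <;> split_ifs <;> simp [h1] <;> norm_num
  obtain ⟨s, hs, hsγ⟩ := hsign
  set e' : Fin 8 → V := fun i ↦ s i • e i with he'
  have hee : ∀ i j, B (e' i) (e' j) = if i = j then 1 else 0 := by
    intro i j
    by_cases hij : i = j
    · subst hij
      rcases hs i with h1 | h1 <;> simp [he', h1, he]
    · simp [he', he, hij]
  have hD' : ∀ i j, i ≠ j → e' i - e' j ∈ Φ := by
    intro i j hij
    have h1 := hD i j hij
    rcases hs i with hi | hi <;> rcases hs j with hj | hj <;> simp only [he', hi, hj]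
    · convert h1.2 using 1; module
    · convert h1.1 using 1; module
    · convert h.neg_mem h1.1 using 1; module
    · convert h.neg_mem h1.2 using 1; module
  have hγe : ∀ i, B (e' i) γ = if i < 3 then -1 / 2 else 1 / 2 := fun i ↦ by rw [h.symm, hsγ]
  have hγe' : ∀ i, B γ (e' i) = if i < 3 then -1 / 2 else 1 / 2 := hsγ
  refine ⟨![e' 0 - e' 1, γ, e' 1 - e' 2, e' 2 - e' 3, e' 3 - e' 4, e' 4 - e' 5, e' 5 - e' 6,
    e' 6 - e' 7], ?_, ?_⟩
  · intro i
    fin_cases i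
    exacts [hD' _ _ (by decide), hγ, hD' _ _ (by decide), hD' _ _ (by decide), hD' _ _ (by decide),
      hD' _ _ (by decide), hD' _ _ (by decide), hD' _ _ (by decide)]
  · clear_value e'
    intro i j
    fin_cases i <;> fin_cases j <;>
      simp [hee, hγe, hγe', h.norm γ hγ, CartanMatrix.E₈] <;> norm_num

end IsE8RootSystem

/-- The words obtained from `w` by repeatedly prepending a simple index, in a canonical way,
so that the sum of the corresponding simple roots of `E₈` remains a positive root. -/
def e8WordsFrom : ℕ → List (Fin 8) → List (List (Fin 8))
  | 0, w => [w]
  | n + 1, w => w :: ((List.finRange 8).filter fun i ↦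
      (w.map fun j ↦ CartanMatrix.E₈ j i).sum = -1 ∧
        ∀ k < i, ((i :: w).map fun j ↦ CartanMatrix.E₈ j k).sum ≠ 1).flatMap
      fun i ↦ e8WordsFrom n (i :: w)

/-- Words in simple indices representing the positive roots of `E₈`. -/
def e8Words : List (List (Fin 8)) :=
  (List.finRange 8).flatMap fun i ↦ e8WordsFrom 28 [i]

lemma e8Words_nodup : (e8Words.map fun w ↦ (List.finRange 8).map w.count).Nodup := by
  decide +kernel

lemma length_e8Words : e8Words.length = 120 := by decide +kernel

lemma e8WordsFrom_induction {P : List (Fin 8) → Prop}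
    (hstep : ∀ i w, P w → (w.map fun j ↦ CartanMatrix.E₈ j i).sum = -1 → P (i :: w))
    (n : ℕ) : ∀ w, P w → ∀ u ∈ e8WordsFrom n w, P u := by
  induction n with
  | zero =>
    intro w hw u hu
    rw [e8WordsFrom, List.mem_singleton] at hu
    rwa [hu]
  | succ n ih =>
    intro w hw u hu
    rw [e8WordsFrom, List.mem_cons, List.mem_flatMap] at hu
    rcases hu with rfl | ⟨i, hi, hu⟩
    · exact hw
    · have := (List.mem_filter.1 hi).2
      rw [decide_eq_true_eq] at this
      exact ih _ (hstep i w hw this.1) u hu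

lemma e8Words_induction {P : List (Fin 8) → Prop} (hs : ∀ i, P [i])
    (hstep : ∀ i w, P w → (w.map fun j ↦ CartanMatrix.E₈ j i).sum = -1 → P (i :: w)) :
    ∀ w ∈ e8Words, P w := by
  intro w hw
  obtain ⟨i, -, hi⟩ := List.mem_flatMap.1 hw
  exact e8WordsFrom_induction hstep _ _ (hs i) w hi

attribute [irreducible] e8Words

namespace IsE8RootSystem

variable {V : Type*} [AddCommGroup V] [Module ℚ V] {B : LinearMap.BilinForm ℚ V} {Φ : Finset V}
  {r : Fin 8 → V}

lemma form_word (hg : ∀ i j, B (r i) (r j) = (CartanMatrix.E₈ i j : ℚ)) (w : List (Fin 8))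
    (i : Fin 8) :
    B (w.map r).sum (r i) = ((w.map fun j ↦ CartanMatrix.E₈ j i).sum : ℤ) := by
  induction w with
  | nil => simp
  | cons j w ih =>
    rw [List.map_cons, List.sum_cons, LinearMap.BilinForm.add_left, ih, hg, List.map_cons,
      List.sum_cons, Int.cast_add]

lemma linearIndependent_of_gram (hg : ∀ i j, B (r i) (r j) = (CartanMatrix.E₈ i j : ℚ)) :
    LinearIndependent ℚ r := by
  rw [Fintype.linearIndependent_iff]
  intro c hc
  have hdet : (CartanMatrix.E₈.map (Int.cast : ℤ → ℚ)).det ≠ 0 := by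
    change ((Int.castRingHom ℚ).mapMatrix CartanMatrix.E₈).det ≠ 0
    rw [← RingHom.map_det, CartanMatrix.E₈_det]
    simp
  refine congr_fun (Matrix.eq_zero_of_mulVec_eq_zero hdet ?_)
  ext i
  have h1 : B (r i) (∑ j, c j • r j) = 0 := by rw [hc, map_zero]
  rw [map_sum] at h1
  rw [Matrix.mulVec, dotProduct, Pi.zero_apply, ← h1]
  refine Finset.sum_congr rfl fun j _ ↦ ?_
  rw [map_smul, hg, Matrix.map_apply, smul_eq_mul, mul_comm]

lemma sum_word (w : List (Fin 8)) : (w.map r).sum = ∑ i, (w.count i : ℚ) • r i := by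
  induction w with
  | nil => simp
  | cons j w ih =>
    rw [List.map_cons, List.sum_cons, ih]
    simp only [List.count_cons, beq_iff_eq, Nat.cast_add, add_smul, Finset.sum_add_distrib]
    rw [add_comm]
    simp

variable (h : IsE8RootSystem B Φ)
include h

lemma word_induction (hr : ∀ i, r i ∈ Φ)
    (hg : ∀ i j, B (r i) (r j) = (CartanMatrix.E₈ i j : ℚ)) {P : V → Prop} (hs : ∀ i, P (r i))
    (hstep : ∀ i, ∀ β ∈ Φ, P β → B β (r i) = -1 → β + r i ∈ Φ → P (β + r i)) :
    ∀ w ∈ e8Words, (w.map r).sum ∈ Φ ∧ P (w.map r).sum := by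
  refine e8Words_induction (fun i ↦ by simpa using ⟨hr i, hs i⟩) fun i w ⟨hw, hP⟩ hi ↦ ?_
  have h1 : B (w.map r).sum (r i) = -1 := by rw [form_word hg, hi]; norm_num
  have h2 := h.add_mem (hr i) hw h1
  rw [List.map_cons, List.sum_cons, add_comm]
  exact ⟨h2, hstep i _ hw hP h1 h2⟩

theorem exists_word (hr : ∀ i, r i ∈ Φ)
    (hg : ∀ i j, B (r i) (r j) = (CartanMatrix.E₈ i j : ℚ)) {γ : V} (hγ : γ ∈ Φ) :
    ∃ w ∈ e8Words, γ = (w.map r).sum ∨ γ = -(w.map r).sum := by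
  classical
  have hli := linearIndependent_of_gram hg
  have hli' := Fintype.linearIndependent_iff.1 hli
  have hmem := h.word_induction hr hg (P := fun _ ↦ True) (fun _ ↦ trivial)
    (fun _ _ _ _ _ _ ↦ trivial)
  have hinj : Set.InjOn (fun w : List (Fin 8) ↦ (w.map r).sum) (e8Words.toFinset : Set _) := by
    intro w hw w' hw' hww
    simp only [List.coe_toFinset, Set.mem_ofPred_eq] at hw hw'
    refine List.inj_on_of_nodup_map e8Words_nodup hw hw' ?_
    refine List.map_congr_left fun i _ ↦ ?_
    have h1 : ∑ i, ((w.count i : ℚ) - w'.count i) • r i = 0 := by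
      simp only [sub_smul, Finset.sum_sub_distrib, ← sum_word]
      exact sub_eq_zero.2 hww
    exact_mod_cast sub_eq_zero.1 (hli' _ h1 i)
  set Ψ := e8Words.toFinset.image (fun w ↦ (w.map r).sum) with hΨ
  have hΨcard : Ψ.card = 120 := by
    rw [hΨ, Finset.card_image_of_injOn hinj, List.toFinset_card_of_nodup
      (List.Nodup.of_map _ e8Words_nodup), length_e8Words]
  have hdisj : Disjoint Ψ (Ψ.image Neg.neg) := by
    rw [Finset.disjoint_left]
    intro x hx hx'
    obtain ⟨y, hy, rfl⟩ := Finset.mem_image.1 hx'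
    obtain ⟨w, hw, h1⟩ := Finset.mem_image.1 hx
    obtain ⟨w', hw', rfl⟩ := Finset.mem_image.1 hy
    have h2 : ∑ i, ((w.count i : ℚ) + w'.count i) • r i = 0 := by
      simp only [add_smul, Finset.sum_add_distrib, ← sum_word]
      rw [h1, neg_add_cancel]
    have h3 : ∀ i, w.count i = 0 := by
      intro i
      have : ((w.count i : ℚ) + w'.count i) = 0 := hli' _ h2 i
      norm_cast at this
      omega
    have h4 : (w.map r).sum = 0 := by simp [sum_word, h3]
    have := h.norm _ (hmem w (List.mem_toFinset.1 hw)).1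
    rw [h4] at this
    simp at this
  have hsub : Ψ ∪ Ψ.image Neg.neg ⊆ Φ := by
    have h1 : Ψ ⊆ Φ := by
      intro x hx
      obtain ⟨w, hw, rfl⟩ := Finset.mem_image.1 hx
      exact (hmem w (List.mem_toFinset.1 hw)).1
    refine Finset.union_subset h1 fun x hx ↦ ?_
    obtain ⟨y, hy, rfl⟩ := Finset.mem_image.1 hx
    exact h.neg_mem (h1 hy)
  have heq := Finset.eq_of_subset_of_card_le hsub (by
    rw [Finset.card_union_of_disjoint hdisj, Finset.card_image_of_injective _ neg_injective,
      hΨcard, h.card])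
  rw [← heq, Finset.mem_union] at hγ
  rcases hγ with hγ | hγ
  · obtain ⟨w, hw, rfl⟩ := Finset.mem_image.1 hγ
    exact ⟨w, List.mem_toFinset.1 hw, .inl rfl⟩
  · obtain ⟨y, hy, rfl⟩ := Finset.mem_image.1 hγ
    obtain ⟨w, hw, rfl⟩ := Finset.mem_image.1 hy
    exact ⟨w, List.mem_toFinset.1 hw, .inr rfl⟩

end IsE8RootSystem

namespace RootPairing

variable {ι K M N : Type*} [Fintype ι] [Field K] [CharZero K] [AddCommGroup M] [AddCommGroup N]
  [Module K M] [Module K N] [Module ℚ M]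

open Classical in
/-- The roots, as elements of the rational span of the roots. -/
noncomputable def ratRoots (P : RootPairing ι K M N) : Finset (P.rootSpan ℚ) :=
  Finset.univ.image (P.rootSpanMem ℚ)

variable (P : RootPairing ι K M N)

omit [CharZero K] in
lemma mem_ratRoots {v : P.rootSpan ℚ} : v ∈ P.ratRoots ↔ ∃ i, P.rootSpanMem ℚ i = v := by
  simp only [ratRoots, Finset.mem_image, Finset.mem_univ, true_and]

variable [P.IsCrystallographic]

lemma two_mul_rootFormIn (i j : ι) :
    2 * P.RootFormIn ℚ (P.rootSpanMem ℚ i) (P.rootSpanMem ℚ j) =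
      P.pairingIn ℤ i j * P.RootFormIn ℚ (P.rootSpanMem ℚ j) (P.rootSpanMem ℚ j) := by
  have := P.isAnisotropic_of_isValuedIn ℚ
  apply (algebraMap ℚ K).injective
  rw [map_mul, map_mul, algebraMap_rootFormIn, algebraMap_rootFormIn]
  have h1 := P.toInvariantForm.two_mul_apply_root_root i j
  have h2 : algebraMap ℚ K (P.pairingIn ℤ i j : ℤ) = P.pairing i j := by
    rw [← P.algebraMap_pairingIn ℤ]; simp
  rw [h2]
  simpa using h1

theorem isEuclideanRootSystem [P.IsReduced] [P.IsIrreducible] :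
    IsEuclideanRootSystem (P.RootFormIn ℚ) P.ratRoots := by
  let : Module ℚ N := Module.compHom N (algebraMap ℚ K)
  have := P.isAnisotropic_of_isValuedIn ℚ
  have hpos : ∀ x : P.rootSpan ℚ, x ≠ 0 → 0 < P.RootFormIn ℚ x x := fun x hx ↦
    P.posRootForm_rootFormIn_posDef ℚ x hx
  have hne : ∀ i, P.rootSpanMem ℚ i ≠ 0 := fun i hi ↦ P.ne_zero i (congr_arg Subtype.val hi)
  have hsymm : ∀ x y, P.RootFormIn ℚ x y = P.RootFormIn ℚ y x := fun x y ↦ by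
    simpa using (P.rootFormIn_isSymm ℚ).eq x y
  have hval := P.two_mul_rootFormIn
  refine ⟨hsymm, hpos, ?_, ?_, ?_, ?_, ?_⟩
  · have : (P.ratRoots : Set (P.rootSpan ℚ)) = Set.range (P.rootSpanMem ℚ) := by
      ext v; simp [mem_ratRoots]
    rw [this]
    have h2 : Set.range (P.rootSpanMem ℚ) =
        ((↑) ⁻¹' (Set.range P.root) : Set (Submodule.span ℚ (Set.range P.root))) := by
      ext v
      constructor
      · rintro ⟨i, rfl⟩; exact ⟨i, rfl⟩
      · rintro ⟨i, hi⟩; exact ⟨i, Subtype.ext hi⟩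
    rw [h2]
    exact Submodule.span_span_coe_preimage
  · intro α hα
    obtain ⟨i, rfl⟩ := P.mem_ratRoots.1 hα
    exact hne i
  · intro α hα β hβ
    obtain ⟨i, rfl⟩ := P.mem_ratRoots.1 hα
    obtain ⟨j, rfl⟩ := P.mem_ratRoots.1 hβ
    refine ⟨P.pairingIn ℤ j i, hval j i, P.mem_ratRoots.2 ⟨P.reflectionPerm i j, ?_⟩⟩
    apply Subtype.ext
    change P.root (P.reflectionPerm i j) = P.root j - ((P.pairingIn ℤ j i : ℤ) : ℚ) • P.root i
    rw [root_reflectionPerm, reflection_apply_root, ← P.algebraMap_pairingIn ℤ,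
      eq_intCast, Int.cast_smul_eq_zsmul, Int.cast_smul_eq_zsmul]
  · intro α hα c hc
    obtain ⟨i, rfl⟩ := P.mem_ratRoots.1 hα
    obtain ⟨j, hj⟩ := P.mem_ratRoots.1 hc
    have h1 : P.root j = c • P.root i := congr_arg Subtype.val hj
    have h2 : P.root j = (c : K) • P.root i := by rw [h1, Rat.cast_smul_eq_qsmul]
    have h3 := (P.isReduced_iff.1 inferInstance) j i (by
      rw [LinearIndependent.pair_iff]
      push Not
      refine ⟨1, -(c : K), ?_, ?_⟩
      · rw [h2]; simp
      · simp)
    have hc2 : ∀ d : ℚ, P.root j = d • P.root i → c = d := by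
      intro d hd
      have : (c - d) • P.rootSpanMem ℚ i = 0 := by
        apply Subtype.ext
        change (c - d) • P.root i = 0
        rw [sub_smul, ← h1, ← hd, sub_self]
      exact sub_eq_zero.1 ((smul_eq_zero.1 this).resolve_right (hne i))
    rcases h3 with h3 | h3
    · exact .inl (hc2 1 (by simpa using h3))
    · exact .inr (hc2 (-1) (by simpa using h3))
  · intro S hS hSne hcl
    let s : Set ι := {i | P.rootSpanMem ℚ i ∈ S}
    have hs : ∀ i, i ∈ s ↔ P.rootSpanMem ℚ i ∈ S := fun i ↦ Iff.rfl
    have horth : ∀ j, j ∉ s → ∀ i ∈ s, P.RootFormIn ℚ (P.rootSpanMem ℚ i) (P.rootSpanMem ℚ j) = 0 := by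
      intro j hj i hi
      by_contra h0
      exact hj ((hs j).2 (hcl _ ((hs i).1 hi) _ (P.mem_ratRoots.2 ⟨j, rfl⟩) h0))
    have htop : Submodule.span K (P.root '' s) = ⊤ := by
      apply P.span_root_image_eq_top_of_forall_orthogonal
      · obtain ⟨v, hv⟩ := hSne
        obtain ⟨i, rfl⟩ := P.mem_ratRoots.1 (hS hv)
        exact ⟨i, hv⟩
      · intro j hj i hi
        have hjs : j ∉ s := fun hjs ↦ hj (Submodule.subset_span ⟨j, hjs, rfl⟩)
        have h0 := horth j hjs i hi
        have h1 := hval i j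
        rw [h0, mul_zero, eq_comm, mul_eq_zero] at h1
        have h2 := h1.resolve_right (hpos _ (hne j)).ne'
        have h3 : P.pairingIn ℤ i j = 0 := by exact_mod_cast h2
        have h4 : P.pairing i j = 0 := by rw [← P.algebraMap_pairingIn ℤ, h3, map_zero]
        exact ⟨P.pairing_eq_zero_iff.1 h4, h4⟩
    refine Finset.Subset.antisymm hS fun v hv ↦ ?_
    obtain ⟨j, rfl⟩ := P.mem_ratRoots.1 hv
    by_contra hj
    have h1 : ∀ x ∈ Submodule.span K (P.root '' s), P.RootForm x (P.root j) = 0 := by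
      intro x hx
      induction hx using Submodule.span_induction with
      | mem x hx =>
        obtain ⟨i, hi, rfl⟩ := hx
        have := horth j hj i hi
        rw [← (algebraMap ℚ K).injective.eq_iff, algebraMap_rootFormIn, map_zero] at this
        exact this
      | zero => simp
      | add x y _ _ hx hy => rw [LinearMap.BilinForm.add_left, hx, hy, add_zero]
      | smul c x _ hx => rw [LinearMap.BilinForm.smul_left, hx, mul_zero]
    have h2 := h1 (P.root j) (htop ▸ Submodule.mem_top)
    have h3 : P.RootFormIn ℚ (P.rootSpanMem ℚ j) (P.rootSpanMem ℚ j) = 0 := by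
      rw [← (algebraMap ℚ K).injective.eq_iff, algebraMap_rootFormIn, map_zero]
      exact h2
    exact (hpos _ (hne j)).ne' h3

end RootPairing

lemma DirectSum.IsInternal.finrank_eq_sum {ι K M : Type*} [Fintype ι] [DecidableEq ι] [Field K]
    [AddCommGroup M] [Module K M] [FiniteDimensional K M] {N : ι → Submodule K M}
    (h : DirectSum.IsInternal N) : finrank K M = ∑ i, finrank K (N i) := by
  rw [← Module.finrank_directSum]
  exact (LinearEquiv.ofBijective (DirectSum.coeLinearMap N) h).finrank_eq.symm

namespace LieAlgebra

/-- A root space decomposition of type `E₈`, indexed by a rational vector space `V` containing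
the roots. -/
structure IsE8Decomposition {F L V : Type*} [Field F] [CharZero F] [LieRing L] [LieAlgebra F L]
    [AddCommGroup V] [Module ℚ V] (B : LinearMap.BilinForm ℚ V) (Φ : Finset V)
    (H : LieSubalgebra F L) (g : V → Submodule F L) : Prop where
  e8 : IsE8RootSystem B Φ
  zero : g 0 = H.toSubmodule
  finrank_zero : finrank F (g 0) = 8
  finrank_eq_one : ∀ γ ∈ Φ, finrank F (g γ) = 1
  eq_bot : ∀ γ, γ ≠ 0 → γ ∉ Φ → g γ = ⊥
  lie_mem : ∀ γ δ, ∀ x ∈ g γ, ∀ y ∈ g δ, ⁅x, y⁆ ∈ g (γ + δ)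
  lie_ne_zero : ∀ γ ∈ Φ, ∀ δ ∈ Φ, B γ δ = -1 →
    ∀ x ∈ g γ, ∀ y ∈ g δ, x ≠ 0 → y ≠ 0 → ⁅x, y⁆ ≠ 0
  exists_coroot : ∀ γ ∈ Φ, ∃ h ∈ g 0, h ≠ 0 ∧ (∀ δ, ∀ y ∈ g δ, ⁅h, y⁆ = (B γ δ : F) • y) ∧
    ∀ x ∈ g γ, x ≠ 0 → ∃ y ∈ g (-γ), ⁅x, y⁆ = h
  iSup_eq_top : ⨆ γ, g γ = ⊤
  iSupIndep : iSupIndep g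

open IsKilling LieModule

variable {F L : Type*} [Field F] [IsAlgClosed F] [CharZero F] [LieRing L] [LieAlgebra F L]
  [FiniteDimensional F L] [LieAlgebra.IsSimple F L]

/-- The root spaces, indexed by the rational span of the roots. -/
noncomputable def ratRootSpace (H : LieSubalgebra F L) [H.IsCartanSubalgebra]
    (γ : (rootSystem H).rootSpan ℚ) : Submodule F L :=
  (rootSpace H ((γ : Dual F H) : H → F)).toSubmodule

variable (H : LieSubalgebra F L) [H.IsCartanSubalgebra]

lemma ratRootSpace_injective :
    Function.Injective fun γ : (rootSystem H).rootSpan ℚ ↦ ((γ : Dual F H) : H → F) :=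
  DFunLike.coe_injective.comp Subtype.val_injective

lemma ratRootSpace_eq_bot {γ : (rootSystem H).rootSpan ℚ} (h0 : γ ≠ 0)
    (h : γ ∉ (rootSystem H).ratRoots) : ratRootSpace H γ = ⊥ := by
  by_contra hne
  apply h
  let w : Weight F H L := ⟨((γ : Dual F H) : H → F), by
    intro h'; apply hne; rw [ratRootSpace]; simp [rootSpace, h']⟩
  have hw : w.IsNonZero := by
    intro hw
    apply h0
    apply ratRootSpace_injective
    exact hw
  rw [RootPairing.mem_ratRoots]
  refine ⟨⟨w, by simpa using hw⟩, ?_⟩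
  apply ratRootSpace_injective
  rfl

lemma iSupIndep_ratRootSpace : iSupIndep (ratRootSpace H) := by
  have h1 := iSupIndep_genWeightSpace F H L
  have h2 := h1.comp (ratRootSpace_injective H)
  exact LieSubmodule.iSupIndep_toSubmodule.2 h2

lemma iSup_ratRootSpace : ⨆ γ, ratRootSpace H γ = ⊤ := by
  have h1 := iSup_genWeightSpace_eq_top' F H L
  rw [← LieSubmodule.toSubmodule_inj, LieSubmodule.iSup_toSubmodule, LieSubmodule.top_toSubmodule]
    at h1
  rw [eq_top_iff, ← h1]
  refine iSup_le fun w ↦ ?_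
  by_cases hw : w.IsZero
  · refine le_trans (le_of_eq ?_) (le_iSup _ 0)
    rw [ratRootSpace]
    congr 2
  · exact le_iSup (ratRootSpace H) ((rootSystem H).rootSpanMem ℚ ⟨w, by simpa using hw⟩)

lemma ratRootSpace_zero : ratRootSpace H 0 = H.toSubmodule := by
  have h1 := LieAlgebra.rootSpace_zero_eq F L H
  have h2 : ratRootSpace H 0 = (rootSpace H (0 : H → F)).toSubmodule := rfl
  rw [h2, h1, LieSubalgebra.coe_toLieSubmodule]

theorem exists_isE8Decomposition (hdim : finrank F L = 248) :
    ∃ B, IsE8Decomposition B (rootSystem H).ratRoots H (ratRootSpace H) := by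
  classical
  have hE := (rootSystem H).isEuclideanRootSystem
  have hrank : finrank ℚ ((rootSystem H).rootSpan ℚ) = finrank F H := by
    let : Module ℚ H := Module.compHom H (algebraMap ℚ F)
    rw [RootPairing.finrank_rootSpanIn, Subspace.dual_finrank_eq]
  have hone : ∀ γ ∈ (rootSystem H).ratRoots, finrank F (ratRootSpace H γ) = 1 := by
    intro γ hγ
    obtain ⟨i, rfl⟩ := (RootPairing.mem_ratRoots _).1 hγ
    exact finrank_rootSpace_eq_one (i : Weight F H L) ((Finset.mem_filter.1 i.2).2)
  have h0 : finrank F (ratRootSpace H 0) = finrank F H := by rw [ratRootSpace_zero]; rfl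
  have hcard : (rootSystem H).ratRoots.card + finrank F H = 248 := by
    set T := insert 0 (rootSystem H).ratRoots
    have h0n : (0 : (rootSystem H).rootSpan ℚ) ∉ (rootSystem H).ratRoots :=
      fun h ↦ hE.ne_zero _ h rfl
    have hT : DirectSum.IsInternal fun γ : T ↦ ratRootSpace H γ := by
      refine DirectSum.isInternal_submodule_of_iSupIndep_of_iSup_eq_top
        ((iSupIndep_ratRootSpace H).comp Subtype.val_injective) ?_
      rw [eq_top_iff, ← iSup_ratRootSpace H]
      refine iSup_le fun γ ↦ ?_
      by_cases hγ : γ ∈ T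
      · exact le_iSup (fun γ : T ↦ ratRootSpace H γ) ⟨γ, hγ⟩
      · rw [Finset.mem_insert, not_or] at hγ
        rw [ratRootSpace_eq_bot H hγ.1 hγ.2]
        exact bot_le
    have h1 := hT.finrank_eq_sum
    rw [hdim, Finset.sum_coe_sort T (fun γ ↦ finrank F (ratRootSpace H γ)),
      Finset.sum_insert h0n, h0, Finset.sum_congr rfl hone] at h1
    rw [h1, Finset.sum_const, smul_eq_mul, mul_one, add_comm]
  obtain ⟨B, hB, hBf⟩ := hE.exists_isE8RootSystem (by rw [hrank, hcard])
  have hpair : ∀ i : H.root, ∀ δ : (rootSystem H).rootSpan ℚ,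
      (δ : Dual F H) (coroot (i : Weight F H L)) =
        (B ((rootSystem H).rootSpanMem ℚ i) δ : F) := by
    intro i δ
    have hδ : δ ∈ Submodule.span ℚ ((rootSystem H).ratRoots : Set ((rootSystem H).rootSpan ℚ)) :=
      hE.span ▸ Submodule.mem_top
    induction hδ using Submodule.span_induction with
    | mem δ hδ =>
      obtain ⟨j, rfl⟩ := (RootPairing.mem_ratRoots _).1 hδ
      have hi := (rootSystem H).mem_ratRoots.2 ⟨i, rfl⟩
      have hp := (rootSystem H).two_mul_rootFormIn j i
      rw [hB.symm, hBf _ hi, hp, mul_div_cancel_right₀ _ (hE.norm_pos hi).ne', Rat.cast_intCast,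
        ← eq_intCast (algebraMap ℤ F), RootPairing.algebraMap_pairingIn]
      rfl
    | zero => simp
    | add x y _ _ hx hy =>
      rw [Submodule.coe_add, LinearMap.add_apply, hx, hy, map_add, Rat.cast_add]
    | smul c x _ hx =>
      rw [Submodule.coe_smul, LinearMap.smul_apply, hx, map_smul, smul_eq_mul, Rat.cast_mul,
        ← Rat.cast_smul_eq_qsmul F c, smul_eq_mul]
  have hact : ∀ i : H.root, ∀ δ, ∀ y ∈ ratRootSpace H δ, ⁅(coroot (i : Weight F H L) : L), y⁆ =
      (B ((rootSystem H).rootSpanMem ℚ i) δ : F) • y := by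
    intro i δ y hy
    have h1 := lie_eq_smul_of_mem_rootSpace (α := ((δ : Dual F H) : H → F)) hy
      (coroot (i : Weight F H L))
    rw [hpair] at h1
    exact h1
  have hsl : ∀ i : H.root, ∀ x ∈ ratRootSpace H ((rootSystem H).rootSpanMem ℚ i), x ≠ 0 →
      ∃ y ∈ ratRootSpace H (-(rootSystem H).rootSpanMem ℚ i),
        IsSl2Triple (coroot (i : Weight F H L) : L) x y := by
    intro i x hx hx0
    have hi : (i : Weight F H L).IsNonZero := (Finset.mem_filter.1 i.2).2
    obtain ⟨h, e, f, hs, he, hf⟩ := exists_isSl2Triple_of_weight_isNonZero hi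
    have hh := hs.h_eq_coroot hi he hf
    subst hh
    have hmem := (rootSystem H).mem_ratRoots.2 ⟨i, rfl⟩
    obtain ⟨c, hc⟩ := (finrank_eq_one_iff_of_nonzero' (⟨e, he⟩ : ratRootSpace H
      ((rootSystem H).rootSpanMem ℚ i)) (fun h ↦ hs.e_ne_zero (congr_arg Subtype.val h))).1
      (hone _ hmem) ⟨x, hx⟩
    have hc' : c • e = x := congr_arg Subtype.val hc
    have hc0 : c ≠ 0 := by rintro rfl; exact hx0 (by rw [← hc', zero_smul])
    have hf' : f ∈ ratRootSpace H (-(rootSystem H).rootSpanMem ℚ i) := hf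
    refine ⟨c⁻¹ • f, Submodule.smul_mem _ _ hf', ?_⟩
    rw [← hc']
    refine ⟨hs.h_ne_zero, ?_, ?_, ?_⟩
    · rw [smul_lie, lie_smul, smul_smul, mul_inv_cancel₀ hc0, one_smul, hs.lie_e_f]
    · rw [lie_smul, hs.lie_h_e_nsmul, smul_comm]
    · rw [lie_smul, hs.lie_h_f_nsmul, smul_neg, smul_comm]
  refine ⟨B, hB, ratRootSpace_zero H, ?_, hone, fun γ ↦ ratRootSpace_eq_bot H, ?_, ?_, ?_,
    iSup_ratRootSpace H, iSupIndep_ratRootSpace H⟩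
  · rw [h0, ← hrank, hB.finrank]
  · intro γ δ x hx y hy
    exact lie_mem_genWeightSpace_of_mem_genWeightSpace hx hy
  · intro γ hγ δ hδ hγδ x hx y hy hx0 hy0 hxy
    obtain ⟨i, rfl⟩ := (RootPairing.mem_ratRoots _).1 hγ
    obtain ⟨f, hf, hs⟩ := hsl i x hx hx0
    have hP : hs.HasPrimitiveVectorWith y (-1 : F) := by
      refine ⟨hy0, ?_, hxy⟩
      rw [hact i δ y hy, hγδ]
      simp
    obtain ⟨n, hn⟩ := hP.exists_nat
    have : ((n + 1 : ℕ) : F) = 0 := by push_cast; rw [← hn]; ring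
    exact absurd this (Nat.cast_ne_zero.2 (Nat.succ_ne_zero n))
  · intro γ hγ
    obtain ⟨i, rfl⟩ := (RootPairing.mem_ratRoots _).1 hγ
    refine ⟨coroot (i : Weight F H L), ?_, ?_, hact i, fun x hx hx0 ↦ ?_⟩
    · rw [ratRootSpace_zero]; exact (coroot (i : Weight F H L)).2
    · have hi : (i : Weight F H L).IsNonZero := (Finset.mem_filter.1 i.2).2
      obtain ⟨h, e, f, hs, he, hf⟩ := exists_isSl2Triple_of_weight_isNonZero hi
      rw [← hs.h_eq_coroot hi he hf]
      exact hs.h_ne_zero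
    · obtain ⟨y, hy, hs⟩ := hsl i x hx hx0
      exact ⟨y, hy, hs.lie_e_f⟩

end LieAlgebra

lemma List.sum_map_neg_apply {ι M : Type*} [AddCommGroup M] (r : ι → M) (w : List ι) :
    (w.map fun i ↦ -r i).sum = -(w.map r).sum := by
  induction w with
  | nil => simp
  | cons i w ih => simp only [List.map_cons, List.sum_cons, ih, neg_add]

namespace LieAlgebra.IsE8Decomposition

variable {F L V : Type*} [Field F] [CharZero F] [LieRing L] [LieAlgebra F L]
  [AddCommGroup V] [Module ℚ V] {B : LinearMap.BilinForm ℚ V} {Φ : Finset V}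
  {H : LieSubalgebra F L} {g : V → Submodule F L} (h : IsE8Decomposition B Φ H g)
include h

lemma exists_ne_zero {γ : V} (hγ : γ ∈ Φ) : ∃ x ∈ g γ, x ≠ 0 := by
  have h1 := h.finrank_eq_one γ hγ
  by_contra! hc
  have : g γ = ⊥ := (Submodule.eq_bot_iff _).2 hc
  rw [this, finrank_bot] at h1
  omega

lemma exists_smul_eq {γ : V} (hγ : γ ∈ Φ) {x y : L} (hx : x ∈ g γ) (hx0 : x ≠ 0) (hy : y ∈ g γ) :
    ∃ c : F, c • x = y := by
  obtain ⟨c, hc⟩ := (finrank_eq_one_iff_of_nonzero' (⟨x, hx⟩ : g γ)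
    (fun h ↦ hx0 (congr_arg Subtype.val h))).1 (h.finrank_eq_one γ hγ) ⟨y, hy⟩
  exact ⟨c, congr_arg Subtype.val hc⟩

lemma exists_lie_eq {β γ : V} (hβ : β ∈ Φ) (hγ : γ ∈ Φ) (hβγ : B β γ = -1) {x y z : L}
    (hx : x ∈ g β) (hx0 : x ≠ 0) (hy : y ∈ g γ) (hy0 : y ≠ 0) (hz : z ∈ g (β + γ)) :
    ∃ c : F, z = ⁅x, c • y⁆ := by
  obtain ⟨c, hc⟩ := h.exists_smul_eq (h.e8.add_mem hγ hβ hβγ) (h.lie_mem _ _ _ hx _ hy)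
    (h.lie_ne_zero β hβ γ hγ hβγ x hx y hy hx0 hy0) hz
  exact ⟨c, by rw [lie_smul, hc]⟩

lemma le_of_word {r : Fin 8 → V} (hr : ∀ i, r i ∈ Φ)
    (hg : ∀ i j, B (r i) (r j) = (CartanMatrix.E₈ i j : ℚ)) {S : LieSubalgebra F L}
    (hS : ∀ i, g (r i) ≤ S.toSubmodule) :
    ∀ w ∈ e8Words, (w.map r).sum ∈ Φ ∧ g (w.map r).sum ≤ S.toSubmodule := by
  refine h.e8.word_induction hr hg (P := fun β ↦ g β ≤ S.toSubmodule) hS ?_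
  intro i β hβ hβS hβi hβr z hz
  obtain ⟨x, hx, hx0⟩ := h.exists_ne_zero hβ
  obtain ⟨y, hy, hy0⟩ := h.exists_ne_zero (hr i)
  obtain ⟨c, rfl⟩ := h.exists_lie_eq hβ (hr i) hβi hx hx0 hy hy0 hz
  exact S.lie_mem (hβS hx) (S.smul_mem c (hS i hy))

theorem exists_basis {r : Fin 8 → V} (hr : ∀ i, r i ∈ Φ)
    (hg : ∀ i j, B (r i) (r j) = (CartanMatrix.E₈ i j : ℚ)) {e f : Fin 8 → L}
    (he : ∀ i, e i ∈ g (r i)) (hf : ∀ i, f i ∈ g (-r i)) (he0 : ∀ i, e i ≠ 0)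
    (hef : ∀ i δ, ∀ y ∈ g δ, ⁅⁅e i, f i⁆, y⁆ = (B (r i) δ : F) • y) :
    ∃ b : Basis (Fin 8) H, b.A = CartanMatrix.E₈ ∧ b.e = e ∧ b.f = f := by
  have hh : ∀ i, ⁅e i, f i⁆ ∈ g 0 := fun i ↦ by
    simpa using h.lie_mem _ _ _ (he i) _ (hf i)
  have hhe : ∀ i j, ⁅⁅e j, f j⁆, e i⁆ = CartanMatrix.E₈ i j • e i := fun i j ↦ by
    rw [hef j _ _ (he i), h.e8.symm, hg, Rat.cast_intCast, Int.cast_smul_eq_zsmul]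
  have hhf : ∀ i j, ⁅⁅e j, f j⁆, f i⁆ = -CartanMatrix.E₈ i j • f i := fun i j ↦ by
    rw [hef j _ _ (hf i), h.e8.symm, map_neg, LinearMap.neg_apply, hg, ← Int.cast_neg,
      Rat.cast_intCast, Int.cast_smul_eq_zsmul]
  have hsl : ∀ i, IsSl2Triple ⁅e i, f i⁆ (e i) (f i) := fun i ↦ by
    have h1 : ⁅⁅e i, f i⁆, e i⁆ = 2 • e i := by
      rw [hhe, CartanMatrix.E₈_diag]
      exact ofNat_smul_eq_nsmul ℤ 2 (e i)
    refine ⟨fun h0 ↦ ?_, rfl, h1, ?_⟩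
    · rw [h0, zero_lie, ← Nat.cast_smul_eq_nsmul F, eq_comm, smul_eq_zero] at h1
      rcases h1 with h1 | h1
      · norm_num at h1
      · exact he0 i h1
    · rw [hhf, CartanMatrix.E₈_diag, neg_smul]
      congr 1
      exact ofNat_smul_eq_nsmul ℤ 2 (f i)
  have hf0 : ∀ i, f i ≠ 0 := fun i ↦ (hsl i).f_ne_zero
  have hli : LinearIndependent F fun i ↦ ⁅e i, f i⁆ := by
    rw [Fintype.linearIndependent_iff]
    intro c hc
    have hdet : (CartanMatrix.E₈.map (Int.cast : ℤ → F)).det ≠ 0 := by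
      change ((Int.castRingHom F).mapMatrix CartanMatrix.E₈).det ≠ 0
      rw [← RingHom.map_det, CartanMatrix.E₈_det]
      simp
    refine congr_fun (Matrix.eq_zero_of_mulVec_eq_zero hdet ?_)
    ext i
    have h1 : ⁅∑ j, c j • ⁅e j, f j⁆, e i⁆ = 0 := by rw [hc, zero_lie]
    simp only [sum_lie, smul_lie, hhe, ← Int.cast_smul_eq_zsmul F, smul_smul,
      ← Finset.sum_smul] at h1
    rw [Matrix.mulVec, dotProduct, Pi.zero_apply, ← (smul_eq_zero.1 h1).resolve_right (he0 i)]
    exact Finset.sum_congr rfl fun j _ ↦ by rw [Matrix.map_apply, mul_comm]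
  have hspan : Submodule.span F (Set.range fun i ↦ ⁅e i, f i⁆) = g 0 := by
    have : FiniteDimensional F (g 0) := FiniteDimensional.of_finrank_pos (by
      rw [h.finrank_zero]; norm_num)
    refine Submodule.eq_of_le_of_finrank_eq ?_ ?_
    · rw [Submodule.span_le]
      rintro _ ⟨i, rfl⟩
      exact hh i
    · rw [finrank_span_eq_card hli, h.finrank_zero, Fintype.card_fin]
  have hhh : ∀ i j, ⁅⁅e i, f i⁆, ⁅e j, f j⁆⁆ = 0 := fun i j ↦ by
    rw [hef i _ _ (hh j), map_zero, Rat.cast_zero, zero_smul]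
  refine ⟨⟨CartanMatrix.E₈, fun i ↦ ⁅e i, f i⁆, e, f, ?_, ?_, hli, ?_, hsl, hhh, hhe, hhf, ?_⟩,
    rfl, rfl, rfl⟩
  · rw [← LieSubalgebra.toSubmodule_inj, LieSubalgebra.coe_lieSpan_eq_span_of_forall_lie_eq_zero,
      hspan, h.zero]
    rintro _ ⟨i, rfl⟩ _ ⟨j, rfl⟩
    exact hhh i j
  · set S := LieSubalgebra.lieSpan F L (Set.range e ∪ Set.range f) with hS
    have heS : ∀ i, e i ∈ S := fun i ↦ LieSubalgebra.subset_lieSpan (.inl ⟨i, rfl⟩)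
    have hfS : ∀ i, f i ∈ S := fun i ↦ LieSubalgebra.subset_lieSpan (.inr ⟨i, rfl⟩)
    have h1 := h.le_of_word hr hg (S := S) fun i x hx ↦ by
      obtain ⟨c, rfl⟩ := h.exists_smul_eq (hr i) (he i) (he0 i) hx
      exact S.smul_mem c (heS i)
    have h2 := h.le_of_word (r := fun i ↦ -r i) (fun i ↦ h.e8.neg_mem (hr i))
      (fun i j ↦ by rw [map_neg, map_neg, LinearMap.neg_apply, neg_neg, hg]) (S := S)
      fun i x hx ↦ by
        obtain ⟨c, rfl⟩ := h.exists_smul_eq (h.e8.neg_mem (hr i)) (hf i) (hf0 i) hx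
        exact S.smul_mem c (hfS i)
    rw [← LieSubalgebra.toSubmodule_inj, LieSubalgebra.top_toSubmodule, eq_top_iff,
      ← h.iSup_eq_top]
    refine iSup_le fun γ ↦ ?_
    by_cases h0 : γ = 0
    · rw [h0, ← hspan, Submodule.span_le]
      rintro _ ⟨i, rfl⟩
      exact S.lie_mem (heS i) (hfS i)
    by_cases hγ : γ ∈ Φ
    · obtain ⟨w, hw, rfl | rfl⟩ := h.e8.exists_word hr hg hγ
      · exact (h1 w hw).2
      · have h3 := (h2 w hw).2
        rwa [List.sum_map_neg_apply] at h3
    · rw [h.eq_bot γ h0 hγ]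
      exact bot_le
  · exact Matrix.nondegenerate_of_det_ne_zero (by rw [CartanMatrix.E₈_det]; exact one_ne_zero)
  · intro i j hij
    have hle : CartanMatrix.E₈ i j ≤ 0 := CartanMatrix.E₈_off_diag_nonpos i j hij
    have hle' : B (r i) (r j) ≤ 0 := by rw [hg]; exact_mod_cast hle
    have hn : 2 < B (r i + -r j) (r i + -r j) := by
      simp only [map_add, map_neg, LinearMap.add_apply, LinearMap.neg_apply]
      rw [h.e8.norm _ (hr i), h.e8.norm _ (hr j), h.e8.symm (r j)]
      linarith
    have h1 := h.lie_mem _ _ _ (he i) _ (hf j)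
    rw [h.eq_bot, Submodule.mem_bot] at h1
    · exact h1
    · intro h0
      rw [h0] at hn
      simp at hn
      linarith
    · intro hm
      rw [h.e8.norm _ hm] at hn
      exact lt_irrefl _ hn

end LieAlgebra.IsE8Decomposition

/-- The sign character of `ℤ/2`. -/
def signVal (F : Type*) [Field F] (z : ZMod 2) : F := if z = 0 then 1 else -1

section signVal

variable {F : Type*} [Field F]

lemma ZMod.two_cases : ∀ z : ZMod 2, z = 0 ∨ z = 1 := by decide

@[simp] lemma signVal_zero : signVal F 0 = 1 := if_pos rfl

@[simp] lemma signVal_one : signVal F 1 = -1 := if_neg one_ne_zero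

lemma signVal_add (a b : ZMod 2) : signVal F (a + b) = signVal F a * signVal F b := by
  have h2 : (1 : ZMod 2) + 1 = 0 := by decide
  rcases ZMod.two_cases a with rfl | rfl <;> rcases ZMod.two_cases b with rfl | rfl <;> simp [h2]

lemma signVal_mul_self (a : ZMod 2) : signVal F a * signVal F a = 1 := by
  rcases ZMod.two_cases a with rfl | rfl <;> simp

lemma signVal_ne_zero (a : ZMod 2) : signVal F a ≠ 0 := by
  rcases ZMod.two_cases a with rfl | rfl <;> simp

lemma signVal_injective [CharZero F] : Function.Injective (signVal F) := by
  have h1 : (1 : F) ≠ -1 := by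
    intro h
    have : (2 : F) = 0 := by linear_combination h
    norm_num at this
  intro a b h
  rcases ZMod.two_cases a with rfl | rfl <;> rcases ZMod.two_cases b with rfl | rfl <;> simp_all

lemma exists_signVal_of_mul_self {c : F} (hc : c * c = 1) : ∃ a, c = signVal F a := by
  rcases mul_self_eq_one_iff.1 hc with rfl | rfl
  · exact ⟨0, by simp⟩
  · exact ⟨1, by simp⟩

end signVal

lemma Submodule.eq_of_iSup_eq_top_of_le {ι R M : Type*} [Ring R] [AddCommGroup M] [Module R M]
    {p q : ι → Submodule R M} (hp : ⨆ i, p i = ⊤) (hq : iSupIndep q) (hpq : ∀ i, p i ≤ q i)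
    (i : ι) : p i = q i := by
  refine le_antisymm (hpq i) fun x hx ↦ ?_
  have h1 : x ∈ p i ⊔ ⨆ (j) (_ : j ≠ i), p j := by
    rw [← iSup_split_single]
    exact hp ▸ Submodule.mem_top
  obtain ⟨y, hy, z, hz, rfl⟩ := Submodule.mem_sup.1 h1
  have hz' : z ∈ ⨆ (j) (_ : j ≠ i), q j := iSup₂_mono (fun j _ ↦ hpq j) hz
  have hz0 : z = 0 := by
    have h2 : z ∈ q i := by simpa using sub_mem hx (hpq i hy)
    exact Submodule.disjoint_def.1 (hq i) z h2 hz'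
  rwa [hz0, add_zero]

namespace LieEquiv

variable {ι F L : Type*} [Field F] [CharZero F] [LieRing L] [LieAlgebra F L]

/-- The joint eigenspaces of a family of involutive automorphisms. -/
def jointEigenspace (τ : ι → L ≃ₗ⁅F⁆ L) (a : ι → ZMod 2) : Submodule F L where
  carrier := {x | ∀ k, τ k x = signVal F (a k) • x}
  add_mem' hx hy k := by rw [map_add, hx k, hy k, smul_add]
  zero_mem' k := by rw [map_zero, smul_zero]
  smul_mem' c x hx k := by rw [map_smul, hx k, smul_comm]

omit [CharZero F] in
lemma lie_mem_jointEigenspace {τ : ι → L ≃ₗ⁅F⁆ L} {a b : ι → ZMod 2} {x y : L}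
    (hx : x ∈ jointEigenspace τ a) (hy : y ∈ jointEigenspace τ b) :
    ⁅x, y⁆ ∈ jointEigenspace τ (a + b) := fun k ↦ by
  rw [map_lie, hx k, hy k, Pi.add_apply, signVal_add, smul_lie, lie_smul, smul_smul]

variable {τ : ι → L ≃ₗ⁅F⁆ L} (hc : ∀ i j x, τ i (τ j x) = τ j (τ i x)) (h2 : ∀ i x, τ i (τ i x) = x)

include hc in
lemma iSupIndep_jointEigenspace : iSupIndep (jointEigenspace τ) := by
  let f : ι → End F L := fun i ↦ (τ i).toLinearEquiv.toLinearMap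
  have hf : Pairwise fun i j ↦ Commute (f i) (f j) := fun i j _ ↦ by
    ext x; exact hc i j x
  have hf' : ∀ i j, Commute (f i) (f j) := fun i j ↦ by
    ext x; exact hc i j x
  have h1 := Module.End.independent_iInf_maxGenEigenspace_of_forall_mapsTo f
    fun i j φ ↦ Module.End.mapsTo_maxGenEigenspace_of_comm (hf' j i) φ
  have hinj : Function.Injective fun (a : ι → ZMod 2) (i : ι) ↦ signVal F (a i) := fun a b hab ↦
    funext fun i ↦ signVal_injective (congr_fun hab i)
  refine (h1.comp hinj).mono fun a x hx ↦ ?_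
  rw [Function.comp_apply, Submodule.mem_iInf]
  intro i
  apply Module.End.mem_maxGenEigenspace _ _ _ |>.2
  refine ⟨1, ?_⟩
  rw [pow_one, LinearMap.sub_apply]
  exact sub_eq_zero.2 (hx i)

include hc h2 in
lemma iSup_jointEigenspace [Finite ι] [FiniteDimensional F L] [IsAlgClosed F] :
    ⨆ a, jointEigenspace τ a = ⊤ := by
  let f : ι → End F L := fun i ↦ (τ i).toLinearEquiv.toLinearMap
  have hf : Pairwise fun i j ↦ Commute (f i) (f j) := fun i j _ ↦ by
    ext x; exact hc i j x
  have h1 := Module.End.iSup_iInf_maxGenEigenspace_eq_top_of_iSup_maxGenEigenspace_eq_top_of_commute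
    f hf fun i ↦ Module.End.iSup_maxGenEigenspace_eq_top (f i)
  rw [eq_top_iff, ← h1]
  refine iSup_le fun χ x hx ↦ ?_
  by_cases hx0 : x = 0
  · rw [hx0]; exact zero_mem _
  have hev : ∀ i, τ i x = χ i • x := by
    intro i
    have hss : (f i).IsSemisimple := by
      refine Module.End.isSemisimple_of_squarefree_aeval_eq_zero (p := Polynomial.X ^ 2 - 1) ?_ ?_
      · exact (Polynomial.X_pow_sub_one_separable_iff.2 (by norm_num)).squarefree
      · ext y
        rw [map_sub, map_pow, Polynomial.aeval_X, map_one, pow_two]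
        exact sub_eq_zero.2 (h2 i y)
    have h3 := (Submodule.mem_iInf _).1 hx i
    rw [hss.isFinitelySemisimple.maxGenEigenspace_eq_eigenspace,
      Module.End.mem_eigenspace_iff] at h3
    exact h3
  have hsq : ∀ i, χ i * χ i = 1 := by
    intro i
    have h3 := h2 i x
    rw [hev i, map_smul, hev i, smul_smul] at h3
    have h4 : (χ i * χ i - 1) • x = 0 := by rw [sub_smul, h3, one_smul, sub_self]
    exact sub_eq_zero.1 ((smul_eq_zero.1 h4).resolve_right hx0)
  choose a ha using fun i ↦ exists_signVal_of_mul_self (hsq i)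
  exact Submodule.mem_iSup_of_mem a fun i ↦ by rw [hev i, ha i]

end LieEquiv

namespace IsLieGrading

variable {ι F L : Type*} [Field F] [CharZero F] [LieRing L] [LieAlgebra F L]
  [DecidableEq (ι → ZMod 2)] {gr : (ι → ZMod 2) → Submodule F L} (h : IsLieGrading F gr)
include h

theorem exists_involutions : ∃ τ : ι → L ≃ₗ⁅F⁆ L, (∀ i j x, τ i (τ j x) = τ j (τ i x)) ∧
    (∀ i x, τ i (τ i x) = x) ∧ ∀ a, gr a = LieEquiv.jointEigenspace τ a := by
  classical
  have hinner : DirectSum.IsInternal gr := h.1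
  have htop := hinner.submodule_iSup_eq_top
  let T : ι → L →ₗ[F] L := fun k ↦
    (DirectSum.toModule F (ι → ZMod 2) L fun a ↦ signVal F (a k) • (gr a).subtype) ∘ₗ
      (LinearEquiv.ofBijective (DirectSum.coeLinearMap gr) hinner).symm.toLinearMap
  have hT : ∀ k a, ∀ x ∈ gr a, T k x = signVal F (a k) • x := by
    intro k a x hx
    have h1 : (LinearEquiv.ofBijective (DirectSum.coeLinearMap gr) hinner).symm x =
        DirectSum.lof F _ (fun a ↦ gr a) a ⟨x, hx⟩ := by
      rw [LinearEquiv.symm_apply_eq]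
      exact (DirectSum.coeLinearMap_lof gr a ⟨x, hx⟩).symm
    simp only [T, LinearMap.comp_apply, LinearEquiv.coe_coe, h1, DirectSum.toModule_lof]
    rfl
  have hind : ∀ {P : L → Prop}, (∀ a, ∀ x ∈ gr a, P x) → (∀ x y, P x → P y → P (x + y)) →
      ∀ x, P x := by
    intro P h1 h3 x
    have hx : x ∈ ⨆ a, gr a := htop ▸ Submodule.mem_top
    induction hx using Submodule.iSup_induction' with
    | mem a x hx => exact h1 a x hx
    | zero => exact h1 0 0 (zero_mem _)
    | add x y _ _ hx hy => exact h3 x y hx hy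
  have hTT : ∀ k x, T k (T k x) = x := fun k ↦ hind
    (fun a x hx ↦ by rw [hT k a x hx, map_smul, hT k a x hx, smul_smul, signVal_mul_self, one_smul])
    fun x y hx hy ↦ by rw [map_add, map_add, hx, hy]
  have hTc : ∀ i j x, T i (T j x) = T j (T i x) := fun i j ↦ hind
    (fun a x hx ↦ by rw [hT j a x hx, hT i a x hx, map_smul, map_smul, hT i a x hx, hT j a x hx,
      smul_comm])
    fun x y hx hy ↦ by simp only [map_add, hx, hy]
  have hTl : ∀ k x y, T k ⁅x, y⁆ = ⁅T k x, T k y⁆ := fun k x y ↦ by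
    revert x
    refine hind (fun a x hx ↦ ?_) fun x x' hx hx' ↦ by
      rw [add_lie, map_add, hx, hx', map_add, add_lie]
    revert y
    refine hind (fun b y hy ↦ ?_) fun y y' hy hy' ↦ by
      rw [lie_add, map_add, hy, hy', map_add, lie_add]
    rw [hT k a x hx, hT k b y hy, hT k _ _ (h.2 a b x hx y hy), Pi.add_apply, signVal_add,
      smul_lie, lie_smul, smul_smul]
  let τ : ι → L ≃ₗ⁅F⁆ L := fun k ↦
    { T k with
      map_lie' := hTl k _ _
      invFun := T k
      left_inv := hTT k
      right_inv := hTT k }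
  refine ⟨τ, hTc, hTT, Submodule.eq_of_iSup_eq_top_of_le htop
    (LieEquiv.iSupIndep_jointEigenspace hTc) fun a x hx k ↦ hT k a x hx⟩

end IsLieGrading

namespace LieAlgebra.IsKilling

variable {F L : Type*} [Field F] [CharZero F] [LieRing L] [LieAlgebra F L]
  [FiniteDimensional F L] [IsAlgClosed F] [IsKilling F L]

/-- The abstract Jordan decomposition. -/
lemma exists_isSemisimple_ad (x : L) : ∃ y : L, (ad F L y).IsSemisimple ∧
    IsNilpotent (ad F L x - ad F L y) ∧
    ∀ (c : F), ∀ w ∈ (ad F L x).maxGenEigenspace c, ⁅y, w⁆ = c • w := by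
  obtain ⟨N, -, S, hS₀, hN, hS, hSN⟩ := (ad F L x).exists_isNilpotent_isSemisimple
  replace hS₀ : Commute (ad F L x) S := Algebra.commute_of_mem_adjoin_self hS₀
  rw [eq_sub_of_add_eq hSN.symm] at hN
  have aux : ∀ c : F, ∀ w ∈ (ad F L x).maxGenEigenspace c, S w = c • w := by
    intro c w hw
    rw [Module.End.maxGenEigenspace_eq] at hw
    rw [Module.End.apply_eq_of_mem_of_comm_of_isFinitelySemisimple_of_isNil hw hS₀
      hS.isFinitelySemisimple hN]
  have htop := Module.End.iSup_maxGenEigenspace_eq_top (ad F L x)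
  have h_der : ∀ y z : L, S ⁅y, z⁆ = ⁅S y, z⁆ + ⁅y, S z⁆ := by
    intro y z
    have hy : y ∈ ⨆ c, (ad F L x).maxGenEigenspace c := htop ▸ Submodule.mem_top
    have hz : z ∈ ⨆ c, (ad F L x).maxGenEigenspace c := htop ▸ Submodule.mem_top
    induction hy using Submodule.iSup_induction' with
    | mem c y hy =>
      induction hz using Submodule.iSup_induction' with
      | mem d z hz =>
        rw [aux c y hy, aux d z hz, aux (c + d) _ (LieModule.lie_mem_maxGenEigenspace_toEnd hy hz),
          smul_lie, lie_smul, ← add_smul]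
      | zero => simp
      | add _ _ _ _ h h' => simp only [lie_add, map_add, h, h']; abel
    | zero => simp
    | add _ _ _ _ h h' => simp only [add_lie, map_add, h, h']; abel
  let S' : LieDerivation F L L := ⟨S, fun y z ↦ by
    rw [h_der, ← lie_skew (S y) z]; abel⟩
  obtain ⟨y, hy⟩ := LieDerivation.IsKilling.exists_eq_ad S'
  have hy' : S = ad F L y := by rw [← LieDerivation.coe_ad_apply_eq_ad_apply y, hy]
  refine ⟨y, hy' ▸ hS, by rwa [← hy'], fun c w hw ↦ ?_⟩
  rw [← ad_apply F, ← hy', aux c w hw]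

variable (F) in
omit [CharZero F] [IsAlgClosed F] in
include F in
lemma eq_of_forall_lie_eq {x y : L} (h : ∀ z : L, ⁅x, z⁆ = ⁅y, z⁆) : x = y := by
  have h1 : (x - y) ∈ LieAlgebra.center F L := by
    rw [LieModule.mem_maxTrivSubmodule]
    intro z
    rw [← lie_skew, sub_lie, h z, sub_self, neg_zero]
  rw [LieAlgebra.center_eq_bot] at h1
  exact sub_eq_zero.1 ((LieSubmodule.mem_bot _).1 h1)

end LieAlgebra.IsKilling

namespace LieEquiv

variable {ι F L : Type*} [Field F] [CharZero F] [LieRing L] [LieAlgebra F L]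
  {τ : ι → L ≃ₗ⁅F⁆ L}

omit [CharZero F] in
lemma lie_eq_zero_of_mem_jointEigenspace (h0 : jointEigenspace τ 0 = ⊥) {a : ι → ZMod 2} {x y : L}
    (hx : x ∈ jointEigenspace τ a) (hy : y ∈ jointEigenspace τ a) : ⁅x, y⁆ = 0 := by
  have h := lie_mem_jointEigenspace hx hy
  have ha : a + a = 0 := by
    funext k
    exact CharTwo.add_self_eq_zero (a k)
  rw [ha, h0] at h
  exact (Submodule.mem_bot F).1 h

variable [FiniteDimensional F L] [IsAlgClosed F] [LieAlgebra.IsKilling F L]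

omit [CharZero F] [FiniteDimensional F L] [IsAlgClosed F] [LieAlgebra.IsKilling F L] in
lemma killingForm_eq_zero_of_ne [CharZero F] {a b : ι → ZMod 2} (hab : a ≠ b) {x y : L}
    (hx : x ∈ jointEigenspace τ a) (hy : y ∈ jointEigenspace τ b) : killingForm F L x y = 0 := by
  obtain ⟨k, hk⟩ := Function.ne_iff.1 hab
  have h1 := LieAlgebra.killingForm_of_equiv_apply (τ k) x y
  rw [hx k, hy k, map_smul, map_smul, LinearMap.smul_apply, smul_smul, ← signVal_add] at h1
  have h2 : b k + a k = 1 := by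
    revert hk
    generalize a k = u; generalize b k = v
    revert u v; decide
  simp only [h2, signVal_one, smul_eq_mul] at h1
  have h3 : (2 : F) * killingForm F L x y = 0 := by linear_combination -h1
  exact (mul_eq_zero.1 h3).resolve_left two_ne_zero

variable (hc : ∀ i j x, τ i (τ j x) = τ j (τ i x)) (h2 : ∀ i x, τ i (τ i x) = x)
include hc h2

lemma isSemisimple_ad_of_mem_jointEigenspace [Finite ι] (h0 : jointEigenspace τ 0 = ⊥)
    {a : ι → ZMod 2} {x : L} (hx : x ∈ jointEigenspace τ a) :
    (LieAlgebra.ad F L x).IsSemisimple := by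
  obtain ⟨y, hss, hnil, hyw⟩ := LieAlgebra.IsKilling.exists_isSemisimple_ad (F := F) x
  have htop := Module.End.iSup_maxGenEigenspace_eq_top (LieAlgebra.ad F L x)
  have hya : y ∈ jointEigenspace τ a := by
    intro k
    have hmap : ∀ (c : F) (w : L), w ∈ (LieAlgebra.ad F L x).maxGenEigenspace c →
        τ k w ∈ (LieAlgebra.ad F L x).maxGenEigenspace (signVal F (a k) * c) := by
      intro c w hw
      obtain ⟨n, hn⟩ := (Module.End.mem_maxGenEigenspace _ _ _).1 hw
      refine (Module.End.mem_maxGenEigenspace _ _ _).2 ⟨n, ?_⟩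
      have hstep : ∀ (m : ℕ) (v : L), ((LieAlgebra.ad F L x - (signVal F (a k) * c) • 1) ^ m) (τ k v) =
          signVal F (a k) ^ m • τ k (((LieAlgebra.ad F L x - c • 1) ^ m) v) := by
        intro m
        induction m with
        | zero => intro v; simp
        | succ m ih =>
          intro v
          have h3 : (LieAlgebra.ad F L x - (signVal F (a k) * c) • 1) (τ k v) =
              signVal F (a k) • τ k ((LieAlgebra.ad F L x - c • 1) v) := by
            have h4 : ⁅x, τ k v⁆ = signVal F (a k) • τ k ⁅x, v⁆ := by
              rw [map_lie, hx k, smul_lie, smul_smul, signVal_mul_self, one_smul]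
            simp only [LinearMap.sub_apply, LieAlgebra.ad_apply, LinearMap.smul_apply,
              Module.End.one_apply, map_sub, map_smul, h4, smul_sub, smul_smul]
          rw [pow_succ, Module.End.mul_apply, h3, map_smul, ih, smul_smul, ← pow_succ', pow_succ,
            pow_succ, Module.End.mul_apply]
      rw [hstep, hn, map_zero, smul_zero]
    refine LieAlgebra.IsKilling.eq_of_forall_lie_eq F fun z ↦ ?_
    have key : ∀ z, ⁅y, τ k z⁆ = signVal F (a k) • τ k ⁅y, z⁆ := by
      intro z
      have hz : z ∈ ⨆ c, (LieAlgebra.ad F L x).maxGenEigenspace c := htop ▸ Submodule.mem_top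
      induction hz using Submodule.iSup_induction' with
      | mem c z hz => rw [hyw c z hz, hyw _ _ (hmap c z hz), map_smul, smul_smul]
      | zero => simp
      | add _ _ _ _ h h' => simp only [lie_add, map_add, h, h', smul_add]
    have h5 := key (τ k z)
    rw [h2, map_lie, h2] at h5
    rw [smul_lie, h5, smul_smul, signVal_mul_self, one_smul]
  have hza : x - y ∈ jointEigenspace τ a := sub_mem hx hya
  have hz0 : x - y = 0 := by
    have h6 : ∀ w, killingForm F L (x - y) w = 0 := by
      intro w
      have hw : w ∈ ⨆ b, jointEigenspace τ b := iSup_jointEigenspace hc h2 ▸ Submodule.mem_top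
      induction hw using Submodule.iSup_induction' with
      | mem b w hw =>
        by_cases hab : a = b
        · subst hab
          have hcomm : Commute (LieAlgebra.ad F L (x - y)) (LieAlgebra.ad F L w) := by
            ext v
            simp only [Module.End.mul_apply, LieAlgebra.ad_apply]
            rw [leibniz_lie, lie_eq_zero_of_mem_jointEigenspace h0 hza hw, zero_lie, zero_add]
          rw [killingForm_apply_apply]
          refine (LinearMap.isNilpotent_trace_of_isNilpotent ?_).eq_zero
          rw [← map_sub] at hnil
          exact hcomm.isNilpotent_mul_right hnil
        · exact killingForm_eq_zero_of_ne hab hza hw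
      | zero => simp
      | add _ _ _ _ h h' => rw [map_add, h, h', add_zero]
    have h7 : (x - y) ∈ LinearMap.ker (killingForm F L) :=
      LinearMap.mem_ker.2 (LinearMap.ext h6)
    rwa [LieAlgebra.IsKilling.ker_killingForm_eq_bot, Submodule.mem_bot] at h7
  rwa [sub_eq_zero.1 hz0]

end LieEquiv

namespace LieAlgebra

variable {F L : Type*} [Field F] [LieRing L] [LieAlgebra F L]

/-- The centralizer of a subspace. -/
def centralizerSubmodule (A : Submodule F L) : LieSubalgebra F L where
  carrier := {x | ∀ a ∈ A, ⁅x, a⁆ = 0}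
  add_mem' hx hy a ha := by rw [add_lie, hx a ha, hy a ha, add_zero]
  zero_mem' a _ := zero_lie a
  smul_mem' c x hx a ha := by rw [smul_lie, hx a ha, smul_zero]
  lie_mem' {x y} hx hy a ha := by rw [lie_lie, hx a ha, hy a ha, lie_zero, lie_zero, sub_zero]

lemma exists_isCartanSubalgebra_ge [Infinite F] [FiniteDimensional F L] (A : Submodule F L)
    (hA : ∀ x ∈ A, ∀ y ∈ A, ⁅x, y⁆ = 0) (hss : ∀ x ∈ A, (ad F L x).IsSemisimple) :
    ∃ H : LieSubalgebra F L, H.IsCartanSubalgebra ∧ A ≤ H.toSubmodule := by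
  set C := centralizerSubmodule A with hC
  obtain ⟨c, hc⟩ := exists_isCartanSubalgebra_engel F C
  set H' := LieSubalgebra.engel F c with hH'
  have hAC : ∀ a ∈ A, a ∈ C := fun a ha b hb ↦ hA a ha b hb
  have hAH' : ∀ a (ha : a ∈ A), (⟨a, hAC a ha⟩ : C) ∈ H' := by
    intro a ha
    rw [← hc.self_normalizing, LieSubalgebra.mem_normalizer_iff']
    intro y hy
    have : ⁅y, (⟨a, hAC a ha⟩ : C)⁆ = 0 := Subtype.ext (y.2 a ha)
    rw [this]; exact zero_mem _
  refine ⟨H'.map C.incl, ⟨?_, ?_⟩, fun a ha ↦ ?_⟩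
  · have hn := hc.nilpotent
    exact (LieEquiv.nilpotent_iff_equiv_nilpotent
      (H'.equivMapOfInjective (f := C.incl) Subtype.val_injective)).1 hn
  · refine le_antisymm (fun y hy ↦ ?_) (LieSubalgebra.le_normalizer _)
    rw [LieSubalgebra.mem_normalizer_iff'] at hy
    have hyC : y ∈ C := by
      intro a ha
      have h1 := hy a ⟨⟨a, hAC a ha⟩, hAH' a ha, rfl⟩
      obtain ⟨z, -, hz⟩ := h1
      have h2 : ⁅a, ⁅a, y⁆⁆ = 0 := by
        rw [← hz, ← lie_skew]
        exact neg_eq_zero.2 (z.2 a ha)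
      have h3 : y ∈ (ad F L a).maxGenEigenspace 0 := by
        refine (Module.End.mem_maxGenEigenspace _ _ _).2 ⟨2, ?_⟩
        rw [zero_smul, sub_zero, pow_two]
        exact h2
      rw [(hss a ha).isFinitelySemisimple.maxGenEigenspace_eq_eigenspace,
        Module.End.mem_eigenspace_iff, zero_smul, ad_apply] at h3
      rw [← lie_skew, h3, neg_zero]
    refine ⟨⟨y, hyC⟩, ?_, rfl⟩
    change _ ∈ H'
    rw [← hc.self_normalizing, LieSubalgebra.mem_normalizer_iff']
    intro z hz
    obtain ⟨w, hw, hw'⟩ := hy z ⟨z, hz, rfl⟩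
    have : w = ⁅z, (⟨y, hyC⟩ : C)⁆ := Subtype.ext hw'
    exact this ▸ hw
  · exact ⟨⟨a, hAC a ha⟩, hAH' a ha, rfl⟩

end LieAlgebra

namespace IsE8RootSystem

variable {V : Type*} [AddCommGroup V] [Module ℚ V] {B : LinearMap.BilinForm ℚ V} {Φ : Finset V}
  (h : IsE8RootSystem B Φ)
include h

lemma two_smul_expand {β : Fin 8 → V} (hβ : ∀ p q, B (β p) (β q) = if p = q then 2 else 0)
    (x : V) : (2 : ℚ) • x = ∑ p, B x (β p) • β p := by
  have := h.finiteDimensional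
  have hli : LinearIndependent ℚ β := by
    refine LinearMap.linearIndependent_of_isOrthoᵢ (B := B) ?_ ?_
    · rw [LinearMap.isOrthoᵢ_def]
      intro i j hij
      rw [hβ, if_neg hij]
    · intro i (h1 : B (β i) (β i) = 0)
      rw [hβ, if_pos rfl] at h1
      norm_num at h1
  have hsp := hli.span_eq_top_of_card_eq_finrank (by rw [h.finrank, Fintype.card_fin])
  rw [← sub_eq_zero]
  by_contra h0
  refine (h.pos _ h0).ne' ?_
  set y := (2 : ℚ) • x - ∑ i, B x (β i) • β i with hy
  have hyi : ∀ j, B y (β j) = 0 := by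
    intro j
    simp [hy, hβ, mul_comm]
  have hyx : ∀ x, B y x = 0 := by
    intro x
    have hx : x ∈ Submodule.span ℚ (Set.range β) := by rw [hsp]; trivial
    induction hx using Submodule.span_induction with
    | mem x hx => obtain ⟨i, rfl⟩ := hx; exact hyi i
    | zero => simp
    | add u v _ _ hu hv => rw [map_add, hu, hv, add_zero]
    | smul t u _ hu => rw [map_smul, hu, smul_zero]
  exact hyx y

lemma two_mul_form {β : Fin 8 → V} (hβ : ∀ p q, B (β p) (β q) = if p = q then 2 else 0)
    (x y : V) : 2 * B x y = ∑ p, B x (β p) * B y (β p) := by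
  have h1 := congr_arg (B y) (h.two_smul_expand hβ x)
  rw [map_smul, smul_eq_mul, map_sum, h.symm y x] at h1
  rw [h1]
  exact Finset.sum_congr rfl fun p _ ↦ by rw [map_smul, smul_eq_mul]

lemma eq_of_forall_form_eq {β : Fin 8 → V} (hβ : ∀ p q, B (β p) (β q) = if p = q then 2 else 0)
    {x y : V} (hxy : ∀ p, B x (β p) = B y (β p)) : x = y := by
  have h1 : (2 : ℚ) • x = (2 : ℚ) • y := by
    rw [h.two_smul_expand hβ x, h.two_smul_expand hβ y]
    exact Finset.sum_congr rfl fun p _ ↦ by rw [hxy p]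
  exact smul_right_injective V (two_ne_zero (α := ℚ)) h1

end IsE8RootSystem

/-- A colouring of the roots by `(ℤ/2)⁴`, additive on root sums and with no root of
colour zero. -/
structure IsE8Coloring {V : Type*} [AddCommGroup V] [Module ℚ V]
    (B : LinearMap.BilinForm ℚ V) (Φ : Finset V) (cl : V → Fin 4 → ZMod 2) : Prop where
  e8 : IsE8RootSystem B Φ
  neg : ∀ γ ∈ Φ, cl (-γ) = cl γ
  add : ∀ β ∈ Φ, ∀ γ ∈ Φ, B β γ = -1 → cl (β + γ) = cl β + cl γ
  ne_zero : ∀ γ ∈ Φ, cl γ ≠ 0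

namespace IsE8Coloring

variable {V : Type*} [AddCommGroup V] [Module ℚ V] {B : LinearMap.BilinForm ℚ V} {Φ : Finset V}
  {cl : V → Fin 4 → ZMod 2} (h : IsE8Coloring B Φ cl)

omit h in
lemma _root_.ZMod.two_pi_add_self {ι : Type*} (c : ι → ZMod 2) : c + c = 0 :=
  funext fun k ↦ CharTwo.add_self_eq_zero (c k)

include h

lemma sub {β γ : V} (hβ : β ∈ Φ) (hγ : γ ∈ Φ) (hp : B β γ = 1) :
    cl (β - γ) = cl β + cl γ := by
  rw [sub_eq_add_neg, h.add β hβ _ (h.e8.neg_mem hγ) (by rw [map_neg, hp]), h.neg γ hγ]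

lemma form_eq_zero_of_eq {β γ : V} (hβ : β ∈ Φ) (hγ : γ ∈ Φ) (hc : cl β = cl γ)
    (h1 : β ≠ γ) (h2 : β ≠ -γ) : B β γ = 0 := by
  rcases h.e8.form γ hγ β hβ with h3 | h3 | h3 | h3 | h3
  · exact absurd h3 h1
  · exact absurd h3 h2
  · exact h3
  · exact absurd (by rw [h.sub hβ hγ h3, hc, ZMod.two_pi_add_self])
      (h.ne_zero _ (h.e8.sub_mem hγ hβ h3))
  · exact absurd (by rw [h.add β hβ γ hγ h3, hc, ZMod.two_pi_add_self])
      (h.ne_zero _ (h.e8.add_mem hγ hβ h3))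

lemma form_ne_one_of_eq {β γ : V} (hβ : β ∈ Φ) (hγ : γ ∈ Φ) (hc : cl β = cl γ) :
    B β γ ≠ 1 := by
  intro h1
  have := h.form_eq_zero_of_eq hβ hγ hc
    (by rintro rfl; rw [h.e8.norm β hβ] at h1; norm_num at h1)
    (by rintro rfl; rw [map_neg, LinearMap.neg_apply, h.e8.norm γ hγ] at h1; norm_num at h1)
  rw [this] at h1
  exact zero_ne_one h1

lemma card_eq [DecidableEq V] {c : Fin 4 → ZMod 2} (hc : c ≠ 0) :
    (Φ.filter fun γ ↦ cl γ = c).card = 16 := by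
  have := h.e8.finiteDimensional
  have hle : ∀ c : Fin 4 → ZMod 2, (Φ.filter fun γ ↦ cl γ = c).card ≤ 16 := by
    intro c
    have := B.card_le_of_orthogonal_or_neg (Φ.filter fun γ ↦ cl γ = c) ?_ ?_
    · rwa [h.e8.finrank] at this
    · intro v hv
      rw [h.e8.norm v (Finset.mem_filter.1 hv).1]
      norm_num
    · intro v hv w hw
      rw [Finset.mem_filter] at hv hw
      by_cases h1 : v = w
      · exact .inl h1
      by_cases h2 : v = -w
      · exact .inr (.inl h2)
      exact .inr (.inr (h.form_eq_zero_of_eq hv.1 hw.1 (hv.2.trans hw.2.symm) h1 h2))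
  have hsum := Finset.card_eq_sum_card_fiberwise (f := cl) (s := Φ)
    (t := Finset.univ.erase (0 : Fin 4 → ZMod 2)) fun γ hγ ↦ by
      simpa using h.ne_zero γ hγ
  rw [h.e8.card] at hsum
  by_contra hne
  have hlt : ∑ b ∈ Finset.univ.erase (0 : Fin 4 → ZMod 2), (Φ.filter fun γ ↦ cl γ = b).card <
      ∑ b ∈ Finset.univ.erase (0 : Fin 4 → ZMod 2), 16 :=
    Finset.sum_lt_sum (fun b _ ↦ hle b) ⟨c, by simpa using hc, lt_of_le_of_ne (hle c) hne⟩
  rw [Finset.sum_const, Finset.card_erase_of_mem (Finset.mem_univ _), Finset.card_univ,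
    Fintype.card_fun, ZMod.card, Fintype.card_fin, ← hsum] at hlt
  norm_num at hlt

lemma exists_frame {c : Fin 4 → ZMod 2} (hc : c ≠ 0) : ∃ β : Fin 8 → V,
    (∀ p, β p ∈ Φ ∧ cl (β p) = c) ∧ (∀ p q, B (β p) (β q) = if p = q then 2 else 0) ∧
    ∀ γ ∈ Φ, cl γ = c → ∃ p, γ = β p ∨ γ = -β p := by
  classical
  have hne : ∀ γ ∈ Φ, -γ ≠ γ := fun γ hγ h1 ↦ by
    have h2 := h.e8.norm γ hγ
    nth_rewrite 1 [← h1] at h2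
    rw [map_neg, LinearMap.neg_apply, h.e8.norm γ hγ] at h2
    norm_num at h2
  obtain ⟨T, hT, hcard, hor, hT'⟩ := Finset.exists_half (Φ.filter fun γ ↦ cl γ = c) Neg.neg
    (fun γ hγ ↦ by
      rw [Finset.mem_filter] at hγ ⊢
      exact ⟨h.e8.neg_mem hγ.1, (h.neg γ hγ.1).trans hγ.2⟩) (fun γ _ ↦ neg_neg γ)
    fun γ hγ ↦ hne γ (Finset.mem_filter.1 hγ).1
  rw [h.card_eq hc] at hcard
  have e := (Finset.equivFinOfCardEq (show T.card = 8 by omega)).symm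
  have hm : ∀ p, (e p : V) ∈ Φ ∧ cl (e p) = c := fun p ↦ Finset.mem_filter.1 (hT (e p).2)
  refine ⟨fun p ↦ e p, hm, fun p q ↦ ?_, fun γ hγ hγc ↦ ?_⟩
  · split_ifs with hpq
    · rw [hpq, h.e8.norm _ (hm q).1]
    · refine h.form_eq_zero_of_eq (hm p).1 (hm q).1 ((hm p).2.trans (hm q).2.symm)
        (fun h1 ↦ hpq (e.injective (Subtype.ext h1))) fun h1 ↦ ?_
      exact hT' _ (e q).2 (h1 ▸ (e p).2)
  · rcases hor γ (Finset.mem_filter.2 ⟨hγ, hγc⟩) with h1 | h1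
    · exact ⟨e.symm ⟨γ, h1⟩, .inl (by simp)⟩
    · exact ⟨e.symm ⟨-γ, h1⟩, .inr (by simp)⟩

lemma sq_form {β : Fin 8 → V} {c : Fin 4 → ZMod 2} (hβ : ∀ p, β p ∈ Φ ∧ cl (β p) = c)
    {γ : V} (hγ : γ ∈ Φ) (hγc : cl γ ≠ c) (p : Fin 8) :
    B γ (β p) = 0 ∨ B γ (β p) = 1 ∨ B γ (β p) = -1 := by
  rcases h.e8.form _ (hβ p).1 γ hγ with h3 | h3 | h3
  · exact absurd (by rw [h3, (hβ p).2]) hγc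
  · exact absurd (by rw [h3, h.neg _ (hβ p).1, (hβ p).2]) hγc
  · exact h3

end IsE8Coloring

namespace IsE8Coloring

variable {V : Type*} [AddCommGroup V] [Module ℚ V] {B : LinearMap.BilinForm ℚ V} {Φ : Finset V}
  {cl : V → Fin 4 → ZMod 2} (h : IsE8Coloring B Φ cl) {β : Fin 8 → V} {c₁ : Fin 4 → ZMod 2}
  (hβ : ∀ p, β p ∈ Φ ∧ cl (β p) = c₁)
  (ho : ∀ p q, B (β p) (β q) = if p = q then 2 else 0)
include h hβ

lemma sq_sq {γ : V} (hγ : γ ∈ Φ) (hγc : cl γ ≠ c₁) (p : Fin 8) :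
    B γ (β p) ^ 2 = 0 ∨ B γ (β p) ^ 2 = 1 := by
  rcases h.sq_form hβ hγ hγc p with h1 | h1 | h1 <;> rw [h1] <;> norm_num

include ho

lemma exists_flip {γ : V} (hγ : γ ∈ Φ) (hγc : cl γ ≠ c₁) {p : Fin 8} (hp : B γ (β p) ≠ 0) :
    ∃ γ' ∈ Φ, cl γ' = cl γ + c₁ ∧
      ∀ q, B γ' (β q) = if q = p then -B γ (β q) else B γ (β q) := by
  refine ⟨γ - B γ (β p) • β p, h.e8.refl _ (hβ p).1 γ hγ, ?_, fun q ↦ ?_⟩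
  · rcases h.sq_form hβ hγ hγc p with h1 | h1 | h1
    · exact absurd h1 hp
    · rw [h1, one_smul, h.sub hγ (hβ p).1 h1, (hβ p).2]
    · rw [h1, neg_smul, one_smul, sub_neg_eq_add, h.add γ hγ _ (hβ p).1 h1, (hβ p).2]
  · rw [map_sub, map_smul, LinearMap.sub_apply, LinearMap.smul_apply, ho, smul_eq_mul]
    by_cases hq : q = p
    · rw [if_pos hq, if_pos hq.symm, hq]; ring
    · rw [if_neg hq, if_neg (Ne.symm hq)]; ring

lemma exists_signs {γ : V} (hγ : γ ∈ Φ) (hγc : cl γ ≠ c₁) {f : Fin 8} (hf : B γ (β f) ≠ 0)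
    {t : Fin 8 → ℚ} (ht : ∀ p, t p = 1 ∨ t p = -1) :
    ∃ γ' ∈ Φ, cl γ' = cl γ ∧ (∀ p, p ≠ f → B γ' (β p) = B γ (β p) ^ 2 * t p) ∧
      ∀ p, B γ' (β p) ^ 2 = B γ (β p) ^ 2 := by
  suffices ∀ A : Finset (Fin 8), f ∉ A → ∃ γ' ∈ Φ, cl γ' = cl γ ∧
      (∀ p ∈ A, B γ' (β p) = B γ (β p) ^ 2 * t p) ∧ ∀ p, B γ' (β p) ^ 2 = B γ (β p) ^ 2 by
    obtain ⟨γ', h1, h2, h3, h4⟩ := this (Finset.univ.erase f) (by simp)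
    exact ⟨γ', h1, h2, fun p hp ↦ h3 p (by simpa using hp), h4⟩
  intro A
  induction A using Finset.induction_on with
  | empty => exact fun _ ↦ ⟨γ, hγ, rfl, by simp, fun _ ↦ rfl⟩
  | insert a A ha ih =>
    intro hfA
    rw [Finset.mem_insert, not_or] at hfA
    obtain ⟨γ', h1, h2, h3, h4⟩ := ih hfA.2
    by_cases h5 : B γ' (β a) = B γ (β a) ^ 2 * t a
    · refine ⟨γ', h1, h2, fun p hp ↦ ?_, h4⟩
      rcases Finset.mem_insert.1 hp with rfl | hp
      · exact h5
      · exact h3 p hp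
    · have hc' : cl γ' ≠ c₁ := h2 ▸ hγc
      have ha0 : B γ' (β a) ≠ 0 := by
        intro h0
        apply h5
        rw [← h4 a, h0]; norm_num
      have hf0 : B γ' (β f) ≠ 0 := by
        intro h0
        have := h4 f
        rw [h0] at this
        exact pow_ne_zero 2 hf (by rw [← this]; norm_num)
      obtain ⟨γ₁, g1, g2, g3⟩ := h.exists_flip hβ ho h1 hc' ha0
      have hc₁ : cl γ₁ ≠ c₁ := by
        rw [g2]
        intro h6
        exact h.ne_zero γ' h1 (by simpa using h6)
      obtain ⟨γ₂, k1, k2, k3⟩ := h.exists_flip hβ ho g1 hc₁ (p := f) (by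
        rw [g3, if_neg hfA.1]; exact hf0)
      refine ⟨γ₂, k1, ?_, fun p hp ↦ ?_, fun p ↦ ?_⟩
      · rw [k2, g2, add_assoc, ZMod.two_pi_add_self, add_zero, h2]
      · rw [k3, g3]
        rcases Finset.mem_insert.1 hp with rfl | hpA
        · rw [if_neg (Ne.symm hfA.1), if_pos rfl, ← h4]
          rw [← h4] at h5
          rcases h.sq_form hβ h1 hc' p with h6 | h6 | h6
          · exact absurd h6 ha0
          · rcases ht p with h7 | h7
            · exact absurd (by rw [h6, h7]; norm_num) h5
            · rw [h6, h7]; norm_num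
          · rcases ht p with h7 | h7
            · rw [h6, h7]; norm_num
            · exact absurd (by rw [h6, h7]; norm_num) h5
        · rw [if_neg (fun e : p = f ↦ hfA.2 (e ▸ hpA)), if_neg (fun e : p = a ↦ ha (e ▸ hpA))]
          exact h3 p hpA
      · rw [k3, g3, ← h4]
        split_ifs <;> ring

omit hβ in
lemma sum_sq {γ : V} (hγ : γ ∈ Φ) : ∑ p, B γ (β p) ^ 2 = 4 := by
  have := h.e8.two_mul_form ho γ γ
  rw [h.e8.norm γ hγ] at this
  rw [Finset.sum_congr rfl fun p _ ↦ pow_two _, ← this]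
  norm_num

lemma exists_adjusted {γ γ' : V} (hγ : γ ∈ Φ) (hγc : cl γ ≠ c₁) (hγ' : γ' ∈ Φ) (hγc' : cl γ' ≠ c₁)
    {f : Fin 8} (hf : B γ (β f) ≠ 0) (hf' : B γ' (β f) = 0) :
    ∃ δ ∈ Φ, cl δ = cl γ ∧ (∀ p, B δ (β p) ^ 2 = B γ (β p) ^ 2) ∧
      ∀ p, B δ (β p) * B γ' (β p) = B γ (β p) ^ 2 * B γ' (β p) ^ 2 := by
  obtain ⟨δ, h1, h2, h3, h4⟩ := h.exists_signs hβ ho hγ hγc hf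
    (t := fun p ↦ if B γ' (β p) = 0 then 1 else B γ' (β p)) fun p ↦ by
      rcases h.sq_form hβ hγ' hγc' p with h6 | h6 | h6 <;> simp [h6]
  refine ⟨δ, h1, h2, h4, fun p ↦ ?_⟩
  by_cases hp : p = f
  · rw [hp, hf']; ring
  · rw [h3 p hp]
    by_cases h0 : B γ' (β p) = 0
    · rw [h0]; ring
    · simp only [h0, if_false]; ring

lemma sum_eq_zero_or_two {γ γ' : V} (hγ : γ ∈ Φ) (hγc : cl γ ≠ c₁) (hγ' : γ' ∈ Φ)
    (hγc' : cl γ' ≠ c₁) {f : Fin 8} (hf : B γ (β f) ≠ 0) (hf' : B γ' (β f) = 0) :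
    ∑ p, B γ (β p) ^ 2 * B γ' (β p) ^ 2 = 0 ∨
      (∑ p, B γ (β p) ^ 2 * B γ' (β p) ^ 2 = 2 ∧ cl γ ≠ cl γ') := by
  obtain ⟨δ, h1, h2, h3, h4⟩ := h.exists_adjusted hβ ho hγ hγc hγ' hγc' hf hf'
  have h5 := h.e8.two_mul_form ho δ γ'
  rw [Finset.sum_congr rfl fun p _ ↦ h4 p] at h5
  have h6 : 0 ≤ ∑ p, B γ (β p) ^ 2 * B γ' (β p) ^ 2 :=
    Finset.sum_nonneg fun p _ ↦ by positivity
  have h7 : ∑ p, B γ (β p) ^ 2 * B γ' (β p) ^ 2 < ∑ p, B γ (β p) ^ 2 := by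
    refine Finset.sum_lt_sum (fun p _ ↦ ?_) ⟨f, Finset.mem_univ _, ?_⟩
    · rcases h.sq_sq hβ hγ' hγc' p with h8 | h8 <;> rw [h8]
      · rw [mul_zero]; positivity
      · rw [mul_one]
    · rw [hf', zero_pow two_ne_zero, mul_zero]
      exact lt_of_le_of_ne (sq_nonneg _) (Ne.symm (pow_ne_zero 2 hf))
  rw [h.sum_sq ho hγ] at h7
  rw [← h5] at h6 h7 ⊢
  rcases h.e8.form γ' hγ' δ h1 with h8 | h8 | h8 | h8 | h8
  · rw [h8, h.e8.norm γ' hγ'] at h7; norm_num at h7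
  · rw [h8, map_neg, LinearMap.neg_apply, h.e8.norm γ' hγ'] at h6; norm_num at h6
  · left; rw [h8]; norm_num
  · right
    refine ⟨by rw [h8]; norm_num, fun h9 ↦ h.form_ne_one_of_eq h1 hγ' (h2.trans h9) h8⟩
  · rw [h8] at h6; norm_num at h6

lemma complement_of_sum_eq_zero {γ γ' : V} (hγ : γ ∈ Φ) (hγc : cl γ ≠ c₁) (hγ' : γ' ∈ Φ)
    (hγc' : cl γ' ≠ c₁) (hs : ∑ p, B γ (β p) ^ 2 * B γ' (β p) ^ 2 = 0) (p : Fin 8) :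
    B γ' (β p) ^ 2 = 1 - B γ (β p) ^ 2 := by
  have h1 := (Finset.sum_eq_zero_iff_of_nonneg fun p _ ↦ by positivity).1 hs
  have h2 : ∑ p, (1 - B γ (β p) ^ 2 - B γ' (β p) ^ 2) = 0 := by
    rw [Finset.sum_sub_distrib, Finset.sum_sub_distrib, h.sum_sq ho hγ, h.sum_sq ho hγ']
    norm_num
  have h3 := (Finset.sum_eq_zero_iff_of_nonneg fun p _ ↦ by
    have := h1 p (Finset.mem_univ _)
    rcases h.sq_sq hβ hγ hγc p with h4 | h4 <;> rcases h.sq_sq hβ hγ' hγc' p with h5 | h5 <;>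
      rw [h4, h5] at this ⊢ <;> norm_num <;> norm_num at this).1 h2 p (Finset.mem_univ _)
  linarith

lemma exists_complement {γ : V} (hγ : γ ∈ Φ) (hγc : cl γ ≠ c₁) :
    ∃ δ ∈ Φ, cl δ = cl γ ∧ ∀ p, B δ (β p) ^ 2 = 1 - B γ (β p) ^ 2 := by
  obtain ⟨q, hq⟩ : ∃ q, B γ (β q) = 0 := by
    by_contra! h0
    have h1 := h.sum_sq ho hγ
    rw [Finset.sum_congr rfl fun p _ ↦
      (h.sq_sq hβ hγ hγc p).resolve_left (pow_ne_zero 2 (h0 p))] at h1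
    norm_num at h1
  obtain ⟨ε, e1, e2, -⟩ := h.exists_frame (h.ne_zero γ hγ)
  obtain ⟨p, hp⟩ : ∃ p, B (β q) (ε p) ≠ 0 := by
    by_contra! h0
    have h1 := h.sum_sq e2 (hβ q).1
    rw [Finset.sum_congr rfl fun p _ ↦ by rw [h0 p]] at h1
    norm_num at h1
  rw [h.e8.symm] at hp
  have hc : cl (ε p) ≠ c₁ := (e1 p).2 ▸ hγc
  have h2 := (h.sum_eq_zero_or_two hβ ho (e1 p).1 hc hγ hγc hp hq).resolve_right
    fun h3 ↦ h3.2 (e1 p).2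
  refine ⟨ε p, (e1 p).1, (e1 p).2, h.complement_of_sum_eq_zero hβ ho hγ hγc (e1 p).1 hc ?_⟩
  rw [← h2]
  exact Finset.sum_congr rfl fun p _ ↦ mul_comm _ _

lemma color_eq_of_sq_eq {γ γ' : V} (hγ : γ ∈ Φ) (hγc : cl γ ≠ c₁) (hγ' : γ' ∈ Φ)
    (hγc' : cl γ' ≠ c₁) (hs : ∀ p, B γ (β p) ^ 2 = B γ' (β p) ^ 2) :
    cl γ' = cl γ ∨ cl γ' = cl γ + c₁ := by
  obtain ⟨f, hf⟩ : ∃ p, B γ (β p) ≠ 0 := by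
    by_contra! h0
    have h1 := h.sum_sq ho hγ
    rw [Finset.sum_congr rfl fun p _ ↦ by rw [h0 p]] at h1
    norm_num at h1
  obtain ⟨δ, h1, h2, h3, h4⟩ := h.exists_signs hβ ho hγ hγc hf
    (t := fun p ↦ if B γ' (β p) = 0 then 1 else B γ' (β p)) fun p ↦ by
      rcases h.sq_form hβ hγ' hγc' p with h6 | h6 | h6 <;> simp [h6]
  have h5 : ∀ p, p ≠ f → B δ (β p) = B γ' (β p) := by
    intro p hp
    rw [h3 p hp, hs]
    rcases h.sq_form hβ hγ' hγc' p with h6 | h6 | h6 <;> simp [h6]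
  have hf' : B γ' (β f) ≠ 0 := by
    intro h0
    have := hs f
    rw [h0] at this
    exact pow_ne_zero 2 hf (by rw [this]; norm_num)
  rcases sq_eq_sq_iff_eq_or_eq_neg.1 ((h4 f).trans (hs f)) with h6 | h6
  · left
    rw [← h2, h.e8.eq_of_forall_form_eq ho (x := δ) (y := γ') fun p ↦ ?_]
    by_cases hp : p = f
    · rw [hp, h6]
    · exact h5 p hp
  · right
    obtain ⟨ε, k1, k2, k3⟩ := h.exists_flip hβ ho hγ' hγc' hf'
    have h7 : ε = δ := h.e8.eq_of_forall_form_eq ho fun p ↦ by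
      rw [k3]
      split_ifs with hp
      · rw [hp, h6]
      · exact (h5 p hp).symm
    rw [← h2, ← h7, k2, add_assoc, ZMod.two_pi_add_self, add_zero]

lemma exists_separating {γ γ' : V} (hγ : γ ∈ Φ) (hγc : cl γ ≠ c₁) (hγ' : γ' ∈ Φ)
    (hγc' : cl γ' ≠ c₁) (hn : cl γ' ≠ cl γ) (hn' : cl γ' ≠ cl γ + c₁) :
    ∃ f, B γ (β f) ≠ 0 ∧ B γ' (β f) = 0 := by
  by_contra! h0
  have h1 : ∑ p, (B γ' (β p) ^ 2 - B γ (β p) ^ 2) = 0 := by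
    rw [Finset.sum_sub_distrib, h.sum_sq ho hγ, h.sum_sq ho hγ', sub_self]
  have h2 := (Finset.sum_eq_zero_iff_of_nonneg fun p _ ↦ by
    rcases h.sq_sq hβ hγ hγc p with h4 | h4
    · rw [h4, sub_zero]; positivity
    · have h5 : B γ (β p) ≠ 0 := by rintro h5; rw [h5] at h4; norm_num at h4
      rw [h4, (h.sq_sq hβ hγ' hγc' p).resolve_left (pow_ne_zero 2 (h0 p h5)), sub_self]).1 h1
  rcases h.color_eq_of_sq_eq hβ ho hγ hγc hγ' hγc'
    fun p ↦ (sub_eq_zero.1 (h2 p (Finset.mem_univ _))).symm with h3 | h3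
  · exact hn h3
  · exact hn' h3

lemma sum_eq_two {γ γ' : V} (hγ : γ ∈ Φ) (hγc : cl γ ≠ c₁) (hγ' : γ' ∈ Φ)
    (hγc' : cl γ' ≠ c₁) (hn : cl γ' ≠ cl γ) (hn' : cl γ' ≠ cl γ + c₁) :
    ∑ p, B γ (β p) ^ 2 * B γ' (β p) ^ 2 = 2 := by
  obtain ⟨f, hf, hf'⟩ := h.exists_separating hβ ho hγ hγc hγ' hγc' hn hn'
  rcases h.sum_eq_zero_or_two hβ ho hγ hγc hγ' hγc' hf hf' with h1 | h1
  · obtain ⟨δ, d1, d2, d3⟩ := h.exists_complement hβ ho hγ hγc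
    rcases h.color_eq_of_sq_eq hβ ho d1 (d2 ▸ hγc) hγ' hγc' fun p ↦ by
      rw [d3, h.complement_of_sum_eq_zero hβ ho hγ hγc hγ' hγc' h1 p] with h2 | h2
    · exact absurd (h2.trans d2) hn
    · exact absurd (h2.trans (by rw [d2])) hn'
  · exact h1.1

lemma sum_eq_one {γ₁ γ₂ γ₃ : V} (hγ₁ : γ₁ ∈ Φ) (hγc₁ : cl γ₁ ≠ c₁) (hγ₂ : γ₂ ∈ Φ)
    (hγc₂ : cl γ₂ ≠ c₁) (hγ₃ : γ₃ ∈ Φ) (hγc₃ : cl γ₃ ≠ c₁)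
    (h12 : cl γ₂ ≠ cl γ₁) (h12' : cl γ₂ ≠ cl γ₁ + c₁) (h13 : cl γ₃ ≠ cl γ₁)
    (h13' : cl γ₃ ≠ cl γ₁ + c₁) (h23 : cl γ₃ ≠ cl γ₂) (h23' : cl γ₃ ≠ cl γ₂ + c₁)
    (hc : cl γ₁ + cl γ₂ ≠ c₁) (h123 : cl γ₃ ≠ cl γ₁ + cl γ₂) (h123' : cl γ₃ ≠ cl γ₁ + cl γ₂ + c₁) :
    ∑ p, B γ₁ (β p) ^ 2 * B γ₂ (β p) ^ 2 * B γ₃ (β p) ^ 2 = 1 := by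
  obtain ⟨f, hf, hf'⟩ := h.exists_separating hβ ho hγ₁ hγc₁ hγ₂ hγc₂ h12 h12'
  obtain ⟨δ, d1, d2, d3, d4⟩ := h.exists_adjusted hβ ho hγ₁ hγc₁ hγ₂ hγc₂ hf hf'
  have s12 := h.sum_eq_two hβ ho hγ₁ hγc₁ hγ₂ hγc₂ h12 h12'
  have s13 := h.sum_eq_two hβ ho hγ₁ hγc₁ hγ₃ hγc₃ h13 h13'
  have s23 := h.sum_eq_two hβ ho hγ₂ hγc₂ hγ₃ hγc₃ h23 h23'
  have hδ : B δ γ₂ = 1 := by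
    have h5 := h.e8.two_mul_form ho δ γ₂
    rw [Finset.sum_congr rfl fun p _ ↦ d4 p, s12] at h5
    linarith
  have hcl : cl (δ - γ₂) = cl γ₁ + cl γ₂ := by rw [h.sub d1 hγ₂ hδ, d2]
  have h6 := h.sum_eq_two hβ ho (h.e8.sub_mem hγ₂ d1 hδ) (hcl ▸ hc) hγ₃ hγc₃ (hcl ▸ h123)
    (hcl ▸ h123')
  have h7 : ∀ p, B (δ - γ₂) (β p) ^ 2 * B γ₃ (β p) ^ 2 =
      B γ₁ (β p) ^ 2 * B γ₃ (β p) ^ 2 + B γ₂ (β p) ^ 2 * B γ₃ (β p) ^ 2 -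
        2 * (B γ₁ (β p) ^ 2 * B γ₂ (β p) ^ 2 * B γ₃ (β p) ^ 2) := by
    intro p
    rw [map_sub, LinearMap.sub_apply, ← d4, ← d3]
    ring
  rw [Finset.sum_congr rfl fun p _ ↦ h7 p, Finset.sum_sub_distrib, Finset.sum_add_distrib, s13,
    s23, ← Finset.mul_sum] at h6
  linarith

end IsE8Coloring

lemma exists_eq_of_sum_eq {x y z : Fin 8 → ℚ} (hx : ∀ p, x p = 0 ∨ x p = 1)
    (hy : ∀ p, y p = 0 ∨ y p = 1) (hz : ∀ p, z p = 0 ∨ z p = 1) (sx : ∑ p, x p = 4)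
    (sy : ∑ p, y p = 4) (sz : ∑ p, z p = 4) (sxy : ∑ p, x p * y p = 2) (sxz : ∑ p, x p * z p = 2)
    (syz : ∑ p, y p * z p = 2) (sxyz : ∑ p, x p * y p * z p = 1) {a b c : ℚ} (ha : a = 0 ∨ a = 1)
    (hb : b = 0 ∨ b = 1) (hc : c = 0 ∨ c = 1) : ∃ p, x p = a ∧ y p = b ∧ z p = c := by
  by_contra! hn
  have h1 : ∑ p, (1 - a + (2 * a - 1) * x p) * (1 - b + (2 * b - 1) * y p) *
      (1 - c + (2 * c - 1) * z p) = 0 := by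
    refine Finset.sum_eq_zero fun p _ ↦ ?_
    have h2 := hn p
    rcases hx p with h3 | h3 <;> rcases hy p with h4 | h4 <;> rcases hz p with h5 | h5 <;>
      rcases ha with rfl | rfl <;> rcases hb with rfl | rfl <;> rcases hc with rfl | rfl <;>
      simp_all
  have h2 : ∀ p, (1 - a + (2 * a - 1) * x p) * (1 - b + (2 * b - 1) * y p) *
      (1 - c + (2 * c - 1) * z p) =
      (1 - a) * (1 - b) * (1 - c) + (2 * a - 1) * (1 - b) * (1 - c) * x p +
      (1 - a) * (2 * b - 1) * (1 - c) * y p + (1 - a) * (1 - b) * (2 * c - 1) * z p +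
      (2 * a - 1) * (2 * b - 1) * (1 - c) * (x p * y p) +
      (2 * a - 1) * (1 - b) * (2 * c - 1) * (x p * z p) +
      (1 - a) * (2 * b - 1) * (2 * c - 1) * (y p * z p) +
      (2 * a - 1) * (2 * b - 1) * (2 * c - 1) * (x p * y p * z p) := fun p ↦ by ring
  simp only [h2, Finset.sum_add_distrib, ← Finset.mul_sum, sx, sy, sz, sxy, sxz, syz, sxyz] at h1
  simp only [Finset.sum_const, Finset.card_univ, Fintype.card_fin, nsmul_eq_mul] at h1
  push_cast at h1
  ring_nf at h1
  norm_num at h1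

/-- The colors of the simple roots in the standard coloring of the `E₈` root system. -/
def e8Colors (i : Fin 8) : Fin 4 → ZMod 2 :=
  Pi.single ((![2, 3, 3, 0, 3, 1, 3, 0] : Fin 8 → Fin 4) i) 1

namespace IsE8Coloring

variable {V : Type*} [AddCommGroup V] [Module ℚ V] {B : LinearMap.BilinForm ℚ V} {Φ : Finset V}
  {cl : V → Fin 4 → ZMod 2}

lemma exists_frame_table (h : IsE8Coloring B Φ cl) :
    ∃ (β : Fin 8 → V) (γ₀ γ₁ γ₂ : V), (∀ p, β p ∈ Φ ∧ cl (β p) = Pi.single 3 1) ∧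
      (∀ p q, B (β p) (β q) = if p = q then 2 else 0) ∧
      (γ₀ ∈ Φ ∧ cl γ₀ = Pi.single 0 1 ∧
        ∀ p, B γ₀ (β p) ^ 2 = (![1, 1, 1, 0, 1, 0, 0, 0] : Fin 8 → ℚ) p) ∧
      (γ₁ ∈ Φ ∧ cl γ₁ = Pi.single 1 1 ∧
        ∀ p, B γ₁ (β p) ^ 2 = (![0, 0, 1, 1, 1, 1, 0, 0] : Fin 8 → ℚ) p) ∧
      (γ₂ ∈ Φ ∧ cl γ₂ = Pi.single 2 1 ∧
        ∀ p, B γ₂ (β p) ^ 2 = (![0, 1, 0, 0, 1, 1, 1, 0] : Fin 8 → ℚ) p) := by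
  obtain ⟨β, hβ, ho, -⟩ := h.exists_frame (c := Pi.single 3 1) (by decide)
  obtain ⟨ε₀, h0, -, -⟩ := h.exists_frame (c := Pi.single 0 1) (by decide)
  obtain ⟨ε₁, h1, -, -⟩ := h.exists_frame (c := Pi.single 1 1) (by decide)
  obtain ⟨ε₂, h2, -, -⟩ := h.exists_frame (c := Pi.single 2 1) (by decide)
  obtain ⟨g0, c0⟩ := h0 0
  obtain ⟨g1, c1⟩ := h1 0
  obtain ⟨g2, c2⟩ := h2 0
  have n0 : cl (ε₀ 0) ≠ Pi.single 3 1 := by rw [c0]; decide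
  have n1 : cl (ε₁ 0) ≠ Pi.single 3 1 := by rw [c1]; decide
  have n2 : cl (ε₂ 0) ≠ Pi.single 3 1 := by rw [c2]; decide
  have key : ∀ i : Fin 8, ∃ p,
      B (ε₀ 0) (β p) ^ 2 = (![1, 1, 1, 0, 1, 0, 0, 0] : Fin 8 → ℚ) i ∧
      B (ε₁ 0) (β p) ^ 2 = (![0, 0, 1, 1, 1, 1, 0, 0] : Fin 8 → ℚ) i ∧
      B (ε₂ 0) (β p) ^ 2 = (![0, 1, 0, 0, 1, 1, 1, 0] : Fin 8 → ℚ) i := by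
    intro i
    refine exists_eq_of_sum_eq (h.sq_sq hβ g0 n0) (h.sq_sq hβ g1 n1) (h.sq_sq hβ g2 n2)
      (h.sum_sq ho g0) (h.sum_sq ho g1) (h.sum_sq ho g2)
      (h.sum_eq_two hβ ho g0 n0 g1 n1 ?_ ?_) (h.sum_eq_two hβ ho g0 n0 g2 n2 ?_ ?_)
      (h.sum_eq_two hβ ho g1 n1 g2 n2 ?_ ?_)
      (h.sum_eq_one hβ ho g0 n0 g1 n1 g2 n2 ?_ ?_ ?_ ?_ ?_ ?_ ?_ ?_ ?_) ?_ ?_ ?_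
    any_goals first | rw [c0, c1, c2]; decide | rw [c0, c1]; decide | rw [c0, c2]; decide |
      rw [c1, c2]; decide
    all_goals fin_cases i <;> simp
  choose e he0 he1 he2 using key
  have hinj : Function.Injective e := by
    intro i j hij
    have t0 := he0 i
    have t1 := he1 i
    have t2 := he2 i
    rw [hij, he0 j] at t0
    rw [hij, he1 j] at t1
    rw [hij, he2 j] at t2
    fin_cases i <;> fin_cases j <;> simp at t0 t1 t2 ⊢
  exact ⟨β ∘ e, ε₀ 0, ε₁ 0, ε₂ 0, fun p ↦ hβ _, fun p q ↦ by simp [ho, hinj.eq_iff],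
    ⟨g0, c0, he0⟩, ⟨g1, c1, he1⟩, ⟨g2, c2, he2⟩⟩

/-- A coloring of the `E₈` root system admits a base with prescribed colors. -/
theorem exists_simple (h : IsE8Coloring B Φ cl) :
    ∃ r : Fin 8 → V, (∀ i, r i ∈ Φ) ∧
      (∀ i j, B (r i) (r j) = (CartanMatrix.E₈ i j : ℚ)) ∧ ∀ i, cl (r i) = e8Colors i := by
  obtain ⟨β, γ₀, γ₁, γ₂, hβ, ho, ⟨g0, c0, x0⟩, ⟨g1, c1, x1⟩, ⟨g2, c2, x2⟩⟩ := h.exists_frame_table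
  have n0 : cl γ₀ ≠ Pi.single 3 1 := by rw [c0]; decide
  have n1 : cl γ₁ ≠ Pi.single 3 1 := by rw [c1]; decide
  have n2 : cl γ₂ ≠ Pi.single 3 1 := by rw [c2]; decide
  obtain ⟨γ₃, g3, c3, x3⟩ := h.exists_complement hβ ho g0 n0
  have n3 : cl γ₃ ≠ Pi.single 3 1 := by rw [c3]; exact n0
  have nz : ∀ {γ : V} {p : Fin 8}, B γ (β p) ^ 2 = 1 → B γ (β p) ≠ 0 := fun h1 h2 ↦ by
    rw [h2] at h1; norm_num at h1
  have pm : ∀ {γ : V} {p : Fin 8}, B γ (β p) ^ 2 = 1 → B γ (β p) = 1 ∨ B γ (β p) = -1 :=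
    fun h1 ↦ sq_eq_one_iff.1 h1
  have neg_or : ∀ {x : ℚ}, x = 1 ∨ x = -1 → -x = 1 ∨ -x = -1 := fun {x} hx ↦ by
    rcases hx with rfl | rfl <;> norm_num
  obtain ⟨r₄, a1, a2, a3, a4⟩ := h.exists_signs hβ ho g0 n0 (f := 4) (nz (x0 4))
    (t := fun _ ↦ -1) fun _ ↦ Or.inr rfl
  have s1 := pm ((a4 4).trans (x0 4))
  obtain ⟨r₆, b1, b2, b3, b4⟩ := h.exists_signs hβ ho g1 n1 (f := 5) (nz (x1 5))
    (t := fun p ↦ if p = 4 then -B r₄ (β 4) else -1) fun p ↦ by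
      split_ifs
      exacts [neg_or s1, Or.inr rfl]
  have s2 := pm ((b4 5).trans (x1 5))
  obtain ⟨r₁, d1, d2, d3, d4⟩ := h.exists_signs hβ ho g2 n2 (f := 6) (nz (x2 6))
    (t := fun p ↦ if p = 4 then -B r₄ (β 4) else if p = 5 then -B r₆ (β 5) else -1) fun p ↦ by
      split_ifs
      exacts [neg_or s1, neg_or s2, Or.inr rfl]
  have s3 := pm ((d4 6).trans (x2 6))
  have x3' : B γ₃ (β 7) ^ 2 = 1 := (x3 7).trans (by simp [x0])
  obtain ⟨r₈, e1, e2, e3, e4⟩ := h.exists_signs hβ ho g3 n3 (f := 7) (nz x3')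
    (t := fun p ↦ if p = 5 then -B r₆ (β 5) else if p = 6 then -B r₁ (β 6) else -1) fun p ↦ by
      split_ifs
      exacts [neg_or s2, neg_or s3, Or.inr rfl]
  obtain ⟨s, hs⟩ : ∃ s, s = B r₄ (β 4) := ⟨_, rfl⟩
  obtain ⟨t, ht⟩ : ∃ t, t = B r₆ (β 5) := ⟨_, rfl⟩
  obtain ⟨w, hw⟩ : ∃ w, w = B r₁ (β 6) := ⟨_, rfl⟩
  obtain ⟨z, hz⟩ : ∃ z, z = B r₈ (β 7) := ⟨_, rfl⟩
  have row4 : ∀ p, B r₄ (β p) = (![-1, -1, -1, 0, s, 0, 0, 0] : Fin 8 → ℚ) p := fun p ↦ by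
    by_cases hp : p = 4
    · rw [hp, ← hs]; rfl
    · rw [a3 p hp, x0]
      revert hp
      fin_cases p <;> simp
  have row6 : ∀ p, B r₆ (β p) = (![0, 0, -1, -1, -s, t, 0, 0] : Fin 8 → ℚ) p := fun p ↦ by
    by_cases hp : p = 5
    · rw [hp, ← ht]; rfl
    · rw [b3 p hp, x1, ← hs]
      revert hp
      fin_cases p <;> simp
  have row1 : ∀ p, B r₁ (β p) = (![0, -1, 0, 0, -s, -t, w, 0] : Fin 8 → ℚ) p := fun p ↦ by
    by_cases hp : p = 6
    · rw [hp, ← hw]; rfl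
    · rw [d3 p hp, x2, ← hs, ← ht]
      revert hp
      fin_cases p <;> simp
  have row8 : ∀ p, B r₈ (β p) = (![0, 0, 0, -1, 0, -t, -w, z] : Fin 8 → ℚ) p := fun p ↦ by
    by_cases hp : p = 7
    · rw [hp, ← hz]; rfl
    · rw [e3 p hp, x3, x0, ← ht, ← hw]
      revert hp
      fin_cases p <;> simp
  have hs2 : s ^ 2 = 1 := by rw [hs, a4]; exact x0 4
  have ht2 : t ^ 2 = 1 := by rw [ht, b4]; exact x1 5
  have hw2 : w ^ 2 = 1 := by rw [hw, d4]; exact x2 6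
  have hz2 : z ^ 2 = 1 := by rw [hz, e4]; exact x3'
  clear hs ht hw hz s1 s2 s3
  refine ⟨![r₁, β 0, β 1, r₄, β 2, r₆, β 3, r₈], fun i ↦ ?_, fun i j ↦ ?_, fun i ↦ ?_⟩
  · fin_cases i
    exacts [d1, (hβ 0).1, (hβ 1).1, a1, (hβ 2).1, b1, (hβ 3).1, e1]
  · have hrow : ∀ i p, B ((![r₁, β 0, β 1, r₄, β 2, r₆, β 3, r₈] : Fin 8 → V) i) (β p) =
        (![![0, -1, 0, 0, -s, -t, w, 0], ![2, 0, 0, 0, 0, 0, 0, 0], ![0, 2, 0, 0, 0, 0, 0, 0],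
          ![-1, -1, -1, 0, s, 0, 0, 0], ![0, 0, 2, 0, 0, 0, 0, 0], ![0, 0, -1, -1, -s, t, 0, 0],
          ![0, 0, 0, 2, 0, 0, 0, 0], ![0, 0, 0, -1, 0, -t, -w, z]] : Fin 8 → Fin 8 → ℚ) i p := by
      intro i p
      fin_cases i
      · exact row1 p
      · refine (ho 0 p).trans ?_; fin_cases p <;> rfl
      · refine (ho 1 p).trans ?_; fin_cases p <;> rfl
      · exact row4 p
      · refine (ho 2 p).trans ?_; fin_cases p <;> rfl
      · exact row6 p
      · refine (ho 3 p).trans ?_; fin_cases p <;> rfl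
      · exact row8 p
    have h1 := h.e8.two_mul_form ho ((![r₁, β 0, β 1, r₄, β 2, r₆, β 3, r₈] : Fin 8 → V) i)
      ((![r₁, β 0, β 1, r₄, β 2, r₆, β 3, r₈] : Fin 8 → V) j)
    simp only [hrow] at h1
    refine mul_left_cancel₀ two_ne_zero (h1.trans ?_)
    clear h1 hrow row1 row4 row6 row8
    rw [Fin.sum_univ_eight]
    fin_cases i <;> fin_cases j <;> simp [CartanMatrix.E₈] <;> linarith
  · fin_cases i
    exacts [d2.trans c2, (hβ 0).2, (hβ 1).2, a2.trans c0, (hβ 2).2, b2.trans c1, (hβ 3).2,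
      e2.trans (c3.trans c0)]

end IsE8Coloring

lemma LieAlgebra.Basis.lieHom_ext {ι F L L' : Type*} [Fintype ι] [CommRing F] [LieRing L]
    [LieAlgebra F L] [LieRing L'] [LieAlgebra F L'] {H : LieSubalgebra F L}
    (b : LieAlgebra.Basis ι H) {φ ψ : L →ₗ⁅F⁆ L'} (he : ∀ i, φ (b.e i) = ψ (b.e i))
    (hf : ∀ i, φ (b.f i) = ψ (b.f i)) : φ = ψ := by
  let S : LieSubalgebra F L :=
    { LinearMap.eqLocus φ.toLinearMap ψ.toLinearMap with
      lie_mem' := fun {x y} hx hy ↦ by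
        have hx' : φ x = ψ x := hx
        have hy' : φ y = ψ y := hy
        change φ ⁅x, y⁆ = ψ ⁅x, y⁆
        rw [LieHom.map_lie, LieHom.map_lie, hx', hy'] }
  have h1 : S = ⊤ := by
    rw [eq_top_iff, ← b.span_ef, LieSubalgebra.lieSpan_le]
    rintro _ (⟨i, rfl⟩ | ⟨i, rfl⟩)
    exacts [he i, hf i]
  ext x
  have : x ∈ S := h1 ▸ LieSubalgebra.mem_top x
  exact this

namespace LieAlgebra

open IsKilling LieModule

variable {F L : Type*} [Field F] [IsAlgClosed F] [CharZero F] [LieRing L] [LieAlgebra F L]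
  [FiniteDimensional F L] [LieAlgebra.IsSimple F L]

section

variable {H : LieSubalgebra F L} [H.IsCartanSubalgebra]

lemma lie_eq_smul_of_mem_ratRootSpace {γ : (rootSystem H).rootSpan ℚ} {x : L}
    (hx : x ∈ ratRootSpace H γ) (h : H) : ⁅(h : L), x⁆ = (γ : Dual F H) h • x :=
  lie_eq_smul_of_mem_rootSpace hx h

lemma mem_ratRootSpace {γ : (rootSystem H).rootSpan ℚ} {x : L}
    (hx : ∀ h : H, ⁅(h : L), x⁆ = (γ : Dual F H) h • x) : x ∈ ratRootSpace H γ := by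
  refine weightSpace_le_genWeightSpace L _ ?_
  rw [mem_weightSpace]
  exact hx

lemma map_mem_ratRootSpace {φ : L ≃ₗ⁅F⁆ L} (hφ : ∀ h ∈ H, φ h = h)
    {γ : (rootSystem H).rootSpan ℚ} {x : L} (hx : x ∈ ratRootSpace H γ) :
    φ x ∈ ratRootSpace H γ := mem_ratRootSpace fun h ↦ by
  rw [← map_smul, ← lie_eq_smul_of_mem_ratRootSpace hx, LieEquiv.map_lie, hφ h h.2]

lemma map_mem_ratRootSpace_neg {φ : L ≃ₗ⁅F⁆ L} (hφ : ∀ h ∈ H, φ h = -h)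
    {γ : (rootSystem H).rootSpan ℚ} {x : L} (hx : x ∈ ratRootSpace H γ) :
    φ x ∈ ratRootSpace H (-γ) := mem_ratRootSpace fun h ↦ by
  have h1 := congr_arg φ (lie_eq_smul_of_mem_ratRootSpace hx h)
  rw [LieEquiv.map_lie, hφ h h.2, map_smul, neg_lie] at h1
  rw [← neg_inj, h1]
  simp

end

end LieAlgebra

namespace LieEquiv

variable {ι F L : Type*} [Field F] [IsAlgClosed F] [CharZero F] [LieRing L] [LieAlgebra F L]
  [FiniteDimensional F L] [LieAlgebra.IsSimple F L] [Finite ι] {τ : ι → L ≃ₗ⁅F⁆ L}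
  (hc : ∀ i j x, τ i (τ j x) = τ j (τ i x)) (h2 : ∀ i x, τ i (τ i x) = x)
  (h0 : jointEigenspace τ 0 = ⊥) (hdim : finrank F L = 248)
include hc h2 h0 hdim

lemma exists_isCartanSubalgebra_ge_jointEigenspace (a : ι → ZMod 2) :
    ∃ H : LieSubalgebra F L, H.IsCartanSubalgebra ∧ finrank F H.toSubmodule = 8 ∧
      jointEigenspace τ a ≤ H.toSubmodule := by
  obtain ⟨H, hH, hle⟩ := LieAlgebra.exists_isCartanSubalgebra_ge (jointEigenspace τ a)
    (fun x hx y hy ↦ lie_eq_zero_of_mem_jointEigenspace h0 hx hy)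
    (fun x hx ↦ isSemisimple_ad_of_mem_jointEigenspace hc h2 h0 hx)
  obtain ⟨B, hB⟩ := LieAlgebra.exists_isE8Decomposition H hdim
  exact ⟨H, hH, hB.zero ▸ hB.finrank_zero, hle⟩

lemma finrank_jointEigenspace_le (a : ι → ZMod 2) : finrank F (jointEigenspace τ a) ≤ 8 := by
  obtain ⟨H, -, h8, hle⟩ := exists_isCartanSubalgebra_ge_jointEigenspace hc h2 h0 hdim a
  exact h8 ▸ Submodule.finrank_mono hle

lemma exists_isCartanSubalgebra_eq_jointEigenspace {a : ι → ZMod 2}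
    (ha : finrank F (jointEigenspace τ a) = 8) :
    ∃ H : LieSubalgebra F L, H.IsCartanSubalgebra ∧ H.toSubmodule = jointEigenspace τ a := by
  obtain ⟨H, hH, h8, hle⟩ := exists_isCartanSubalgebra_ge_jointEigenspace hc h2 h0 hdim a
  exact ⟨H, hH, (Submodule.eq_of_le_of_finrank_eq hle (ha.trans h8.symm)).symm⟩

end LieEquiv

lemma eq_of_signVal_smul_eq {F M : Type*} [Field F] [CharZero F] [AddCommGroup M] [Module F M]
    {a b : ZMod 2} {x : M} (hx : x ≠ 0) (h : signVal F a • x = signVal F b • x) : a = b :=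
  signVal_injective (smul_left_injective F hx h)

/-- A basis of the Lie algebra of type `E₈` on which five involutions act in the standard way. -/
structure IsStandardFamily {F L : Type*} [Field F] [LieRing L] [LieAlgebra F L]
    (τ : Fin 5 → L ≃ₗ⁅F⁆ L) {H : LieSubalgebra F L} (b : LieAlgebra.Basis (Fin 8) H) : Prop where
  A_eq : b.A = CartanMatrix.E₈
  map_e : ∀ (k : Fin 4) i, τ k.castSucc (b.e i) = signVal F (e8Colors i k) • b.e i
  map_f : ∀ (k : Fin 4) i, τ k.castSucc (b.f i) = signVal F (e8Colors i k) • b.f i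
  swap_e : ∀ i, τ (Fin.last 4) (b.e i) = b.f i
  swap_f : ∀ i, τ (Fin.last 4) (b.f i) = b.e i

namespace LieAlgebra.IsE8Decomposition

variable {F L V : Type*} [Field F] [CharZero F] [LieRing L] [LieAlgebra F L]
  [AddCommGroup V] [Module ℚ V] {B : LinearMap.BilinForm ℚ V} {Φ : Finset V}
  {H : LieSubalgebra F L} {g : V → Submodule F L} (h : IsE8Decomposition B Φ H g)
  {τ : Fin 5 → L ≃ₗ⁅F⁆ L} (hc : ∀ i j x, τ i (τ j x) = τ j (τ i x)) (h2 : ∀ i x, τ i (τ i x) = x)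
  (hτ : ∀ (k : Fin 4) γ, ∀ x ∈ g γ, τ k.castSucc x ∈ g γ)
  (hσ : ∀ γ, ∀ x ∈ g γ, τ (Fin.last 4) x ∈ g (-γ))
include h h2

include hτ in
lemma exists_map_eq_signVal_smul {γ : V} (hγ : γ ∈ Φ) (k : Fin 4) :
    ∃ a, ∀ x ∈ g γ, τ k.castSucc x = signVal F a • x := by
  obtain ⟨x, hx, hx0⟩ := h.exists_ne_zero hγ
  obtain ⟨c, hcx⟩ := h.exists_smul_eq hγ hx hx0 (hτ k γ x hx)
  have h1 := h2 k.castSucc x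
  rw [← hcx, map_smul, ← hcx, smul_smul] at h1
  obtain ⟨a, rfl⟩ := exists_signVal_of_mul_self
    (smul_left_injective F hx0 (h1.trans (one_smul F x).symm))
  refine ⟨a, fun y hy ↦ ?_⟩
  obtain ⟨d, rfl⟩ := h.exists_smul_eq hγ hx hx0 hy
  rw [map_smul, ← hcx, smul_comm]

include hc hτ hσ

theorem exists_coloring (h0 : LieEquiv.jointEigenspace τ 0 = ⊥) :
    ∃ cl : V → Fin 4 → ZMod 2, IsE8Coloring B Φ cl ∧
      ∀ γ ∈ Φ, ∀ k, ∀ x ∈ g γ, τ k.castSucc x = signVal F (cl γ k) • x := by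
  have h1 : ∀ γ, ∃ a : Fin 4 → ZMod 2, γ ∈ Φ →
      ∀ k, ∀ x ∈ g γ, τ k.castSucc x = signVal F (a k) • x := fun γ ↦ by
    by_cases hγ : γ ∈ Φ
    · choose a ha using h.exists_map_eq_signVal_smul h2 hτ hγ
      exact ⟨a, fun _ ↦ ha⟩
    · exact ⟨0, fun h ↦ absurd h hγ⟩
  choose cl hcl using h1
  have hneg : ∀ γ ∈ Φ, cl (-γ) = cl γ := fun γ hγ ↦ by
    obtain ⟨x, hx, hx0⟩ := h.exists_ne_zero hγ
    funext k
    refine eq_of_signVal_smul_eq (F := F) (x := τ (Fin.last 4) x)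
      ((LieEquiv.injective _).ne_iff' (map_zero _) |>.2 hx0) ?_
    rw [← hcl _ (h.e8.neg_mem hγ) k _ (hσ γ x hx), hc, hcl γ hγ k x hx, map_smul]
  refine ⟨cl, ⟨h.e8, hneg, fun β hβ γ hγ hβγ ↦ ?_, fun γ hγ hz ↦ ?_⟩, hcl⟩
  · obtain ⟨x, hx, hx0⟩ := h.exists_ne_zero hβ
    obtain ⟨y, hy, hy0⟩ := h.exists_ne_zero hγ
    funext k
    refine eq_of_signVal_smul_eq (F := F) (x := ⁅x, y⁆)
      (h.lie_ne_zero β hβ γ hγ hβγ x hx y hy hx0 hy0) ?_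
    rw [← hcl _ (h.e8.add_mem hγ hβ hβγ) k _ (h.lie_mem _ _ _ hx _ hy), LieEquiv.map_lie,
      hcl β hβ k x hx, hcl γ hγ k y hy, Pi.add_apply, signVal_add, smul_lie, lie_smul, smul_smul]
  · obtain ⟨x, hx, hx0⟩ := h.exists_ne_zero hγ
    have h3 : x + τ (Fin.last 4) x ∈ LieEquiv.jointEigenspace τ 0 := by
      intro k
      rw [Pi.zero_apply, signVal_zero, one_smul, map_add]
      refine Fin.lastCases ?_ (fun k ↦ ?_) k
      · rw [h2, add_comm]
      · rw [hcl γ hγ k x hx, hcl _ (h.e8.neg_mem hγ) k _ (hσ γ x hx), hneg γ hγ, hz, Pi.zero_apply,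
          signVal_zero, one_smul, one_smul]
    rw [h0, Submodule.mem_bot] at h3
    have hne : γ ≠ -γ := fun h4 ↦ by
      have h5 := h.e8.norm γ hγ
      nth_rewrite 1 [h4] at h5
      rw [map_neg, LinearMap.neg_apply, h.e8.norm γ hγ] at h5
      norm_num at h5
    have hx' : x ∈ g (-γ) := by
      rw [eq_neg_of_add_eq_zero_left h3]
      exact neg_mem (hσ γ x hx)
    exact hx0 (Submodule.disjoint_def.1 (h.iSupIndep.pairwiseDisjoint hne) x hx hx')

theorem exists_isStandardFamily [IsAlgClosed F] (h0 : LieEquiv.jointEigenspace τ 0 = ⊥) :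
    ∃ b : Basis (Fin 8) H, IsStandardFamily τ b := by
  obtain ⟨cl, hcol, hcl⟩ := h.exists_coloring hc h2 hτ hσ h0
  obtain ⟨r, hr, hg, hrc⟩ := hcol.exists_simple
  have h1 : ∀ i, ∃ e ∈ g (r i), e ≠ 0 ∧
      ∀ δ, ∀ y ∈ g δ, ⁅⁅e, τ (Fin.last 4) e⁆, y⁆ = (B (r i) δ : F) • y := fun i ↦ by
    obtain ⟨x, hx, hx0⟩ := h.exists_ne_zero (hr i)
    obtain ⟨t, -, ht0, ht, hxt⟩ := h.exists_coroot _ (hr i)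
    obtain ⟨y, hy, rfl⟩ := hxt x hx hx0
    obtain ⟨c, rfl⟩ := h.exists_smul_eq (h.e8.neg_mem (hr i)) (hσ _ x hx)
      ((LieEquiv.injective _).ne_iff' (map_zero _) |>.2 hx0) hy
    obtain ⟨s, rfl⟩ := IsAlgClosed.exists_eq_mul_self c
    have hs : s ≠ 0 := by
      rintro rfl
      simp at ht0
    refine ⟨s • x, (g _).smul_mem s hx, smul_ne_zero hs hx0, fun δ y hy ↦ ?_⟩
    rw [map_smul, smul_lie, lie_smul, smul_smul, ← lie_smul]
    exact ht δ y hy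
  choose e he he0 hef using h1
  obtain ⟨b, hA, hbe, hbf⟩ := h.exists_basis hr hg he (fun i ↦ hσ _ _ (he i)) he0 hef
  refine ⟨b, hA, fun k i ↦ ?_, fun k i ↦ ?_, fun i ↦ ?_, fun i ↦ ?_⟩
  · rw [hbe, hcl _ (hr i) k _ (he i), hrc]
  · rw [hbf]
    dsimp only
    rw [hc, hcl _ (hr i) k _ (he i), hrc, map_smul]
  · rw [hbe, hbf]
  · rw [hbe, hbf, h2]

end LieAlgebra.IsE8Decomposition

namespace IsStandardFamily

variable {F L : Type*} [Field F] [CharZero F] [LieRing L] [LieAlgebra F L]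

theorem exists_equiv [FiniteDimensional F L] [LieAlgebra.IsSimple F L]
    {τ τ' : Fin 5 → L ≃ₗ⁅F⁆ L} {H H' : LieSubalgebra F L} {b : LieAlgebra.Basis (Fin 8) H}
    {b' : LieAlgebra.Basis (Fin 8) H'} (h : IsStandardFamily τ b) (h' : IsStandardFamily τ' b') :
    ∃ φ : L ≃ₗ⁅F⁆ L, ∀ k x, φ (τ k x) = τ' k (φ x) := by
  obtain ⟨φ, hφ⟩ := LieAlgebra.Basis.exists_equiv_of_A_eq b b' (h.A_eq.trans h'.A_eq.symm)
  refine ⟨φ, fun k x ↦ ?_⟩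
  have h1 : (φ : L →ₗ⁅F⁆ L).comp (τ k : L →ₗ⁅F⁆ L) =
      (τ' k : L →ₗ⁅F⁆ L).comp (φ : L →ₗ⁅F⁆ L) := by
    refine b.lieHom_ext (fun i ↦ ?_) fun i ↦ ?_ <;> refine Fin.lastCases ?_ (fun k ↦ ?_) k
    · change φ (τ _ _) = τ' _ (φ _)
      rw [h.swap_e, (hφ i).1, (hφ i).2, h'.swap_e]
    · change φ (τ _ _) = τ' _ (φ _)
      rw [h.map_e, map_smul, (hφ i).1, h'.map_e]
    · change φ (τ _ _) = τ' _ (φ _)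
      rw [h.swap_f, (hφ i).1, (hφ i).2, h'.swap_f]
    · change φ (τ _ _) = τ' _ (φ _)
      rw [h.map_f, map_smul, (hφ i).2, h'.map_f]
  exact DFunLike.congr_fun h1 x

end IsStandardFamily

lemma LieEquiv.map_jointEigenspace {ι F L : Type*} [Field F] [LieRing L] [LieAlgebra F L]
    {τ τ' : ι → L ≃ₗ⁅F⁆ L} {φ : L ≃ₗ⁅F⁆ L} (hφ : ∀ k x, φ (τ k x) = τ' k (φ x))
    (a : ι → ZMod 2) : (jointEigenspace τ a).map φ.toLinearEquiv.toLinearMap =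
      jointEigenspace τ' a := by
  ext y
  constructor
  · rintro ⟨x, hx, rfl⟩ k
    change τ' k (φ x) = _ • φ x
    rw [← hφ, hx k, map_smul]
  · intro hy
    refine ⟨φ.symm y, fun k ↦ ?_, φ.apply_symm_apply y⟩
    apply φ.injective
    change φ _ = φ _
    rw [hφ, map_smul, φ.apply_symm_apply, hy k]

lemma sum_e8Colors_ne_zero : ∀ w ∈ e8Words, (w.map e8Colors).sum ≠ 0 := by
  decide +kernel

namespace IsStandardFamily

variable {F L : Type*} [Field F] [LieRing L] [LieAlgebra F L] {τ : Fin 5 → L ≃ₗ⁅F⁆ L}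
  {H : LieSubalgebra F L} {b : LieAlgebra.Basis (Fin 8) H} (h : IsStandardFamily τ b)
include h

lemma map_map_comm (i j : Fin 5) (x : L) : τ i (τ j x) = τ j (τ i x) := by
  have h1 : (τ i : L →ₗ⁅F⁆ L).comp (τ j : L →ₗ⁅F⁆ L) =
      (τ j : L →ₗ⁅F⁆ L).comp (τ i : L →ₗ⁅F⁆ L) := by
    refine b.lieHom_ext (fun m ↦ ?_) fun m ↦ ?_ <;> change τ i (τ j _) = τ j (τ i _) <;>
      induction i using Fin.lastCases <;> induction j using Fin.lastCases <;>
      simp only [h.swap_e, h.swap_f, h.map_e, h.map_f, map_smul]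
    all_goals exact smul_comm _ _ _
  exact DFunLike.congr_fun h1 x

lemma map_map_self (i : Fin 5) (x : L) : τ i (τ i x) = x := by
  have h1 : (τ i : L →ₗ⁅F⁆ L).comp (τ i : L →ₗ⁅F⁆ L) = LieHom.id := by
    refine b.lieHom_ext (fun m ↦ ?_) fun m ↦ ?_ <;> change τ i (τ i _) = _ <;>
      induction i using Fin.lastCases <;>
      simp only [h.swap_e, h.swap_f, h.map_e, h.map_f, map_smul, smul_smul, signVal_mul_self,
        one_smul, LieHom.id_apply]
  exact DFunLike.congr_fun h1 x

lemma map_h (k : Fin 4) (i : Fin 8) : τ k.castSucc (b.h i) = b.h i := by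
  rw [← (b.sl2 i).lie_e_f, LieEquiv.map_lie, h.map_e, h.map_f, smul_lie, lie_smul, smul_smul,
    signVal_mul_self, one_smul]

lemma swap_h (i : Fin 8) : τ (Fin.last 4) (b.h i) = -b.h i := by
  rw [← (b.sl2 i).lie_e_f, LieEquiv.map_lie, h.swap_e, h.swap_f, lie_skew]

lemma map_of_mem (k : Fin 4) {x : L} (hx : x ∈ H) : τ k.castSucc x = x := by
  have h1 : H.toSubmodule ≤ LinearMap.eqLocus (τ k.castSucc).toLinearEquiv.toLinearMap
      LinearMap.id := by
    rw [b.coe_cartan_eq_span, Submodule.span_le]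
    rintro _ ⟨i, rfl⟩
    exact h.map_h k i
  exact h1 hx

lemma swap_of_mem {x : L} (hx : x ∈ H) : τ (Fin.last 4) x = -x := by
  have h1 : H.toSubmodule ≤ LinearMap.eqLocus (τ (Fin.last 4)).toLinearEquiv.toLinearMap
      (-LinearMap.id) := by
    rw [b.coe_cartan_eq_span, Submodule.span_le]
    rintro _ ⟨i, rfl⟩
    exact h.swap_h i
  exact h1 hx

end IsStandardFamily

namespace LieAlgebra.IsE8Decomposition

variable {F L V : Type*} [Field F] [CharZero F] [LieRing L] [LieAlgebra F L]
  [AddCommGroup V] [Module ℚ V] {B : LinearMap.BilinForm ℚ V} {Φ : Finset V}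
  {H : LieSubalgebra F L} {g : V → Submodule F L} (h : IsE8Decomposition B Φ H g)
  {r : Fin 8 → V} (hr : ∀ i, r i ∈ Φ) (hg : ∀ i j, B (r i) (r j) = (CartanMatrix.E₈ i j : ℚ))
include h hr hg

lemma map_of_word {τ : Fin 5 → L ≃ₗ⁅F⁆ L}
    (hτ : ∀ i k, ∀ x ∈ g (r i), τ k.castSucc x = signVal F (e8Colors i k) • x) :
    ∀ w ∈ e8Words, (w.map r).sum ∈ Φ ∧ ∀ (k : Fin 4), ∀ x ∈ g (w.map r).sum,
      τ k.castSucc x = signVal F ((w.map e8Colors).sum k) • x := by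
  refine e8Words_induction (fun i ↦ by simpa using ⟨hr i, hτ i⟩) fun i w ⟨hw, hP⟩ hi ↦ ?_
  have h1 : B (w.map r).sum (r i) = -1 := by rw [IsE8RootSystem.form_word hg, hi]; norm_num
  have h2 := h.e8.add_mem (hr i) hw h1
  rw [List.map_cons, List.sum_cons, add_comm (r i)]
  refine ⟨h2, fun k x hx ↦ ?_⟩
  obtain ⟨y, hy, hy0⟩ := h.exists_ne_zero hw
  obtain ⟨z, hz, hz0⟩ := h.exists_ne_zero (hr i)
  obtain ⟨c, rfl⟩ := h.exists_lie_eq hw (hr i) h1 hy hy0 hz hz0 hx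
  rw [List.map_cons, List.sum_cons, Pi.add_apply, signVal_add, LieEquiv.map_lie, map_smul,
    hP k y hy, hτ i k z hz, smul_lie, lie_smul, lie_smul, lie_smul, smul_smul, smul_smul,
    smul_smul]
  ring_nf

theorem exists_isStandardFamily_of_gram [FiniteDimensional F L] [LieAlgebra.IsSimple F L] :
    ∃ (τ : Fin 5 → L ≃ₗ⁅F⁆ L) (b : Basis (Fin 8) H), IsStandardFamily τ b ∧
      (∀ i, b.e i ∈ g (r i)) ∧ ∀ i, b.f i ∈ g (-r i) := by
  have h1 : ∀ i, ∃ e ∈ g (r i), e ≠ 0 ∧ ∃ f ∈ g (-r i),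
      ∀ δ, ∀ y ∈ g δ, ⁅⁅e, f⁆, y⁆ = (B (r i) δ : F) • y := fun i ↦ by
    obtain ⟨x, hx, hx0⟩ := h.exists_ne_zero (hr i)
    obtain ⟨t, -, ht0, ht, hxt⟩ := h.exists_coroot _ (hr i)
    obtain ⟨y, hy, rfl⟩ := hxt x hx hx0
    exact ⟨x, hx, hx0, y, hy, ht⟩
  choose e he he0 f hf hef using h1
  obtain ⟨b, hA, rfl, rfl⟩ := h.exists_basis hr hg he hf he0 hef
  have h2 : ∀ k : Fin 4, ∃ φ : L ≃ₗ⁅F⁆ L, ∀ i, φ (b.e i) = signVal F (e8Colors i k) • b.e i ∧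
      φ (b.f i) = signVal F (e8Colors i k) • b.f i := fun k ↦ by
    obtain ⟨b', hA', he', hf'⟩ := h.exists_basis hr hg
      (e := fun i ↦ signVal F (e8Colors i k) • b.e i)
      (f := fun i ↦ signVal F (e8Colors i k) • b.f i)
      (fun i ↦ (g _).smul_mem _ (he i)) (fun i ↦ (g _).smul_mem _ (hf i))
      (fun i ↦ smul_ne_zero (signVal_ne_zero _) (he0 i)) fun i δ y hy ↦ by
        rw [smul_lie, lie_smul, smul_smul, signVal_mul_self, one_smul]
        exact hef i δ y hy
    obtain ⟨φ, hφ⟩ := Basis.exists_equiv_of_A_eq b b' (hA.trans hA'.symm)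
    exact ⟨φ, fun i ↦ ⟨(hφ i).1.trans (congr_fun he' i), (hφ i).2.trans (congr_fun hf' i)⟩⟩
  choose t ht using h2
  obtain ⟨σ, hσ⟩ := Basis.exists_equiv_of_A_eq b b.symm rfl
  refine ⟨Fin.snoc (α := fun _ ↦ L ≃ₗ⁅F⁆ L) t σ, b, ⟨hA, fun k i ↦ ?_, fun k i ↦ ?_, fun i ↦ ?_,
    fun i ↦ ?_⟩, he, hf⟩
  · rw [Fin.snoc_castSucc]
    exact (ht k i).1
  · rw [Fin.snoc_castSucc]
    exact (ht k i).2
  · rw [Fin.snoc_last]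
    exact (hσ i).1
  · rw [Fin.snoc_last]
    exact (hσ i).2

theorem jointEigenspace_zero_eq_bot {τ : Fin 5 → L ≃ₗ⁅F⁆ L} {b : Basis (Fin 8) H}
    (hτ : IsStandardFamily τ b) (he : ∀ i, b.e i ∈ g (r i)) (hf : ∀ i, b.f i ∈ g (-r i)) :
    LieEquiv.jointEigenspace τ 0 = ⊥ := by
  set τ' : Fin 4 → L ≃ₗ⁅F⁆ L := fun k ↦ τ k.castSucc with hτ'
  have h1 := h.map_of_word hr hg (τ := τ) fun i k x hx ↦ by
    obtain ⟨c, rfl⟩ := h.exists_smul_eq (hr i) (he i) (b.sl2 i).e_ne_zero hx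
    rw [map_smul, hτ.map_e, smul_comm]
  have h2 := h.map_of_word (r := fun i ↦ -r i) (fun i ↦ h.e8.neg_mem (hr i))
    (fun i j ↦ by rw [map_neg, map_neg, LinearMap.neg_apply, neg_neg, hg]) (τ := τ)
    fun i k x hx ↦ by
      obtain ⟨c, rfl⟩ := h.exists_smul_eq (h.e8.neg_mem (hr i)) (hf i) (b.sl2 i).f_ne_zero hx
      rw [map_smul, hτ.map_f, smul_comm]
  have h3 : ∀ γ ∈ Φ, ∃ a ≠ 0, g γ ≤ LieEquiv.jointEigenspace τ' a := fun γ hγ ↦ by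
    obtain ⟨w, hw, rfl | rfl⟩ := h.e8.exists_word hr hg hγ
    · exact ⟨_, sum_e8Colors_ne_zero w hw, fun x hx k ↦ (h1 w hw).2 k x hx⟩
    · refine ⟨_, sum_e8Colors_ne_zero w hw, fun x hx k ↦ (h2 w hw).2 k x ?_⟩
      rwa [List.sum_map_neg_apply]
  let p : (Fin 4 → ZMod 2) → Submodule F L := fun a ↦
    if a = 0 then g 0 else LieEquiv.jointEigenspace τ' a
  have h5 : g 0 = LieEquiv.jointEigenspace τ' 0 := by
    have h6 := Submodule.eq_of_iSup_eq_top_of_le (p := p) (q := LieEquiv.jointEigenspace τ') ?_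
      (LieEquiv.iSupIndep_jointEigenspace fun i j x ↦ hτ.map_map_comm _ _ x) (fun a ↦ ?_) 0
    · simpa [p] using h6
    · rw [eq_top_iff, ← h.iSup_eq_top]
      refine iSup_le fun γ ↦ ?_
      by_cases h0 : γ = 0
      · rw [h0]
        exact le_trans (by simp [p]) (le_iSup p 0)
      by_cases hγ : γ ∈ Φ
      · obtain ⟨a, ha, hle⟩ := h3 γ hγ
        exact le_trans (by simpa [p, ha] using hle) (le_iSup p a)
      · rw [h.eq_bot γ h0 hγ]
        exact bot_le
    · by_cases ha : a = 0
      · simp only [p, ha, if_true]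
        rw [h.zero]
        intro x hx k
        rw [Pi.zero_apply, signVal_zero, one_smul]
        exact hτ.map_of_mem k hx
      · simp [p, ha]
  rw [eq_bot_iff]
  intro x hx
  have h6 : x ∈ g 0 := by
    rw [h5]
    exact fun k ↦ hx k.castSucc
  rw [h.zero] at h6
  have h7 := hx (Fin.last 4)
  rw [hτ.swap_of_mem h6, Pi.zero_apply, signVal_zero, one_smul, neg_eq_iff_add_eq_zero,
    ← two_smul F, smul_eq_zero] at h7
  exact (Submodule.mem_bot F).2 (h7.resolve_left two_ne_zero)

end LieAlgebra.IsE8Decomposition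

namespace LieEquiv

variable {F L : Type*} [Field F] [IsAlgClosed F] [CharZero F] [LieRing L] [LieAlgebra F L]
  [FiniteDimensional F L] [LieAlgebra.IsSimple F L] {τ : Fin 5 → L ≃ₗ⁅F⁆ L}
  (hc : ∀ i j x, τ i (τ j x) = τ j (τ i x)) (h2 : ∀ i x, τ i (τ i x) = x)
  (hdim : finrank F L = 248)
include hc h2 hdim

omit [LieAlgebra.IsSimple F L] hdim in
lemma isInternal_jointEigenspace : DirectSum.IsInternal (jointEigenspace τ) := by
  rw [DirectSum.isInternal_submodule_iff_iSupIndep_and_iSup_eq_top]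
  exact ⟨iSupIndep_jointEigenspace hc, iSup_jointEigenspace hc h2⟩

lemma sum_finrank_jointEigenspace :
    finrank F (jointEigenspace τ 0) +
      ∑ a ∈ Finset.univ.erase 0, finrank F (jointEigenspace τ a) = 248 := by
  rw [Finset.add_sum_erase _ (fun a ↦ finrank F (jointEigenspace τ a)) (Finset.mem_univ 0),
    ← (isInternal_jointEigenspace hc h2).finrank_eq_sum, hdim]

lemma jointEigenspace_zero_eq_bot (h8 : ∀ a, a ≠ 0 → finrank F (jointEigenspace τ a) = 8) :
    jointEigenspace τ 0 = ⊥ := by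
  have h1 := sum_finrank_jointEigenspace hc h2 hdim
  rw [Finset.sum_congr rfl fun a ha ↦ h8 a (Finset.ne_of_mem_erase ha), Finset.sum_const,
    Finset.card_erase_of_mem (Finset.mem_univ 0), Finset.card_univ, Fintype.card_fun, ZMod.card,
    Fintype.card_fin] at h1
  exact Submodule.finrank_eq_zero.1 (by simpa using h1)

lemma finrank_jointEigenspace_eq (h0 : jointEigenspace τ 0 = ⊥) (a : Fin 5 → ZMod 2) (ha : a ≠ 0) :
    finrank F (jointEigenspace τ a) = 8 := by
  have h1 := sum_finrank_jointEigenspace hc h2 hdim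
  rw [h0, finrank_bot, zero_add] at h1
  have h3 : ∑ a ∈ Finset.univ.erase (0 : Fin 5 → ZMod 2), 8 = 248 := by
    rw [Finset.sum_const, Finset.card_erase_of_mem (Finset.mem_univ 0), Finset.card_univ,
      Fintype.card_fun, ZMod.card, Fintype.card_fin]
    rfl
  exact (Finset.sum_eq_sum_iff_of_le fun a _ ↦ finrank_jointEigenspace_le hc h2 h0 hdim a).1
    (h1.trans h3.symm) a (Finset.mem_erase.2 ⟨ha, Finset.mem_univ a⟩)

lemma exists_isStandardFamily (h8 : ∀ a, a ≠ 0 → finrank F (jointEigenspace τ a) = 8) :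
    ∃ (H : LieSubalgebra F L) (b : LieAlgebra.Basis (Fin 8) H), IsStandardFamily τ b := by
  have h0 := jointEigenspace_zero_eq_bot hc h2 hdim h8
  obtain ⟨H, hH, hHa⟩ := exists_isCartanSubalgebra_eq_jointEigenspace hc h2 h0 hdim
    (h8 (Pi.single (Fin.last 4) 1) (Pi.single_ne_zero_iff.2 one_ne_zero))
  obtain ⟨B, hB⟩ := LieAlgebra.exists_isE8Decomposition H hdim
  have h1 : ∀ x ∈ H, ∀ k, τ k x = signVal F ((Pi.single (Fin.last 4) 1 : Fin 5 → ZMod 2) k) • x :=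
    fun x hx ↦ by
      rw [← LieSubalgebra.mem_toSubmodule, hHa] at hx
      exact hx
  refine ⟨H, hB.exists_isStandardFamily hc h2 (fun k γ x hx ↦ ?_) (fun γ x hx ↦ ?_) h0⟩
  · refine LieAlgebra.map_mem_ratRootSpace (fun y hy ↦ ?_) hx
    rw [h1 y hy, Pi.single_eq_of_ne (Fin.castSucc_lt_last k).ne, signVal_zero, one_smul]
  · refine LieAlgebra.map_mem_ratRootSpace_neg (fun y hy ↦ ?_) hx
    rw [h1 y hy, Pi.single_eq_same, signVal_one, neg_one_smul]

end LieEquiv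

lemma LieAlgebra.exists_isStandardFamily {F L : Type*} [Field F] [IsAlgClosed F] [CharZero F]
    [LieRing L] [LieAlgebra F L] [FiniteDimensional F L] [LieAlgebra.IsSimple F L]
    (hdim : finrank F L = 248) : ∃ (τ : Fin 5 → L ≃ₗ⁅F⁆ L) (H : LieSubalgebra F L)
      (b : Basis (Fin 8) H), IsStandardFamily τ b ∧ LieEquiv.jointEigenspace τ 0 = ⊥ := by
  obtain ⟨H, hH, -⟩ := exists_isCartanSubalgebra_ge (⊥ : Submodule F L)
    (fun x hx y _ ↦ by rw [(Submodule.mem_bot F).1 hx, zero_lie])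
    (fun x hx ↦ by
      rw [(Submodule.mem_bot F).1 hx, map_zero]
      exact Module.End.isSemisimple_zero)
  obtain ⟨B, hB⟩ := exists_isE8Decomposition H hdim
  obtain ⟨r, hr, hg⟩ := hB.e8.exists_gram
  obtain ⟨τ, b, hτ, he, hf⟩ := hB.exists_isStandardFamily_of_gram hr hg
  exact ⟨τ, H, b, hτ, hB.jointEigenspace_zero_eq_bot hr hg hτ he hf⟩

theorem jordan_grading_E8_Z2pow5 (F : Type*) [Field F] [IsAlgClosed F] [CharZero F]
    (L : Type*) [LieRing L] [LieAlgebra F L] [FiniteDimensional F L]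
    [LieAlgebra.IsSimple F L] (hdim : finrank F L = 248) :
    (∃ gr : (Fin 5 → ZMod 2) → Submodule F L, IsLieGrading F gr ∧
      ∀ a : Fin 5 → ZMod 2, a ≠ 0 → finrank F (gr a) = 8) ∧
    ∀ gr gr' : (Fin 5 → ZMod 2) → Submodule F L,
      IsLieGrading F gr → (∀ a : Fin 5 → ZMod 2, a ≠ 0 → finrank F (gr a) = 8) →
      IsLieGrading F gr' → (∀ a : Fin 5 → ZMod 2, a ≠ 0 → finrank F (gr' a) = 8) →
      GradingsEquiv F gr gr' := by
  constructor
  · obtain ⟨τ, H, b, hτ, h0⟩ := LieAlgebra.exists_isStandardFamily (F := F) (L := L) hdim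
    exact ⟨LieEquiv.jointEigenspace τ,
      ⟨LieEquiv.isInternal_jointEigenspace hτ.map_map_comm hτ.map_map_self,
        fun a b x hx y hy ↦ LieEquiv.lie_mem_jointEigenspace hx hy⟩,
      LieEquiv.finrank_jointEigenspace_eq hτ.map_map_comm hτ.map_map_self hdim h0⟩
  · intro gr gr' hgr h8 hgr' h8'
    obtain ⟨τ, hc, h2, hτ⟩ := hgr.exists_involutions
    obtain ⟨τ', hc', h2', hτ'⟩ := hgr'.exists_involutions
    obtain rfl : gr = LieEquiv.jointEigenspace τ := funext hτ
    obtain rfl : gr' = LieEquiv.jointEigenspace τ' := funext hτ'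
    obtain ⟨H, b, hb⟩ := LieEquiv.exists_isStandardFamily hc h2 hdim h8
    obtain ⟨H', b', hb'⟩ := LieEquiv.exists_isStandardFamily hc' h2' hdim h8'
    obtain ⟨φ, hφ⟩ := hb.exists_equiv hb'
    exact ⟨φ, fun a _ ↦ ⟨a, LieEquiv.map_jointEigenspace hφ a⟩⟩
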